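/- Let E be a coherent sheaf on P^m with supernatural cohomology, of dimension s, with root sequence z_1 > ... > z_s, and set z_0 = +∞ and z_{s+1} = −∞. Then for each 0 ≤ j ≤ s and each integer d: h^j(E(d)) = (rank(E)/s!) · ∏_{i=1}^{s} |d − z_i| if z_j > d > z_{j+1}, and h^j(E(d)) = 0 otherwise. -/

import Mathlib

open MvPolynomial Finset Module

noncomputable section

/-- The standard graded polynomial ring `S = K[x_1, …, x_n]`. -/
abbrev PolyS (K : Type) [Field K] (n : ℕ) : Type := MvPolynomial (Fin n) K

/-- The `K`-subspace of homogeneous polynomials of integer degree `z`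
(it is `0` if `z < 0`). -/
def homogZ (K : Type) [Field K] (n : ℕ) (z : ℤ) : Submodule K (PolyS K n) :=
  ⨆ (_ : 0 ≤ z), MvPolynomial.homogeneousSubmodule (Fin n) K z.toNat

/-- The degree-`ℓ` piece of the graded free module `⊕ₚ S(-dg p)`. -/
def freePiece {K : Type} [Field K] {n r : ℕ} (dg : Fin r → ℤ) (ℓ : ℤ) :
    Submodule K (Fin r → PolyS K n) :=
  Submodule.pi Set.univ fun p => homogZ K n (ℓ - dg p)

/-- A (homologically indexed) finite complex of graded free `S`-modules
`F₀ ← F₁ ← ⋯ ← F_len ← 0`, where `Fᵢ = ⊕ₚ S(-deg i p)` and the (degree `0`)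
map `Fᵢ₊₁ → Fᵢ` is given by the matrix `dd i`, whose entries are homogeneous
of the appropriate degrees. -/
structure FreeComplex (K : Type) [Field K] (n : ℕ) where
  len : ℕ
  rk : ℕ → ℕ
  deg : (i : ℕ) → Fin (rk i) → ℤ
  dd : (i : ℕ) → Matrix (Fin (rk i)) (Fin (rk (i+1))) (PolyS K n)
  rk_eq_zero : ∀ i, len < i → rk i = 0
  isHomog : ∀ i p q, dd i p q ∈ homogZ K n (deg (i+1) q - deg i p)
  isComplex : ∀ i, dd i * dd (i+1) = 0

variable {K : Type} [Field K] {n : ℕ}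

/-- `F` is exact in positive homological degrees; that is, it is a graded free
resolution of the finitely generated graded module `M = coker (F₁ → F₀)`. -/
def IsResolution (F : FreeComplex K n) : Prop :=
  ∀ i, LinearMap.ker ((F.dd i).mulVecLin) = LinearMap.range ((F.dd (i+1)).mulVecLin)

/-- The complex is minimal: entries of the differentials lie in the maximal ideal,
i.e. all (constant) entries between generators of equal degrees vanish. -/
def IsMinimal (F : FreeComplex K n) : Prop :=
  ∀ i p q, F.deg (i+1) q = F.deg i p → F.dd i p q = 0

/-- Betti number `β_{i,j}`: the number of generators of `Fᵢ` of degree `j`. -/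
def bettiNum (F : FreeComplex K n) (i : ℕ) (j : ℤ) : ℕ :=
  (Finset.univ.filter fun p => F.deg i p = j).card

/-- The dimension of the degree-`ℓ` piece of the module `M = coker (F₁ → F₀)`
resolved by `F`. -/
def MPieceDim (F : FreeComplex K n) (ℓ : ℤ) : ℕ :=
  finrank K ((freePiece (F.deg 0) ℓ) ⧸
    (Submodule.comap (freePiece (F.deg 0) ℓ).subtype
      ((LinearMap.range ((F.dd 0).mulVecLin)).restrictScalars K)))

/-- The Hilbert polynomial of the twisted free module `S(-a)` in `n` variables:
`binom (t - a + n - 1, n - 1)`. -/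
def genHilb (n : ℕ) (a : ℤ) : Polynomial ℚ :=
  if n = 0 then 0 else
    Polynomial.C (((n - 1).factorial : ℚ))⁻¹ *
      ∏ k ∈ Finset.range (n - 1),
        (Polynomial.X - Polynomial.C (a : ℚ) + Polynomial.C ((k : ℚ) + 1))

/-- The Hilbert polynomial of `M = coker (F₁ → F₀)`, computed from the free
resolution `F` by additivity. -/
def hilbPoly (F : FreeComplex K n) : Polynomial ℚ :=
  ∑ i ∈ Finset.range (F.len + 1),
    Polynomial.C ((-1 : ℚ) ^ i) * ∑ p : Fin (F.rk i), genHilb n (F.deg i p)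

/-- The Krull dimension of a module read off from its Hilbert polynomial:
`0` for the zero polynomial (finite length), `deg + 1` otherwise. -/
def polyDim (P : Polynomial ℚ) : ℕ := if P = 0 then 0 else P.natDegree + 1

/-- `M = coker (F₁ → F₀)` is a Cohen-Macaulay module of codimension `c`:
`F` is a minimal free resolution of length exactly `c` (so `pd M = c`, and by
Auslander–Buchsbaum `depth M = n - c`) and `dim M = n - c`. -/
def IsCMcodim (F : FreeComplex K n) (c : ℕ) : Prop :=
  IsResolution F ∧ IsMinimal F ∧ (∀ i, c < i → F.rk i = 0) ∧ F.rk c ≠ 0 ∧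
    polyDim (hilbPoly F) = n - c

/-- The multiplicity `e(M)` of a module of codimension `c`, computed from the
Betti numbers of a free resolution:
`e(M) = ((-1)^c / c!) ⬝ Σ_{i,j} (-1)^i β_{i,j} j^c`. -/
def multQ (F : FreeComplex K n) (c : ℕ) : ℚ :=
  ((-1 : ℚ) ^ c / c.factorial) *
    ∑ i ∈ Finset.range (F.len + 1),
      (-1 : ℚ) ^ i * ∑ p : Fin (F.rk i), ((F.deg i p : ℚ)) ^ c


/-- A (cohomologically indexed) finite complex of graded free `S`-modules
`0 → E⁰ → E¹ → ⋯ → E^len → 0`, where `Eⁱ = ⊕ₚ S(-deg i p)` and the (degree `0`)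
map `Eⁱ → Eⁱ⁺¹` is given by the matrix `dd i`. -/
structure CoComplex (K : Type) [Field K] (n : ℕ) where
  len : ℕ
  rk : ℕ → ℕ
  deg : (i : ℕ) → Fin (rk i) → ℤ
  dd : (i : ℕ) → Matrix (Fin (rk (i+1))) (Fin (rk i)) (PolyS K n)
  rk_eq_zero : ∀ i, len < i → rk i = 0
  isHomog : ∀ i p q, dd i p q ∈ homogZ K n (deg i q - deg (i+1) p)
  isComplex : ∀ i, dd (i+1) * dd i = 0

/-- The degree-`ℓ` part of the cocycles at cohomological position `i`. -/
def CoComplex.kerPiece (E : CoComplex K n) (i : ℕ) (ℓ : ℤ) :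
    Submodule K (Fin (E.rk i) → PolyS K n) :=
  ((LinearMap.ker ((E.dd i).mulVecLin)).restrictScalars K) ⊓ freePiece (E.deg i) ℓ

/-- The coboundaries at cohomological position `i` (as a `K`-subspace). -/
def CoComplex.imSub (E : CoComplex K n) : (i : ℕ) → Submodule K (Fin (E.rk i) → PolyS K n)
  | 0 => ⊥
  | (j+1) => (LinearMap.range ((E.dd j).mulVecLin)).restrictScalars K

/-- `dim_K (Hⁱ(E))_ℓ`, the dimension of the degree-`ℓ` component of the `i`-th
cohomology module of the complex `E`. -/
def cohomDim (E : CoComplex K n) (i : ℕ) (ℓ : ℤ) : ℕ :=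
  finrank K ((E.kerPiece i ℓ) ⧸
    (Submodule.comap (E.kerPiece i ℓ).subtype (E.imSub i)))

/-- The bilinear pairing `⟨F, E⟩ = Σ_{j ≤ i, k} (-1)^{i-j} β_{i,k}(F) ⬝ dim_K (H^j E)_{-k}`
of a free resolution `F` against a free cocomplex `E`. -/
def pairing (F : FreeComplex K n) (E : CoComplex K n) : ℤ :=
  ∑ i ∈ Finset.range (F.len + 1), ∑ j ∈ Finset.range (i + 1),
    (-1 : ℤ) ^ (i - j) * ∑ p : Fin (F.rk i), (cohomDim E j (-(F.deg i p)) : ℤ)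

/-- The modified pairing `⟨F, E⟩_{c,τ}`: terms with `j ≤ i` are kept when `j < τ`
or `j ≤ i - 2`, and the terms with `j = τ`, `i = τ + ε` (`ε ∈ {0,1}`) are kept
only when the degree `k` of the generator satisfies `k ≤ c + ε`. -/
def pairingMod (F : FreeComplex K n) (E : CoComplex K n) (c : ℤ) (τ : ℕ) : ℤ :=
  (∑ i ∈ Finset.range (F.len + 1), ∑ j ∈ Finset.range (i + 1),
    if j < τ ∨ j + 2 ≤ i then
      (-1 : ℤ) ^ (i - j) * ∑ p : Fin (F.rk i), (cohomDim E j (-(F.deg i p)) : ℤ)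
    else 0) +
  ∑ ε ∈ Finset.range 2,
    (-1 : ℤ) ^ ε * ∑ p ∈ Finset.univ.filter (fun p => F.deg (τ + ε) p ≤ c + ε),
      (cohomDim E τ (-(F.deg (τ + ε) p)) : ℤ)

/-- The dual cocomplex `Hom(F, S)`: `0 → F₀^∨ → F₁^∨ → ⋯`. Its `j`-th cohomology
is `Ext^j_S(M, S)` for the module `M` resolved by `F`. -/
def dualCo (F : FreeComplex K n) : CoComplex K n where
  len := F.len
  rk := F.rk
  deg := fun i p => -F.deg i p
  dd := fun i => (F.dd i).transpose
  rk_eq_zero := F.rk_eq_zero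
  isHomog := by
    intro i p q
    have h := F.isHomog i q p
    rw [neg_sub_neg]
    exact h
  isComplex := by
    intro i
    rw [← Matrix.transpose_mul, F.isComplex i, Matrix.transpose_zero]

/-- `dim_K Ext^j_S(M, S)_e`, where `M = coker (F₁ → F₀)` (zero for `j < 0`). -/
def extDim (F : FreeComplex K n) (j : ℤ) (e : ℤ) : ℕ :=
  if 0 ≤ j then cohomDim (dualCo F) j.toNat e else 0

/-- `h^i(𝓔(d)) = dim_K H^i(ℙ^{n-1}, 𝓔(d))` for the coherent sheaf `𝓔 = M~` on
`ℙ^{n-1}` associated to the module `M = coker (F₁ → F₀)` resolved by `F`,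
expressed via graded local duality:
`h^i(𝓔(d)) = dim Ext^{n-1-i}(M,S)_{-d-n}` for `i ≥ 1`, and
`h^0(𝓔(d)) = dim M_d - dim Ext^{n}(M,S)_{-d-n} + dim Ext^{n-1}(M,S)_{-d-n}`. -/
def sheafH (F : FreeComplex K n) (i : ℕ) (d : ℤ) : ℕ :=
  if i = 0 then
    MPieceDim F d - extDim F (n : ℤ) (-d - n) + extDim F ((n : ℤ) - 1) (-d - n)
  else extDim F ((n : ℤ) - 1 - i) (-d - n)

/-- The ideal generated by the `s × s` minors of a matrix. -/
def minorsIdeal {a b : ℕ} (M : Matrix (Fin a) (Fin b) (PolyS K n)) (s : ℕ) :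
    Ideal (PolyS K n) :=
  Ideal.span (Set.range fun fg : (Fin s ↪ Fin a) × (Fin s ↪ Fin b) =>
    (M.submatrix fg.1 fg.2).det)

/-- The `r`-th Fitting ideal of `M = coker (F₁ → F₀)`: the ideal of
`(rk F₀ - r)`-minors of the presentation matrix. -/
def fittingIdeal (F : FreeComplex K n) (r : ℤ) : Ideal (PolyS K n) :=
  if (F.rk 0 : ℤ) - r ≤ 0 then ⊤ else minorsIdeal (F.dd 0) ((F.rk 0 : ℤ) - r).toNat

/-- The irrelevant maximal ideal `(x_1, …, x_n)` of `S`. -/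
def irrel (K : Type) [Field K] (n : ℕ) : Ideal (PolyS K n) :=
  Ideal.span (Set.range (MvPolynomial.X : Fin n → PolyS K n))

/-- The coherent sheaf `M~` on `ℙ^{n-1}` associated to `M = coker (F₁ → F₀)` is a
locally free sheaf (vector bundle) of rank `r`: the Fitting ideal `Fitt_{r-1}(M)`
is zero and `Fitt_r(M)` contains a power of the irrelevant ideal. -/
def IsVectorBundle (F : FreeComplex K n) (r : ℕ) : Prop :=
  fittingIdeal F ((r : ℤ) - 1) = ⊥ ∧ ∃ N : ℕ, (irrel K n) ^ N ≤ fittingIdeal F r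

/-- The rank of a sheaf of dimension `s`: the normalized leading coefficient of
its Hilbert polynomial, `χ(𝓔(d)) = (rank 𝓔 / s!) d^s + O(d^{s-1})`. -/
def sheafRank (F : FreeComplex K n) (s : ℕ) : ℚ :=
  (s.factorial : ℚ) * (hilbPoly F).coeff s

/-- The sheaf `M~` has natural cohomology: for each `d` at most one `h^i(𝓔(d))`
is nonzero. -/
def HasNaturalCohomology (F : FreeComplex K n) : Prop :=
  ∀ (d : ℤ) (i i' : ℕ), sheafH F i d ≠ 0 → sheafH F i' d ≠ 0 → i = i'

/-- The sheaf `𝓔 = M~` (of dimension `s`) has supernatural cohomology with root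
sequence `z_1 > ⋯ > z_s`: it has natural cohomology and its Hilbert polynomial
`d ↦ χ(𝓔(d))` has the distinct integral roots `z_1 > ⋯ > z_s`. -/
def IsSupernaturalWithRoots (F : FreeComplex K n) {s : ℕ} (z : Fin s → ℤ) : Prop :=
  StrictAnti z ∧ HasNaturalCohomology F ∧
    ∃ a : ℚ, a ≠ 0 ∧
      hilbPoly F = Polynomial.C a * ∏ i : Fin s, (Polynomial.X - Polynomial.C ((z i : ℚ)))


/-- number of roots above `d` -/
def combN {s : ℕ} (z : Fin s → ℤ) (d : ℤ) : ℕ := (univ.filter fun i => d < z i).card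

lemma combN_split {s : ℕ} (z : Fin s → ℤ) {c c' : ℤ} (h : c' ≤ c) :
    combN z c' = combN z c + (univ.filter fun i => c' < z i ∧ z i ≤ c).card := by
  unfold combN
  rw [← card_union_of_disjoint]
  · congr 1
    ext i
    simp only [mem_filter, mem_univ, true_and, mem_union]
    omega
  · rw [disjoint_filter]
    intro i _ h1 h2
    omega

lemma combN_le {s : ℕ} (z : Fin s → ℤ) (hz : StrictAnti z) {c c' : ℤ} (h : c' < c)
    (hc : ∀ i, z i ≠ c) : (combN z c' : ℤ) ≤ combN z c + (c - c' - 1) := by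
  rw [combN_split z h.le]
  have h1 : (univ.filter fun i => c' < z i ∧ z i ≤ c).card ≤ (Finset.Ioo c' c).card := by
    rw [← card_image_of_injective _ hz.injective]
    apply card_le_card
    intro x hx
    simp only [mem_image, mem_filter, mem_univ, true_and] at hx
    obtain ⟨i, hi, rfl⟩ := hx
    have := hc i
    rw [Finset.mem_Ioo]
    omega
  rw [Int.card_Ioo] at h1
  push_cast
  omega

lemma combN_eq {s : ℕ} (z : Fin s → ℤ) (hz : StrictAnti z) {c : ℤ} (k : ℕ)
    (hc : ∀ i, z i ≠ c + 1 + k) (hr : ∀ l : ℕ, l < k → ∃ i, z i = c + 1 + l) :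
    combN z c = combN z (c + 1 + k) + k := by
  rw [combN_split z (show c ≤ c + 1 + k by omega)]
  congr 1
  have h1 : (univ.filter fun i => c < z i ∧ z i ≤ c + 1 + k).image z =
      (Finset.Ioo c (c + 1 + k)) := by
    ext x
    simp only [mem_image, mem_filter, mem_univ, true_and, Finset.mem_Ioo]
    constructor
    · rintro ⟨i, hi, rfl⟩
      have := hc i
      omega
    · intro hx
      obtain ⟨i, hi⟩ := hr (x - c - 1).toNat (by omega)
      exact ⟨i, by omega, by omega⟩
  rw [← card_image_of_injective _ hz.injective, h1, Int.card_Ioo]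
  omega

lemma combN_iff {s : ℕ} (z : Fin s → ℤ) (hz : StrictAnti z) (d : ℤ) (j : ℕ) (hj : j ≤ s) :
    ((∀ i : Fin s, (i : ℕ) < j → d < z i) ∧ (∀ i : Fin s, j ≤ (i : ℕ) → z i < d)) ↔
      ((∀ i, z i ≠ d) ∧ combN z d = j) := by
  constructor
  · rintro ⟨h1, h2⟩
    refine ⟨fun i hi => ?_, ?_⟩
    · by_cases h : (i : ℕ) < j
      · have := h1 i h; omega
      · have := h2 i (by omega); omega
    · unfold combN
      have : (univ.filter fun i => d < z i) = univ.filter (fun i : Fin s => (i : ℕ) < j) := by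
        ext i
        simp only [mem_filter, mem_univ, true_and]
        refine ⟨fun h => ?_, h1 i⟩
        by_contra hc
        have := h2 i (by omega)
        omega
      rw [this, Fin.card_filter_val_lt]
      omega
  · rintro ⟨h0, rfl⟩
    refine ⟨fun i hi => ?_, fun i hi => ?_⟩
    · by_contra hc
      have : combN z d ≤ (univ.filter (fun i' : Fin s => (i' : ℕ) < i)).card := by
        apply card_le_card
        intro i' hi'
        simp only [mem_filter, mem_univ, true_and] at hi' ⊢
        by_contra hlt
        have : z i' ≤ z i := hz.antitone (by rw [Fin.le_def]; omega)
        omega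
      rw [Fin.card_filter_val_lt] at this
      omega
    · by_contra hc
      have h3 := h0 i
      have : (univ.filter (fun i' : Fin s => (i' : ℕ) < i + 1)).card ≤ combN z d := by
        apply card_le_card
        intro i' hi'
        simp only [mem_filter, mem_univ, true_and] at hi' ⊢
        have : z i ≤ z i' := hz.antitone (by rw [Fin.le_def]; omega)
        omega
      rw [Fin.card_filter_val_lt] at this
      have := i.2
      omega

theorem combi (h : ℕ → ℤ → ℕ) (n s : ℕ) (z : Fin s → ℤ) (hz : StrictAnti z)
    (nat : ∀ d i i', h i d ≠ 0 → h i' d ≠ 0 → i = i') (a : ℚ) (ha : a ≠ 0)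
    (hχ : ∀ d : ℤ, a * ∏ i, ((d : ℚ) - z i) = ∑ i ∈ range n, (-1 : ℚ) ^ i * h i d)
    (hbig : ∀ i d, n ≤ i → h i d = 0)
    (SD : ∀ i c, h i c ≠ 0 → ∃ k : ℕ, h (i + k) (c - 1 - k) ≠ 0)
    (Fv : ∀ i d, s < i → h i d = 0) (j : ℕ) (hj : j ≤ s) (d : ℤ) :
    (h j d : ℚ) =
      if (∀ i : Fin s, (i : ℕ) < j → d < z i) ∧ (∀ i : Fin s, j ≤ (i : ℕ) → z i < d) then
        a * ∏ i : Fin s, |(d : ℚ) - (z i : ℚ)| else 0 := by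
  classical
  -- single term
  have single : ∀ d q, h q d ≠ 0 → a * ∏ i, ((d : ℚ) - z i) = (-1 : ℚ) ^ q * h q d := by
    intro d q hq
    rw [hχ]
    apply Finset.sum_eq_single_of_mem
    · rw [mem_range]
      by_contra hc
      exact hq (hbig q d (by omega))
    · intro b _ hb
      have : h b d = 0 := by
        by_contra hc
        exact hb (nat d b q hc hq)
      simp [this]
  have root : ∀ d i, h i d ≠ 0 → ∀ k, z k ≠ d := by
    intro d i hi k hk
    have := single d i hi
    rw [Finset.prod_eq_zero (mem_univ k) (by rw [hk]; simp), mul_zero] at this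
    have h2 : (h i d : ℚ) ≠ 0 := by exact_mod_cast hi
    exact (mul_ne_zero (pow_ne_zero _ (by norm_num)) h2) this.symm
  have nonroot : ∀ d, (∀ k, z k ≠ d) → ∃ q, h q d ≠ 0 := by
    intro d hd
    by_contra hc
    push Not at hc
    have := hχ d
    rw [Finset.sum_eq_zero (by intro i _; rw [hc]; simp)] at this
    have h2 : ∏ i, ((d : ℚ) - z i) ≠ 0 := by
      rw [Finset.prod_ne_zero_iff]
      intro i _ h3
      apply hd i
      have : (d : ℚ) = z i := by linarith
      exact_mod_cast this.symm
    exact mul_ne_zero ha h2 this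
  obtain ⟨B, hB⟩ : ∃ B : ℤ, ∀ i, |z i| < B := by
    refine ⟨∑ i, |z i| + 1, fun i => ?_⟩
    have := Finset.single_le_sum (f := fun i => |z i|) (fun i _ => abs_nonneg _) (mem_univ i)
    omega
  have hB1 : ∀ i, z i < B := fun i => (abs_lt.mp (hB i)).2
  have hB2 : ∀ i, -B < z i := fun i => (abs_lt.mp (hB i)).1
  have step1 : ∀ m : ℕ, ∀ c, c ≤ -B + m → ∀ i, h i c ≠ 0 → i ≤ combN z c := by
    intro m
    induction m with
    | zero =>
      intro c hc i hi
      have : combN z c = s := by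
        unfold combN
        rw [filter_true_of_mem]
        · simp
        · intro i _
          have := hB2 i
          push_cast at hc
          omega
      rw [this]
      by_contra h3
      exact hi (Fv i c (by omega))
    | succ m ih =>
      intro c hc i hi
      obtain ⟨k, hk⟩ := SD i c hi
      have h1 := ih (c - 1 - k) (by push_cast at hc; omega) _ hk
      have h2 := combN_le z hz (show c - 1 - k < c by omega) (root c i hi)
      omega
  have step1' : ∀ c i, h i c ≠ 0 → i ≤ combN z c := fun c i hi =>
    step1 (c + B).toNat c (by omega) i hi
  have step2 : ∀ m : ℕ, ∀ c, B ≤ c + m → (∀ k, z k ≠ c) → h (combN z c) c ≠ 0 := by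
    intro m
    induction m using Nat.strong_induction_on with
    | _ m ih =>
      intro c hc hnr
      by_cases hcB : B ≤ c
      · obtain ⟨q, hq⟩ := nonroot c hnr
        have h1 := step1' c q hq
        have h2 : combN z c = 0 := by
          unfold combN
          rw [card_eq_zero, filter_eq_empty_iff]
          intro i _
          have := hB1 i
          omega
        rw [h2] at h1 ⊢
        have : q = 0 := by omega
        rwa [this] at hq
      · have hex : ∃ k : ℕ, ∀ i, z i ≠ c + 1 + k := ⟨m, fun i => by have := hB1 i; omega⟩
        let k := Nat.find hex
        have hk : ∀ i, z i ≠ c + 1 + k := Nat.find_spec hex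
        have hk' : ∀ l : ℕ, l < k → ∃ i, z i = c + 1 + l := by
          intro l hl
          have := Nat.find_min hex hl
          push Not at this
          exact this
        have hN := combN_eq z hz k hk hk'
        have h1 : h (combN z (c + 1 + k)) (c + 1 + k) ≠ 0 :=
          ih (m - 1) (by omega) (c + 1 + k) (by omega) hk
        obtain ⟨k', hk2⟩ := SD _ _ h1
        rcases lt_trichotomy k' k with hlt | heq | hgt
        · exfalso
          obtain ⟨i, hi⟩ := hk' (k - 1 - k') (by omega)
          exact root _ _ hk2 i (by omega)
        · rw [heq] at hk2
          rw [hN]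
          convert hk2 using 2
          omega
        · exfalso
          have h3 := step1' _ _ hk2
          have h4 := combN_le z hz (show c + 1 + k - 1 - k' < c by omega) hnr
          omega
  have step2' : ∀ c, (∀ k, z k ≠ c) → h (combN z c) c ≠ 0 := fun c hc =>
    step2 (B - c).toNat c (by omega) hc
  have apos : 0 < a := by
    have hnr : ∀ k, z k ≠ B := fun k => (hB1 k).ne
    have h1 := step2' B hnr
    have h2 := single _ _ h1
    have h3 : combN z B = 0 := by
      unfold combN
      rw [card_eq_zero, filter_eq_empty_iff]
      intro i _
      have := hB1 i
      omega
    rw [h3] at h2 h1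
    have h4 : 0 < ∏ i, ((B : ℚ) - z i) := by
      apply Finset.prod_pos
      intro i _
      have : (z i : ℚ) < B := by exact_mod_cast hB1 i
      linarith
    have h5 : (0 : ℚ) < h 0 B := by exact_mod_cast Nat.pos_of_ne_zero h1
    rw [pow_zero, one_mul] at h2
    rw [← h2] at h5
    exact (pos_iff_pos_of_mul_pos h5).mpr h4
  split_ifs with hcond
  · rw [combN_iff z hz d j hj] at hcond
    obtain ⟨h1, rfl⟩ := hcond
    have h2 := single d _ (step2' d h1)
    have h3 := congrArg abs h2
    rw [abs_mul, abs_mul, abs_pow, abs_neg, abs_one, one_pow, one_mul, Finset.abs_prod,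
      abs_of_pos apos, Nat.abs_cast] at h3
    exact h3.symm
  · rw [combN_iff z hz d j hj] at hcond
    by_contra hc
    have hc' : h j d ≠ 0 := by exact_mod_cast hc
    have h1 := root d j hc'
    exact hcond ⟨h1, nat d _ _ (step2' d h1) hc'⟩

lemma homogZ_of_nonneg {z : ℤ} (hz : 0 ≤ z) :
    homogZ K n z = MvPolynomial.homogeneousSubmodule (Fin n) K z.toNat := by
  unfold homogZ
  exact iSup_pos hz

lemma homogZ_of_neg {z : ℤ} (hz : z < 0) : homogZ K n z = ⊥ := by
  unfold homogZ
  exact iSup_neg (by omega)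

lemma homogZ_nat (k : ℕ) :
    homogZ K n k = MvPolynomial.homogeneousSubmodule (Fin n) K k := by
  rw [homogZ_of_nonneg (by positivity)]; simp

instance homogZ_fin (z : ℤ) : FiniteDimensional K (homogZ K n z) := by
  rcases lt_or_ge z 0 with h | h
  · rw [homogZ_of_neg h]; infer_instance
  · rw [homogZ_of_nonneg h]
    exact Module.Finite.of_fg (homogeneousSubmodule_fg _ _ _)

lemma finrank_homog (k : ℕ) :
    finrank K (MvPolynomial.homogeneousSubmodule (Fin n) K k) = Nat.multichoose n k := by
  rw [homogeneousSubmodule_eq_finsupp_supported]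
  rw [(AddMonoidAlgebra.supportedEquivFinsupp (R := K) (S := K) {d : Fin n →₀ ℕ | d.degree = k}).finrank_eq]
  have e : {d : Fin n →₀ ℕ | d.degree = k} ≃ Sym (Fin n) k :=
    (Equiv.subtypeEquivRight (fun d => by
      rfl)).trans (Sym.equivNatSum (Fin n) k).symm
  have : Fintype {d : Fin n →₀ ℕ | d.degree = k} := Fintype.ofEquiv _ e.symm
  rw [Module.finrank_finsupp_self, Fintype.card_congr e, Sym.card_sym_eq_multichoose]
  simp

def hdim (n : ℕ) (z : ℤ) : ℕ := if 0 ≤ z then Nat.multichoose n z.toNat else 0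

lemma finrank_homogZ (z : ℤ) : finrank K (homogZ K n z) = hdim n z := by
  unfold hdim
  split_ifs with h
  · rw [homogZ_of_nonneg h, finrank_homog]
  · rw [homogZ_of_neg (by omega)]; simp

lemma prod_choose (m w : ℕ) :
    ((m.factorial : ℚ))⁻¹ * ∏ k ∈ Finset.range m, ((w : ℚ) + (k + 1)) =
      (Nat.multichoose (m + 1) w : ℚ) := by
  rw [Nat.multichoose_eq]
  have h1 : m + 1 + w - 1 = w + m := by omega
  rw [h1, show (w + m).choose w = (w+m).choose m by
    rw [← Nat.choose_symm_of_eq_add (show w + m = m + w by omega)]]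
  have h2 := Nat.ascFactorial_eq_factorial_mul_choose w m
  have h3 : ((w+1).ascFactorial m : ℚ) = ∏ k ∈ Finset.range m, ((w : ℚ) + (k + 1)) := by
    rw [Nat.ascFactorial_eq_prod_range]
    push_cast
    exact Finset.prod_congr rfl fun k _ => by ring
  rw [← h3, h2]
  push_cast
  have : (m.factorial : ℚ) ≠ 0 := by exact_mod_cast m.factorial_ne_zero
  field_simp

lemma genHilb_eval (m : ℕ) (a d : ℤ) :
    (genHilb (m + 1) a).eval (d : ℚ) =
      (hdim (m+1) (d - a) : ℚ) + (-1) ^ m * hdim (m+1) (a - d - (m + 1 : ℕ)) := by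
  have h0 : (genHilb (m + 1) a).eval (d : ℚ) =
      ((m.factorial : ℚ))⁻¹ * ∏ k ∈ Finset.range m, (((d - a : ℤ) : ℚ) + (k + 1)) := by
    unfold genHilb
    simp [Polynomial.eval_prod]
  rw [h0]
  unfold hdim
  rcases lt_or_ge (d - a) 0 with h | h
  · rw [if_neg (by omega)]
    rcases lt_or_ge (a - d - (m+1 : ℕ)) 0 with h' | h'
    · rw [if_neg (by omega)]
      rw [Finset.prod_eq_zero (i := (a - d - 1).toNat)]
      · simp
      · rw [Finset.mem_range]; omega
      · have : (((a - d - 1).toNat : ℤ)) = a - d - 1 := by omega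
        have h5 : (((a - d - 1).toNat : ℚ)) = a - d - 1 := by exact_mod_cast this
        rw [h5]; push_cast; ring
    · rw [if_pos h']
      set w := (a - d - (m+1 : ℕ)).toNat with hw
      have hw' : (w : ℤ) = a - d - (m+1 : ℕ) := by omega
      have hw2 : (w : ℚ) = a - d - (m+1) := by exact_mod_cast hw'
      rw [← prod_choose, ← Finset.prod_range_reflect]
      have : ∏ j ∈ Finset.range m, (((d - a : ℤ) : ℚ) + (((m - 1 - j : ℕ) : ℚ) + 1)) =
          ∏ j ∈ Finset.range m, ((-1) * ((w : ℚ) + (j + 1))) := by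
        apply Finset.prod_congr rfl
        intro j hj
        rw [Finset.mem_range] at hj
        rw [Nat.cast_sub (by omega), Nat.cast_sub (by omega), hw2]
        push_cast
        ring
      rw [this, Finset.prod_mul_distrib]
      simp
      ring
  · rw [if_pos h, if_neg (by omega)]
    have : (((d - a : ℤ)) : ℚ) = ((d - a).toNat : ℚ) := by
      have : (d - a) = ((d - a).toNat : ℤ) := by omega
      exact_mod_cast this
    rw [this, prod_choose]
    simp

/-- homogeneous component of integer degree -/
def compZ (z : ℤ) : PolyS K n →ₗ[K] PolyS K n :=
  if 0 ≤ z then homogeneousComponent z.toNat else 0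

lemma compZ_mem (z : ℤ) (p : PolyS K n) : compZ z p ∈ homogZ K n z := by
  unfold compZ
  split_ifs with h
  · rw [homogZ_of_nonneg h]
    exact homogeneousComponent_mem z.toNat p
  · simp

lemma compZ_of_mem {z : ℤ} {p : PolyS K n} (hp : p ∈ homogZ K n z) : compZ z p = p := by
  unfold compZ
  split_ifs with h
  · rw [homogZ_of_nonneg h] at hp
    rw [homogeneousComponent_of_mem hp]; simp
  · rw [homogZ_of_neg (by omega)] at hp
    simp at hp
    simp [hp]

lemma homogZ_mul {a b : ℤ} {f g : PolyS K n} (hf : f ∈ homogZ K n a) (hg : g ∈ homogZ K n b) :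
    f * g ∈ homogZ K n (a + b) := by
  rcases lt_or_ge a 0 with h | h
  · rw [homogZ_of_neg h] at hf
    simp at hf
    simp [hf]
  rcases lt_or_ge b 0 with h' | h'
  · rw [homogZ_of_neg h'] at hg
    simp at hg
    simp [hg]
  rw [homogZ_of_nonneg h] at hf
  rw [homogZ_of_nonneg h'] at hg
  rw [homogZ_of_nonneg (by omega), show (a + b).toNat = a.toNat + b.toNat by omega]
  exact homogeneousSubmodule_mul _ _ (Submodule.mul_mem_mul hf hg)

lemma compZ_of_mem_ne {z w : ℤ} {p : PolyS K n} (hp : p ∈ homogZ K n w) (hzw : w ≠ z) :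
    compZ z p = 0 := by
  unfold compZ
  rcases lt_or_ge w 0 with h | h
  · rw [homogZ_of_neg h] at hp
    simp at hp
    simp [hp]
  · rw [homogZ_of_nonneg h] at hp
    split_ifs with h2
    · rw [homogeneousComponent_of_mem hp, if_neg (by omega)]
    · simp

lemma compZ_mul {c : ℤ} {f : PolyS K n} (hf : f ∈ homogZ K n c) (z : ℤ) (p : PolyS K n) :
    compZ (z + c) (f * p) = f * compZ z p := by
  conv_lhs => rw [← sum_homogeneousComponent p]
  conv_rhs => rw [← sum_homogeneousComponent p]
  rw [Finset.mul_sum, map_sum, map_sum, Finset.mul_sum]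
  refine Finset.sum_congr rfl fun i _ => ?_
  have h1 : homogeneousComponent i p ∈ homogZ K n i := by
    rw [homogZ_nat]; exact homogeneousComponent_mem i p
  have h2 := homogZ_mul hf h1
  by_cases h : (i : ℤ) = z
  · subst h
    rw [compZ_of_mem h1, compZ_of_mem]
    rwa [add_comm]
  · rw [compZ_of_mem_ne h1 h, compZ_of_mem_ne h2 (by omega), mul_zero]

lemma mem_freePiece {r : ℕ} {dg : Fin r → ℤ} {ℓ : ℤ} {v : Fin r → PolyS K n} :
    v ∈ freePiece dg ℓ ↔ ∀ p, v p ∈ homogZ K n (ℓ - dg p) := by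
  unfold freePiece
  simp [Submodule.mem_pi]

instance freePiece_fin {r : ℕ} (dg : Fin r → ℤ) (ℓ : ℤ) :
    FiniteDimensional K (freePiece (K := K) (n := n) dg ℓ) := by
  have : (freePiece (K := K) (n := n) dg ℓ) ≤
    LinearMap.range (LinearMap.piMap (R := K) fun p => (homogZ K n (ℓ - dg p)).subtype) := by
    intro v hv
    rw [mem_freePiece] at hv
    exact ⟨fun p => ⟨v p, hv p⟩, rfl⟩
  exact Submodule.finiteDimensional_of_le this

lemma finrank_freePiece {r : ℕ} (dg : Fin r → ℤ) (ℓ : ℤ) :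
    finrank K (freePiece (K := K) (n := n) dg ℓ) = ∑ p, hdim n (ℓ - dg p) := by
  have e : (freePiece (K := K) (n := n) dg ℓ) ≃ₗ[K] (∀ p, homogZ K n (ℓ - dg p)) :=
    { toFun := fun v p => ⟨v.1 p, mem_freePiece.1 v.2 p⟩
      invFun := fun v => ⟨fun p => v p, mem_freePiece.2 fun p => (v p).2⟩
      map_add' := fun _ _ => rfl
      map_smul' := fun _ _ => rfl
      left_inv := fun _ => rfl
      right_inv := fun _ => rfl }
  rw [e.finrank_eq, Module.finrank_pi_fintype]
  simp [finrank_homogZ]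

/-- matrix multiplication as a `K`-linear map -/
def mvK {a b : ℕ} (A : Matrix (Fin a) (Fin b) (PolyS K n)) :
    (Fin b → PolyS K n) →ₗ[K] (Fin a → PolyS K n) := A.mulVecLin.restrictScalars K

@[simp] lemma mvK_apply {a b : ℕ} (A : Matrix (Fin a) (Fin b) (PolyS K n)) (v) :
    mvK A v = A.mulVec v := rfl

lemma mvK_mem {a b : ℕ} {A : Matrix (Fin a) (Fin b) (PolyS K n)} {da : Fin a → ℤ} {db : Fin b → ℤ}
    (hA : ∀ p q, A p q ∈ homogZ K n (db q - da p)) {ℓ : ℤ} {v} (hv : v ∈ freePiece db ℓ) :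
    A.mulVec v ∈ freePiece da ℓ := by
  rw [mem_freePiece] at *
  intro p
  rw [Matrix.mulVec, dotProduct]
  refine Submodule.sum_mem _ fun q _ => ?_
  have := homogZ_mul (hA p q) (hv q)
  rwa [show db q - da p + (ℓ - db q) = ℓ - da p by ring] at this

lemma mvK_lift {a b : ℕ} {A : Matrix (Fin a) (Fin b) (PolyS K n)} {da : Fin a → ℤ} {db : Fin b → ℤ}
    (hA : ∀ p q, A p q ∈ homogZ K n (db q - da p)) {ℓ : ℤ} {v}
    (hv : A.mulVec v ∈ freePiece da ℓ) : ∃ u ∈ freePiece db ℓ, A.mulVec u = A.mulVec v := by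
  refine ⟨fun q => compZ (ℓ - db q) (v q), mem_freePiece.2 fun q => compZ_mem _ _, ?_⟩
  rw [mem_freePiece] at hv
  funext p
  rw [← compZ_of_mem (hv p)]
  simp only [Matrix.mulVec, dotProduct, map_sum]
  refine Finset.sum_congr rfl fun q _ => ?_
  have := compZ_mul (hA p q) (ℓ - db q) (v q)
  rw [← this]
  congr 2
  ring

lemma range_inf {a b : ℕ} {A : Matrix (Fin a) (Fin b) (PolyS K n)} {da : Fin a → ℤ} {db : Fin b → ℤ}
    (hA : ∀ p q, A p q ∈ homogZ K n (db q - da p)) (ℓ : ℤ) :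
    (LinearMap.range A.mulVecLin).restrictScalars K ⊓ freePiece da ℓ =
      (freePiece db ℓ).map (mvK A) := by
  ext v
  simp only [Submodule.mem_inf, Submodule.restrictScalars_mem, LinearMap.mem_range,
    Matrix.mulVecLin_apply, Submodule.mem_map, mvK_apply]
  constructor
  · rintro ⟨⟨u, rfl⟩, h⟩
    exact mvK_lift hA h
  · rintro ⟨u, hu, rfl⟩
    exact ⟨⟨u, rfl⟩, mvK_mem hA hu⟩

lemma finrank_quot_comap {V : Type*} [AddCommGroup V] [Module K V] (W N : Submodule K V)
    [FiniteDimensional K W] :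
    finrank K (W ⧸ N.comap W.subtype) + finrank K (N ⊓ W : Submodule K V) = finrank K W := by
  rw [← Submodule.finrank_quotient_add_finrank (N.comap W.subtype)]
  congr 1
  rw [inf_comm, ← Submodule.map_comap_subtype]
  exact (Submodule.equivMapOfInjective _ W.injective_subtype _).finrank_eq.symm

lemma finrank_map_add_ker {V V' : Type*} [AddCommGroup V] [Module K V] [AddCommGroup V'] [Module K V']
    (f : V →ₗ[K] V') (W : Submodule K V) [FiniteDimensional K W] :
    finrank K (W.map f) + finrank K (LinearMap.ker f ⊓ W : Submodule K V) = finrank K W := by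
  rw [← LinearMap.finrank_range_add_finrank_ker (f.comp W.subtype)]
  congr 1
  · rw [LinearMap.range_comp, Submodule.range_subtype]
  · rw [LinearMap.ker_comp, inf_comm, ← Submodule.map_comap_subtype]
    exact (Submodule.equivMapOfInjective _ W.injective_subtype _).finrank_eq.symm

lemma telescope (v h r : ℕ → ℤ) (h0 : v 0 = h 0 + r 0)
    (hs : ∀ i, v (i + 1) = h (i + 1) + r i + r (i + 1)) (N : ℕ) :
    ∑ i ∈ range (N + 1), (-1) ^ i * v i = ∑ i ∈ range (N + 1), (-1) ^ i * h i + (-1) ^ N * r N := by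
  induction N with
  | zero => simp [h0]
  | succ N ih =>
    rw [Finset.sum_range_succ, ih, Finset.sum_range_succ _ (N + 1), hs]
    ring

/-- dimension of free piece -/
def FreeComplex.vdim (F : FreeComplex K n) (i : ℕ) (ℓ : ℤ) : ℕ := ∑ p, hdim n (ℓ - F.deg i p)
def CoComplex.vdim (F : CoComplex K n) (i : ℕ) (ℓ : ℤ) : ℕ := ∑ p, hdim n (ℓ - F.deg i p)

lemma ker_mvK {a b : ℕ} (A : Matrix (Fin a) (Fin b) (PolyS K n)) :
    LinearMap.ker (mvK A) = (LinearMap.ker A.mulVecLin).restrictScalars K := by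
  ext v; simp [LinearMap.mem_ker]

lemma euler_free (F : FreeComplex K n) (hres : IsResolution F) (ℓ : ℤ) :
    ∑ i ∈ range (F.len + 1), (-1 : ℤ) ^ i * F.vdim i ℓ = MPieceDim F ℓ := by
  let r : ℕ → ℤ := fun i => finrank K ((freePiece (F.deg (i + 1)) ℓ).map (mvK (F.dd i)))
  let h : ℕ → ℤ := fun i => if i = 0 then MPieceDim F ℓ else 0
  have h0 : (F.vdim 0 ℓ : ℤ) = h 0 + r 0 := by
    have := finrank_quot_comap (freePiece (F.deg 0) ℓ)
      ((LinearMap.range ((F.dd 0).mulVecLin)).restrictScalars K)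
    rw [range_inf (F.isHomog 0), finrank_freePiece] at this
    simp only [h, r, if_true]
    unfold FreeComplex.vdim MPieceDim
    exact_mod_cast this.symm
  have hs : ∀ i, (F.vdim (i + 1) ℓ : ℤ) = h (i + 1) + r i + r (i + 1) := by
    intro i
    have := finrank_map_add_ker (mvK (F.dd i)) (freePiece (F.deg (i + 1)) ℓ)
    rw [ker_mvK, hres i, range_inf (F.isHomog (i + 1)), finrank_freePiece] at this
    simp only [h, r]
    unfold FreeComplex.vdim
    rw [if_neg (by omega)]
    rw [zero_add]
    exact_mod_cast this.symm
  have := telescope (fun i => (F.vdim i ℓ : ℤ)) h r h0 hs F.len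
  rw [this]
  have hr : r F.len = 0 := by
    simp only [r]
    have h1 : F.rk (F.len + 1) = 0 := F.rk_eq_zero _ (by omega)
    have : freePiece (K := K) (n := n) (F.deg (F.len + 1)) ℓ = ⊥ := by
      rw [eq_bot_iff]
      intro v _
      have : v = 0 := by
        funext p
        exact absurd p.2 (by omega)
      simp [this]
    rw [this]
    simp
  rw [hr, Finset.sum_range_succ']
  simp [h]

lemma euler_co (E : CoComplex K n) (ℓ : ℤ) :
    ∑ i ∈ range (E.len + 1), (-1 : ℤ) ^ i * E.vdim i ℓ =
      ∑ i ∈ range (E.len + 1), (-1 : ℤ) ^ i * cohomDim E i ℓ := by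
  let r : ℕ → ℤ := fun i => finrank K ((freePiece (E.deg i) ℓ).map (mvK (E.dd i)))
  let h : ℕ → ℤ := fun i => cohomDim E i ℓ
  have hker : ∀ i, finrank K (E.kerPiece i ℓ) + finrank K ((freePiece (E.deg i) ℓ).map (mvK (E.dd i)))
      = E.vdim i ℓ := by
    intro i
    have := finrank_map_add_ker (mvK (E.dd i)) (freePiece (E.deg i) ℓ)
    rw [ker_mvK, finrank_freePiece] at this
    unfold CoComplex.kerPiece CoComplex.vdim
    omega
  have hfin : ∀ i, FiniteDimensional K (E.kerPiece i ℓ) := fun i =>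
    Submodule.finiteDimensional_of_le (inf_le_right : E.kerPiece i ℓ ≤ freePiece (E.deg i) ℓ)
  have h0 : (E.vdim 0 ℓ : ℤ) = h 0 + r 0 := by
    have h1 := finrank_quot_comap (E.kerPiece 0 ℓ) (E.imSub 0)
    have h2 : (E.imSub 0 ⊓ E.kerPiece 0 ℓ) = ⊥ := by simp [CoComplex.imSub]
    rw [h2, finrank_bot] at h1
    have := hker 0
    simp only [h, r]
    unfold cohomDim
    rw [← this, ← h1]
    push_cast
    ring
  have hs : ∀ i, (E.vdim (i + 1) ℓ : ℤ) = h (i + 1) + r i + r (i + 1) := by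
    intro i
    have h1 := finrank_quot_comap (E.kerPiece (i + 1) ℓ) (E.imSub (i + 1))
    have h2 : (E.imSub (i + 1) ⊓ E.kerPiece (i + 1) ℓ) = (freePiece (E.deg i) ℓ).map (mvK (E.dd i)) := by
      rw [← range_inf (da := E.deg (i + 1)) (fun p q => E.isHomog i p q)]
      unfold CoComplex.kerPiece CoComplex.imSub
      rw [← inf_assoc]
      congr 1
      rw [inf_eq_left]
      rintro _ ⟨u, rfl⟩
      simp only [Submodule.restrictScalars_mem, LinearMap.mem_ker, Matrix.mulVecLin_apply,
        Matrix.mulVec_mulVec, E.isComplex i, Matrix.zero_mulVec]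
    rw [h2] at h1
    have := hker (i + 1)
    simp only [h, r]
    unfold cohomDim
    rw [← this, ← h1]
    push_cast
    ring
  have := telescope (fun i => (E.vdim i ℓ : ℤ)) h r h0 hs E.len
  rw [this]
  have hr : r E.len = 0 := by
    simp only [r]
    have h1 : E.rk (E.len + 1) = 0 := E.rk_eq_zero _ (by omega)
    have : (freePiece (K := K) (n := n) (E.deg E.len) ℓ).map (mvK (E.dd E.len)) = ⊥ := by
      rw [eq_bot_iff]
      intro v _
      have : v = 0 := by
        funext p
        exact absurd p.2 (by omega)
      simp [this]
    rw [this]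
    simp
  rw [hr]
  simp [h]

lemma hilbPoly_eval {m : ℕ} (F : FreeComplex K (m + 1)) (hres : IsResolution F) (d : ℤ) :
    (hilbPoly F).eval (d : ℚ) = (MPieceDim F d : ℚ) + (-1) ^ m *
      ∑ j ∈ range (F.len + 1), (-1 : ℚ) ^ j * cohomDim (dualCo F) j (-d - (m + 1 : ℕ)) := by
  have h1 := euler_free F hres d
  have h2 := euler_co (dualCo F) (-d - (m + 1 : ℕ))
  have h1' := congrArg (Int.cast : ℤ → ℚ) h1
  have h2' := congrArg (Int.cast : ℤ → ℚ) h2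
  push_cast at h1' h2'
  rw [← h1']
  have hl : (dualCo F).len = F.len := rfl
  rw [hl] at h2'
  push_cast
  rw [← h2', Finset.mul_sum, ← Finset.sum_add_distrib]
  unfold hilbPoly
  rw [Polynomial.eval_finset_sum]
  refine Finset.sum_congr rfl fun i _ => ?_
  rw [Polynomial.eval_mul, Polynomial.eval_C, Polynomial.eval_finset_sum]
  unfold FreeComplex.vdim CoComplex.vdim
  simp only [genHilb_eval]
  rw [Finset.sum_add_distrib, ← Finset.mul_sum]
  have : ∀ p : Fin (F.rk i), (-d - (m + 1 : ℕ) : ℤ) - (dualCo F).deg i p = F.deg i p - d - (m + 1 : ℕ) := by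
    intro p
    have : (dualCo F).deg i p = - F.deg i p := rfl
    rw [this]; ring
  have hrk : (dualCo F).rk = F.rk := rfl
  push_cast at this ⊢
  have e2 : ∑ p : Fin (F.rk i), (hdim (m + 1) (F.deg i p - d - (m + 1)) : ℚ) =
    ∑ p : Fin ((dualCo F).rk i), (hdim (m + 1) (-d - (m + 1) - (dualCo F).deg i p) : ℚ) := by
    refine Finset.sum_congr rfl fun p _ => ?_
    rw [this]
  rw [e2]
  ring

section nagata
open Polynomial MvPolynomial Ideal Nat RingHom List
variable {k : Type*} [Field k] {n : ℕ} (f : MvPolynomial (Fin (n + 1)) k)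
variable (v w : Fin (n + 1) →₀ ℕ)

namespace NagataAux



variable {f v} in
lemma lt_up (vlt : ∀ i, v i < (2 + f.totalDegree)) : ∀ l ∈ ofFn v, l < (2 + f.totalDegree) := by
  grind


/-- We construct an algebra map `T1 f c` which maps `X_i` into `X_i + c • X_0 ^ r_i` when `i ≠ 0`
and `X_0` to `X_0`. -/
noncomputable abbrev T1 (c : k) :
    MvPolynomial (Fin (n + 1)) k →ₐ[k] MvPolynomial (Fin (n + 1)) k :=
  aeval fun i ↦ if i = 0 then X 0 else X i + c • X 0 ^ (2 + f.totalDegree) ^ (i : Fin (n+1)).1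

lemma t1_comp_t1_neg (c : k) : (T1 f c).comp (T1 f (-c)) = AlgHom.id _ _ := by
  rw [comp_aeval, ← MvPolynomial.aeval_X_left]
  ext i v
  cases i using Fin.cases <;> simp

/-- `T1 f 1` leads to an algebra equiv `T f`. -/
noncomputable abbrev T := AlgEquiv.ofAlgHom (T1 f 1) (T1 f (-1))
  (t1_comp_t1_neg f 1) (by simpa using t1_comp_t1_neg f (-1))

lemma sum_r_mul_ne (vlt : ∀ i, v i < (2 + f.totalDegree)) (wlt : ∀ i, w i < (2 + f.totalDegree)) (ne : v ≠ w) :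
    ∑ x : Fin (n + 1), (2 + f.totalDegree) ^ (x : Fin (n+1)).1 * v x ≠ ∑ x : Fin (n + 1), (2 + f.totalDegree) ^ (x : Fin (n+1)).1 * w x := by
  intro h
  refine ne <| Finsupp.ext <| congrFun <| ofFn_inj.mp ?_
  apply ofDigits_inj_of_len_eq (Nat.lt_add_right f.totalDegree one_lt_two)
    (by simp) (lt_up vlt) (lt_up wlt)
  simpa only [ofDigits_eq_sum_mapIdx, mapIdx_eq_ofFn, get_ofFn, length_ofFn,
    Fin.val_cast, mul_comm, sum_ofFn] using! h

lemma degreeOf_zero_t {a : k} (ha : a ≠ 0) : ((T f) (monomial v a)).degreeOf 0 =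
    ∑ i : Fin (n + 1), ((2 + f.totalDegree) ^ (i : Fin (n+1)).1) * v i := by
  rw [← natDegree_finSuccEquiv, monomial_eq, Finsupp.prod_pow v fun a ↦ X a]
  simp only [Fin.prod_univ_succ, Fin.sum_univ_succ, map_mul, map_prod, map_pow,
    AlgEquiv.ofAlgHom_apply, MvPolynomial.aeval_C, MvPolynomial.aeval_X, if_pos, Fin.succ_ne_zero,
    ite_false, one_smul, map_add, finSuccEquiv_X_zero, finSuccEquiv_X_succ, algebraMap_eq]
  have h (i : Fin n) :
      (Polynomial.C (X (R := k) i) + Polynomial.X ^ (2 + f.totalDegree) ^ (i.succ : Fin (n+1)).1) ^ v i.succ ≠ 0 :=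
    pow_ne_zero (v i.succ) (leadingCoeff_ne_zero.mp <| by simp [add_comm, leadingCoeff_X_pow_add_C])
  rw [natDegree_mul (by simp [ha]) (mul_ne_zero (by simp) (Finset.prod_ne_zero_iff.mpr
    (fun i _ ↦ h i))), natDegree_mul (by simp) (Finset.prod_ne_zero_iff.mpr (fun i _ ↦ h i)),
    natDegree_prod _ _ (fun i _ ↦ h i), natDegree_finSuccEquiv, degreeOf_C]
  simpa only [natDegree_pow, zero_add, natDegree_X, mul_one, Fin.val_zero, pow_zero, one_mul,
    add_right_inj] using Finset.sum_congr rfl (fun i _ ↦ by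
    rw [add_comm (Polynomial.C _), natDegree_X_pow_add_C, mul_comm])

/-- `T` maps different monomials of `f` to polynomials with different degrees in `X_0`. -/
lemma degreeOf_t_ne_of_ne (hv : v ∈ f.support) (hw : w ∈ f.support) (ne : v ≠ w) :
    (T f <| monomial v <| coeff v f).degreeOf 0 ≠
    (T f <| monomial w <| coeff w f).degreeOf 0 := by
  rw [degreeOf_zero_t _ _ <| mem_support_iff.mp hv, degreeOf_zero_t _ _ <| mem_support_iff.mp hw]
  refine sum_r_mul_ne f v w (fun i ↦ ?_) (fun i ↦ ?_) ne <;>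
  exact lt_of_le_of_lt ((monomial_le_degreeOf i ‹_›).trans (degreeOf_le_totalDegree f i))
    (by lia)

lemma leadingCoeff_finSuccEquiv_t :
    (finSuccEquiv k n ((T f) ((monomial v) (coeff v f)))).leadingCoeff =
    algebraMap k _ (coeff v f) := by
  rw [monomial_eq, Finsupp.prod_fintype]
  · simp only [map_mul, map_prod, leadingCoeff_mul, leadingCoeff_prod]
    rw [AlgEquiv.ofAlgHom_apply, algHom_C, algebraMap_eq, finSuccEquiv_apply,
      eval₂Hom_C, coe_comp]
    simp only [AlgEquiv.ofAlgHom_apply, Function.comp_apply, leadingCoeff_C, map_pow,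
      leadingCoeff_pow, algebraMap_eq]
    have : ∀ j, ((finSuccEquiv k n) ((T1 f) 1 (X j))).leadingCoeff = 1 := fun j ↦ by
      by_cases h : j = 0
      · simp [h, finSuccEquiv_apply]
      · simp only [aeval_eq_bind₁, bind₁_X_right, if_neg h, one_smul, map_add, map_pow]
        obtain ⟨i, rfl⟩ := Fin.exists_succ_eq.mpr h
        simp [finSuccEquiv_X_succ, finSuccEquiv_X_zero, add_comm]
    simp only [this, one_pow, Finset.prod_const_one, mul_one]
  exact fun i ↦ pow_zero _

/-- `T` maps `f` into some polynomial in `X_0` such that the leading coefficient is invertible. -/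
lemma T_leadingcoeff_isUnit (fne : f ≠ 0) :
    IsUnit (finSuccEquiv k n (T f f)).leadingCoeff := by
  obtain ⟨v, vin, vs⟩ := Finset.exists_max_image f.support
    (fun v ↦ (T f ((monomial v) (coeff v f))).degreeOf 0) (support_nonempty.mpr fne)
  set h := fun w ↦ (MvPolynomial.monomial w) (coeff w f)
  simp only [← natDegree_finSuccEquiv] at vs
  replace vs : ∀ x ∈ f.support \ {v}, (finSuccEquiv k n ((T f) (h x))).degree <
      (finSuccEquiv k n ((T f) (h v))).degree := by
    intro x hx
    obtain ⟨h1, h2⟩ := Finset.mem_sdiff.mp hx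
    apply degree_lt_degree <| lt_of_le_of_ne (vs x h1) ?_
    simpa only [natDegree_finSuccEquiv]
      using degreeOf_t_ne_of_ne f _ _ h1 vin <| ne_of_not_mem_cons h2
  have coeff : (finSuccEquiv k n ((T f) (h v + ∑ x ∈ f.support \ {v}, h x))).leadingCoeff =
      (finSuccEquiv k n ((T f) (h v))).leadingCoeff := by
    simp only [map_add, map_sum]
    rw [add_comm]
    apply leadingCoeff_add_of_degree_lt <| (lt_of_le_of_lt <| degree_sum_le _ _) ?_
    have h2 : h v ≠ 0 := by simpa [h] using mem_support_iff.mp vin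
    replace h2 : (finSuccEquiv k n ((T f) (h v))) ≠ 0 := fun eq ↦ h2 <|
      by simpa only [map_eq_zero_iff _ (AlgEquiv.injective _)] using eq
    exact (Finset.sup_lt_iff <| Ne.bot_lt (fun x ↦ h2 <| degree_eq_bot.mp x)).mpr vs
  nth_rw 2 [← f.support_sum_monomial_coeff]
  rw [Finset.sum_eq_add_sum_sdiff_singleton_of_mem vin h]
  rw [leadingCoeff_finSuccEquiv_t] at coeff
  simpa only [coeff, algebraMap_eq] using (mem_support_iff.mp vin).isUnit.map MvPolynomial.C


end NagataAux
end nagata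

section regseq
open RingTheory.Sequence

lemma isSMulRegular_monic {B : Type*} [CommRing B] (rs : List B) (g : Polynomial B) (hg : g.Monic) :
    IsSMulRegular (Polynomial B ⧸ (Ideal.ofList (rs.map (algebraMap B (Polynomial B))) • ⊤ :
      Submodule (Polynomial B) (Polynomial B))) g := by
  have h0 : (Ideal.ofList (rs.map (algebraMap B (Polynomial B))) • ⊤ :
      Submodule (Polynomial B) (Polynomial B)) = (Ideal.ofList rs).map Polynomial.C := by
    rw [smul_eq_mul, Ideal.mul_top, Ideal.map_ofList]
    rfl
  rw [h0]
  rw [isSMulRegular_quotient_iff_mem_of_smul_mem]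
  intro x hx
  have key : ∀ y : Polynomial B, y ∈ (Ideal.ofList rs).map Polynomial.C ↔
      y.map (Ideal.Quotient.mk (Ideal.ofList rs)) = 0 := by
    intro y
    rw [Ideal.mem_map_C_iff, Polynomial.ext_iff]
    simp [Polynomial.coeff_map, Ideal.Quotient.eq_zero_iff_mem]
  rw [key] at hx ⊢
  rw [smul_eq_mul, Polynomial.map_mul] at hx
  exact (Polynomial.Monic.mul_right_eq_zero_iff (hg.map _)).1 hx

theorem exists_regseq {K : Type} [Field K] : ∀ (n : ℕ) (I : Ideal (MvPolynomial (Fin n) K)), I ≠ ⊤ →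
    ∃ rs : List (MvPolynomial (Fin n) K), IsWeaklyRegular (MvPolynomial (Fin n) K) rs ∧
      (∀ r ∈ rs, r ∈ I) ∧ ∃ t, rs.length + t = n ∧
        ∃ φ : MvPolynomial (Fin t) K →ₐ[K] (MvPolynomial (Fin n) K ⧸ I),
          Function.Injective φ := by
  intro n
  induction n with
  | zero =>
    intro I hI
    refine ⟨[], IsWeaklyRegular.nil _ _, by simp, 0, rfl, Ideal.Quotient.mkₐ K I, ?_⟩
    have : I = ⊥ := by
      let e := MvPolynomial.isEmptyAlgEquiv K (Fin 0)
      rw [eq_bot_iff]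
      intro x hx
      by_contra h
      have hx0 : x ≠ 0 := h
      have hu : IsUnit x := by
        have : IsUnit (e x) := by
          rw [isUnit_iff_ne_zero]
          simpa using hx0
        simpa using this
      exact hI (Ideal.eq_top_of_isUnit_mem I hx hu)
    rw [← RingHom.coe_coe, RingHom.injective_iff_ker_eq_bot]
    subst this
    exact Ideal.mk_ker
  | succ n ih =>
    intro I hI
    by_cases hb : I = ⊥
    · refine ⟨[], IsWeaklyRegular.nil _ _, by simp, n + 1, by simp, Ideal.Quotient.mkₐ K I, ?_⟩
      rw [← RingHom.coe_coe, RingHom.injective_iff_ker_eq_bot]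
      subst hb
      exact Ideal.mk_ker
    obtain ⟨f, hfI, hf0⟩ := Submodule.exists_mem_ne_zero_of_ne_bot hb
    have hu := NagataAux.T_leadingcoeff_isUnit f hf0
    let e : MvPolynomial (Fin (n + 1)) K ≃ₐ[K] Polynomial (MvPolynomial (Fin n) K) :=
      (NagataAux.T f).trans (MvPolynomial.finSuccEquiv K n)
    have hu' : IsUnit (e f).leadingCoeff := hu
    obtain ⟨u, hu2⟩ := hu'
    let g : Polynomial (MvPolynomial (Fin n) K) := Polynomial.C ((u⁻¹ : Units _) : MvPolynomial (Fin n) K) * e f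
    have hg : g.Monic := by
      unfold Polynomial.Monic
      rw [Polynomial.leadingCoeff_mul, Polynomial.leadingCoeff_C, ← hu2]
      simp
    have hgI : e.symm g ∈ I := by
      simp only [g, map_mul, AlgEquiv.symm_apply_apply]
      exact I.mul_mem_left _ hfI
    let P : Ideal (Polynomial (MvPolynomial (Fin n) K)) := I.comap (e.symm : _ →+* _)
    let J : Ideal (MvPolynomial (Fin n) K) := P.comap Polynomial.C
    have hJ : J ≠ ⊤ := by
      rw [Ideal.ne_top_iff_one]
      simp only [J, P, Ideal.mem_comap, map_one]
      rwa [← Ideal.ne_top_iff_one]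
    obtain ⟨rs, hreg, hmem, t, ht, φ, hφ⟩ := ih J hJ
    have hreg2 : IsWeaklyRegular (Polynomial (MvPolynomial (Fin n) K))
        (rs.map (algebraMap _ (Polynomial (MvPolynomial (Fin n) K))) ++ [g]) := by
      rw [isWeaklyRegular_append_iff]
      refine ⟨hreg.of_flat, ?_⟩
      rw [isWeaklyRegular_singleton_iff]
      exact isSMulRegular_monic rs g hg
    let ls := (rs.map (algebraMap _ (Polynomial (MvPolynomial (Fin n) K))) ++ [g])
    refine ⟨ls.map e.symm, ?_, ?_, t, ?_, ?_⟩
    · refine (AddEquiv.isWeaklyRegular_congr (e := e.symm.toRingEquiv.toAddEquiv) ?_).1 hreg2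
      rw [List.forall₂_map_right_iff, List.forall₂_same]
      intro r _ x
      simp
    · intro r hr
      simp only [ls, List.map_append, List.map_map, List.map_cons, List.map_nil, List.mem_append,
        List.mem_map, List.mem_singleton] at hr
      rcases hr with ⟨a, ha, rfl⟩ | rfl
      · exact hmem a ha
      · exact hgI
    · simp [ls]
      omega
    · let ψ : MvPolynomial (Fin n) K →ₐ[K] (MvPolynomial (Fin (n + 1)) K ⧸ I) :=
        (Ideal.Quotient.mkₐ K I).comp ((e.symm : _ →ₐ[K] _).comp
          (IsScalarTower.toAlgHom K (MvPolynomial (Fin n) K) (Polynomial (MvPolynomial (Fin n) K))))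
      have hker : RingHom.ker ψ = J := by
        ext x
        rw [RingHom.mem_ker]
        simp only [ψ, AlgHom.comp_apply, Ideal.Quotient.mkₐ_eq_mk, Ideal.Quotient.eq_zero_iff_mem]
        rfl
      let ψ' : (MvPolynomial (Fin n) K ⧸ J) →ₐ[K] (MvPolynomial (Fin (n + 1)) K ⧸ I) :=
        Ideal.Quotient.liftₐ J ψ (fun a ha => by rw [← hker] at ha; exact ha)
      refine ⟨ψ'.comp φ, ?_⟩
      have : Function.Injective ψ' := by
        rw [← RingHom.coe_coe, injective_iff_map_eq_zero]
        intro a ha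
        obtain ⟨b, rfl⟩ := Ideal.Quotient.mk_surjective a
        have : ψ b = 0 := ha
        rw [Ideal.Quotient.eq_zero_iff_mem, ← hker]
        exact this
      exact this.comp hφ
end regseq

section ExtVan

variable {S : Type} [CommRing S]

/-- transposed matrix action on vectors in a module -/
def actT {a b : ℕ} {N : Type} [AddCommGroup N] [Module S N] (A : Matrix (Fin a) (Fin b) S)
    (g : Fin a → N) : Fin b → N := fun q => ∑ p, A p q • g p

variable {N : Type} [AddCommGroup N] [Module S N]

lemma actT_mul {a b c : ℕ} (A : Matrix (Fin a) (Fin b) S) (B : Matrix (Fin b) (Fin c) S)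
    (g : Fin a → N) : actT (A * B) g = actT B (actT A g) := by
  funext q
  simp only [actT, Matrix.mul_apply, Finset.sum_smul, Finset.smul_sum, smul_smul]
  rw [Finset.sum_comm]
  refine Finset.sum_congr rfl fun p _ => Finset.sum_congr rfl fun r _ => ?_
  rw [mul_comm]

lemma actT_addM {a b : ℕ} (A B : Matrix (Fin a) (Fin b) S) (g : Fin a → N) :
    actT (A + B) g = actT A g + actT B g := by
  funext q
  simp [actT, add_smul, Finset.sum_add_distrib]

lemma actT_add {a b : ℕ} (A : Matrix (Fin a) (Fin b) S) (g g' : Fin a → N) :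
    actT A (g + g') = actT A g + actT A g' := by
  funext q
  simp [actT, Finset.sum_add_distrib]

lemma actT_smul {a b : ℕ} (A : Matrix (Fin a) (Fin b) S) (s : S) (g : Fin a → N) :
    actT A (s • g) = s • actT A g := by
  funext q
  simp only [actT, Pi.smul_apply, Finset.smul_sum]
  refine Finset.sum_congr rfl fun p _ => ?_
  rw [smul_comm]

lemma actT_zeroV {a b : ℕ} (A : Matrix (Fin a) (Fin b) S) :
    actT A (0 : Fin a → N) = 0 := by
  funext q; simp [actT]

lemma actT_zeroM {a b : ℕ} (g : Fin a → N) :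
    actT (0 : Matrix (Fin a) (Fin b) S) g = 0 := by
  funext q; simp [actT]

lemma actT_scalar {a : ℕ} (s : S) (g : Fin a → N) :
    actT (s • (1 : Matrix (Fin a) (Fin a) S)) g = s • g := by
  funext q
  simp [actT, Matrix.smul_apply, Matrix.one_apply]

lemma actT_mk {a b : ℕ} {N' : Type} [AddCommGroup N'] [Module S N'] (f : N →ₗ[S] N')
    (A : Matrix (Fin a) (Fin b) S) (g : Fin a → N) :
    actT A (fun p => f (g p)) = fun q => f (actT A g q) := by
  funext q
  simp [actT]

end ExtVan

lemma mat_lift {a b c : ℕ} {S : Type} [CommRing S] (A : Matrix (Fin a) (Fin b) S)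
    (C : Matrix (Fin a) (Fin c) S)
    (h : ∀ v, C.mulVec v ∈ LinearMap.range A.mulVecLin) :
    ∃ σ : Matrix (Fin b) (Fin c) S, A * σ = C := by
  have : ∀ q, ∃ u, A.mulVec u = fun p => C p q := by
    intro q
    obtain ⟨u, hu⟩ := h (Pi.single q 1)
    refine ⟨u, ?_⟩
    rw [← Matrix.mulVecLin_apply, hu]
    funext p
    simp
  choose u hu using this
  refine ⟨fun p q => u q p, ?_⟩
  ext p q
  have := congrFun (hu q) p
  rw [← this]
  rfl

lemma nullhom0 (F : FreeComplex K n) (a : PolyS K n)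
    (ha : ∀ v, a • v ∈ LinearMap.range (F.dd 0).mulVecLin) :
    ∃ σ : Matrix (Fin (F.rk 1)) (Fin (F.rk 0)) (PolyS K n), F.dd 0 * σ = a • 1 := by
  apply mat_lift
  intro v
  rw [Matrix.smul_mulVec, Matrix.one_mulVec]
  exact ha v

lemma nullhom (F : FreeComplex K n) (hres : IsResolution F) (a : PolyS K n)
    (ha : ∀ v, a • v ∈ LinearMap.range (F.dd 0).mulVecLin) (j : ℕ) :
    ∃ (σ : Matrix (Fin (F.rk (j+1))) (Fin (F.rk j)) (PolyS K n))
      (τ : Matrix (Fin (F.rk (j+2))) (Fin (F.rk (j+1))) (PolyS K n)),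
      σ * F.dd j + F.dd (j+1) * τ = a • 1 := by
  have key : ∀ j (σ : Matrix (Fin (F.rk (j+1))) (Fin (F.rk j)) (PolyS K n)),
      F.dd j * σ * F.dd j = a • F.dd j → ∃ τ : Matrix (Fin (F.rk (j+2))) (Fin (F.rk (j+1))) (PolyS K n),
      σ * F.dd j + F.dd (j+1) * τ = a • 1 := by
    intro j σ h
    obtain ⟨τ, hτ⟩ := mat_lift (F.dd (j+1)) (a • 1 - σ * F.dd j) (by
      intro v
      rw [← hres j, LinearMap.mem_ker, Matrix.mulVecLin_apply, Matrix.mulVec_mulVec, Matrix.mul_sub,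
        ← Matrix.mul_assoc, h]
      simp)
    exact ⟨τ, by rw [hτ]; abel⟩
  induction j with
  | zero =>
    obtain ⟨σ, hσ⟩ := nullhom0 F a ha
    obtain ⟨τ, hτ⟩ := key 0 σ (by rw [hσ]; simp)
    exact ⟨σ, τ, hτ⟩
  | succ j ih =>
    obtain ⟨σ, τ, h⟩ := ih
    obtain ⟨τ', hτ'⟩ := key (j+1) τ (by
      have h2 : F.dd (j+1) * τ = a • 1 - σ * F.dd j := by rw [← h]; abel
      rw [h2, Matrix.sub_mul, Matrix.mul_assoc, F.isComplex]
      simp)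
    exact ⟨τ, τ', hτ'⟩

/-- coboundary predicate in Hom(F,N) -/
def IsB (F : FreeComplex K n) (N : Type) [AddCommGroup N] [Module (PolyS K n) N] :
    (j : ℕ) → (Fin (F.rk j) → N) → Prop
  | 0, g => g = 0
  | (j+1), g => ∃ b, actT (F.dd j) b = g

open RingTheory.Sequence Pointwise in
theorem ext_van (F : FreeComplex K n) (hres : IsResolution F) (rs : List (PolyS K n)) :
    ∀ (N : Type) [AddCommGroup N] [Module (PolyS K n) N], IsWeaklyRegular N rs →
    (∀ a ∈ rs, ∀ v, a • v ∈ LinearMap.range (F.dd 0).mulVecLin) →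
    ∀ (j : ℕ) (g : Fin (F.rk j) → N), j < rs.length → actT (F.dd j) g = 0 → IsB F N j g := by
  induction rs with
  | nil => intro N _ _ _ _ j g hj; simp at hj
  | cons a rs ih =>
    intro N _ _ hreg hrs j g hj hg
    rw [isWeaklyRegular_cons_iff] at hreg
    obtain ⟨hr, hreg⟩ := hreg
    have ha := hrs a (by simp)
    have hrV : ∀ {t : ℕ} {u v : Fin t → N}, a • u = a • v → u = v := by
      intro t u v h
      funext p
      exact hr (congrFun h p)
    cases j with
    | zero =>
      obtain ⟨σ, hσ⟩ := nullhom0 F a ha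
      have : a • g = 0 := by
        rw [← actT_scalar, ← hσ, actT_mul, hg, actT_zeroV]
      exact hrV (by rw [this, smul_zero])
    | succ i =>
      obtain ⟨σ, τ, h⟩ := nullhom F hres a ha i
      have hag : a • g = actT (F.dd i) (actT σ g) := by
        rw [← actT_scalar, ← h, actT_addM, actT_mul, actT_mul, hg, actT_zeroV, add_zero]
      set b := actT σ g with hb
      let mk := (a • (⊤ : Submodule (PolyS K n) N)).mkQ
      have hlift : ∀ {t : ℕ} (w : Fin t → N), (∀ p, mk (w p) = 0) → ∃ w', w = a • w' := by
        intro t w hw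
        have : ∀ p, ∃ y, a • y = w p := by
          intro p
          have h1 := hw p
          rw [Submodule.mkQ_apply, Submodule.Quotient.mk_eq_zero,
            Submodule.mem_smul_pointwise_iff_exists] at h1
          obtain ⟨y, _, hy⟩ := h1
          exact ⟨y, hy⟩
        choose y hy using this
        exact ⟨y, by funext p; exact (hy p).symm⟩
      have hB := ih (QuotSMulTop a N) hreg (fun c hc => hrs c (by simp [hc])) i
        (fun p => mk (b p)) (by simpa using hj) (by
          rw [actT_mk, ← hag]
          funext q
          rw [Submodule.mkQ_apply]
          refine (Submodule.Quotient.mk_eq_zero _).2 ?_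
          exact Submodule.smul_mem_pointwise_smul _ _ _ trivial)
      cases i with
      | zero =>
        obtain ⟨b', hb'⟩ := hlift b (fun p => congrFun hB p)
        refine ⟨b', hrV ?_⟩
        rw [hag, hb', actT_smul]
      | succ k =>
        obtain ⟨c, hc⟩ := hB
        have : ∀ p, ∃ y, mk y = c p := fun p => Submodule.mkQ_surjective _ (c p)
        choose c' hc' using this
        obtain ⟨b', hb'⟩ := hlift (b + actT (F.dd k) (-c')) (by
          intro p
          have h1 := congrFun hc p
          rw [show c = fun p => mk (c' p) from funext fun p => (hc' p).symm, actT_mk] at h1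
          rw [show -c' = (-1 : PolyS K n) • c' by simp, actT_smul]
          simp [h1])
        refine ⟨b', hrV ?_⟩
        rw [hag, ← actT_smul, ← hb', actT_add, ← actT_mul (F.dd k), F.isComplex, actT_zeroM, add_zero]

/-- Ext vanishing from a regular sequence in the annihilator. -/
theorem cohomDim_van (F : FreeComplex K n) (hres : IsResolution F) (rs : List (PolyS K n))
    (hreg : RingTheory.Sequence.IsWeaklyRegular (PolyS K n) rs)
    (hrs : ∀ a ∈ rs, ∀ v, a • v ∈ LinearMap.range (F.dd 0).mulVecLin)
    (j : ℕ) (hj : j < rs.length) (e : ℤ) : cohomDim (dualCo F) j e = 0 := by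
  unfold cohomDim
  have hact : ∀ i (g : Fin (F.rk i) → PolyS K n), actT (F.dd i) g = ((dualCo F).dd i).mulVec g := by
    intro i g
    rfl
  have : Submodule.comap ((dualCo F).kerPiece j e).subtype ((dualCo F).imSub j) = ⊤ := by
    rw [eq_top_iff]
    rintro ⟨g, hg⟩ -
    have h1 : ((dualCo F).dd j).mulVec g = 0 := hg.1
    have := ext_van F hres rs (PolyS K n) hreg hrs j g hj ((hact j g).trans h1)
    rw [Submodule.mem_comap]
    cases j with
    | zero => exact this
    | succ j =>
      obtain ⟨b, hb⟩ := this
      exact ⟨b, (hact j b).symm.trans hb⟩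
  rw [this]
  have : Subsingleton (((dualCo F).kerPiece j e) ⧸ (⊤ : Submodule K ((dualCo F).kerPiece j e))) :=
    Submodule.Quotient.subsingleton_iff.2 rfl
  exact finrank_zero_of_subsingleton

lemma cohomDim_eq_zero_of_small (E : CoComplex K n) (j : ℕ) (e : ℤ)
    (h : ∀ p, e - E.deg j p < 0) : cohomDim E j e = 0 := by
  have h1 : E.kerPiece j e = ⊥ := by
    rw [eq_bot_iff]
    intro v hv
    have := mem_freePiece.1 hv.2
    rw [Submodule.mem_bot]
    funext p
    have h2 := this p
    rw [homogZ_of_neg (h p)] at h2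
    simpa using h2
  unfold cohomDim
  have : Subsingleton (E.kerPiece j e) := by rw [h1]; infer_instance
  exact finrank_zero_of_subsingleton

lemma MPieceDim_large {m : ℕ} (F : FreeComplex K (m + 1)) (hres : IsResolution F) :
    ∃ d0 : ℤ, ∀ d : ℤ, d0 ≤ d → (MPieceDim F d : ℚ) = (hilbPoly F).eval (d : ℚ) := by
  refine ⟨∑ j ∈ range (F.len + 1), ∑ p : Fin (F.rk j), |F.deg j p|, fun d hd => ?_⟩
  rw [hilbPoly_eval F hres]
  have : ∀ j ∈ range (F.len + 1), cohomDim (dualCo F) j (-d - (m + 1 : ℕ)) = 0 := by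
    intro j hj
    apply cohomDim_eq_zero_of_small
    intro p
    have h1 : |F.deg j p| ≤ ∑ p : Fin (F.rk j), |F.deg j p| :=
      Finset.single_le_sum (f := fun p => |F.deg j p|) (fun _ _ => abs_nonneg _) (mem_univ _)
    have h2 : ∑ p : Fin (F.rk j), |F.deg j p| ≤ ∑ j ∈ range (F.len + 1), ∑ p : Fin (F.rk j), |F.deg j p| :=
      Finset.single_le_sum (f := fun j => ∑ p : Fin (F.rk j), |F.deg j p|)
        (fun _ _ => Finset.sum_nonneg fun _ _ => abs_nonneg _) hj
    have h3 := le_abs_self (F.deg j p)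
    show -d - (m + 1 : ℕ) - (-F.deg j p) < 0
    push_cast
    omega
  rw [Finset.sum_eq_zero (fun j hj => by rw [this j hj]; simp)]
  simp

lemma MPieceDim_bound {m : ℕ} (F : FreeComplex K (m + 1)) (hres : IsResolution F) {s : ℕ}
    (z : Fin s → ℤ) (a : ℚ)
    (hP : hilbPoly F = Polynomial.C a * ∏ i : Fin s, (Polynomial.X - Polynomial.C ((z i : ℚ))))
    (c : ℤ) : ∃ C : ℕ, ∀ k : ℕ, MPieceDim F (k + c) ≤ C * (k + 1) ^ s := by
  obtain ⟨d0, hd0⟩ := MPieceDim_large F hres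
  let A : ℚ := |a| * ∏ i : Fin s, (1 + |(c:ℚ)| + |(z i : ℚ)|)
  refine ⟨⌈A⌉₊ + ∑ k ∈ range (d0 - c).toNat, MPieceDim F (k + c), fun k => ?_⟩
  have hpos : 1 ≤ (k + 1) ^ s := Nat.one_le_pow _ _ (by omega)
  rcases lt_or_ge k (d0 - c).toNat with hk | hk
  · have h1 : MPieceDim F (k + c) ≤ ∑ k ∈ range (d0 - c).toNat, MPieceDim F (k + c) :=
      Finset.single_le_sum (f := fun k : ℕ => MPieceDim F (k + c)) (fun _ _ => Nat.zero_le _)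
        (Finset.mem_range.2 hk)
    nlinarith
  · have h1 := hd0 (k + c) (by omega)
    have h2 : ((MPieceDim F (k + c) : ℕ) : ℚ) ≤ A * (k + 1) ^ s := by
      rw [h1, hP]
      refine (le_abs_self _).trans ?_
      rw [Polynomial.eval_mul, abs_mul, Polynomial.eval_C, Polynomial.eval_prod, Finset.abs_prod,
        mul_assoc]
      refine mul_le_mul_of_nonneg_left ?_ (abs_nonneg _)
      have : ((k:ℚ) + 1) ^ s = ∏ i : Fin s, ((k:ℚ) + 1) := by simp
      rw [this, ← Finset.prod_mul_distrib]
      refine Finset.prod_le_prod (fun _ _ => abs_nonneg _) fun i _ => ?_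
      simp only [Polynomial.eval_sub, Polynomial.eval_X, Polynomial.eval_C]
      have e1 := abs_add_le ((k:ℚ)) ((c:ℚ) - z i)
      have e2 := abs_sub (c:ℚ) (z i : ℚ)
      have e3 : |(k:ℚ)| = k := abs_of_nonneg (by positivity)
      have e4 : (((k:ℤ) + c : ℤ) : ℚ) - z i = k + (c - z i) := by push_cast; ring
      rw [e4]
      have e5 := abs_nonneg (c:ℚ)
      have e6 := abs_nonneg (z i:ℚ)
      have e7 : (0:ℚ) ≤ k := by positivity
      nlinarith [mul_nonneg e7 e5, mul_nonneg e7 e6]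
    have h3 : A ≤ ⌈A⌉₊ := Nat.le_ceil A
    have h4 : ((MPieceDim F (k + c) : ℕ) : ℚ) ≤ ((⌈A⌉₊ * (k + 1) ^ s : ℕ) : ℚ) := by
      push_cast
      refine h2.trans ?_
      exact mul_le_mul_of_nonneg_right h3 (by positivity)
    have h5 : MPieceDim F (k + c) ≤ ⌈A⌉₊ * (k + 1) ^ s := by exact_mod_cast h4
    rw [add_mul]
    omega

/-- The annihilator ideal of `coker (F₁ → F₀)`. -/
def annF (F : FreeComplex K n) : Ideal (PolyS K n) :=
  Module.annihilator (PolyS K n) ((Fin (F.rk 0) → PolyS K n) ⧸ LinearMap.range (F.dd 0).mulVecLin)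

lemma mem_annF (F : FreeComplex K n) (a : PolyS K n) :
    a ∈ annF F ↔ ∀ v, a • v ∈ LinearMap.range (F.dd 0).mulVecLin := by
  unfold annF
  rw [Module.mem_annihilator]
  constructor
  · intro h v
    have := h (Submodule.Quotient.mk v)
    rwa [← Submodule.Quotient.mk_smul, Submodule.Quotient.mk_eq_zero] at this
  · intro h v
    obtain ⟨v, rfl⟩ := Submodule.Quotient.mk_surjective _ v
    rw [← Submodule.Quotient.mk_smul, Submodule.Quotient.mk_eq_zero]
    exact h v

lemma li_card {ι κ : Type} [Fintype ι] [Fintype κ] {V : Type} [AddCommGroup V] [Module K V]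
    {W : κ → Type} [∀ i, AddCommGroup (W i)] [∀ i, Module K (W i)] [∀ i, FiniteDimensional K (W i)]
    (Φ : ∀ i, V →ₗ[K] W i) (v : ι → V) (hv : LinearIndependent K v)
    (h : ∀ f ∈ Submodule.span K (Set.range v), (∀ i, Φ i f = 0) → f = 0) :
    Fintype.card ι ≤ ∑ i, finrank K (W i) := by
  have hd : Disjoint (Submodule.span K (Set.range v)) (LinearMap.ker (LinearMap.pi Φ)) := by
    rw [Submodule.disjoint_def]
    intro f hf hk
    refine h f hf fun i => ?_
    rw [LinearMap.mem_ker] at hk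
    exact congrFun hk i
  have h2 := (hv.map hd).fintype_card_le_finrank
  rwa [Module.finrank_pi_fintype] at h2

/-- the `K`-space of degree `ℓ` elements of the cokernel -/
abbrev MPiece (F : FreeComplex K n) (ℓ : ℤ) : Type := (freePiece (K := K) (n := n) (F.deg 0) ℓ) ⧸
    (Submodule.comap (freePiece (F.deg 0) ℓ).subtype
      ((LinearMap.range ((F.dd 0).mulVecLin)).restrictScalars K))

/-- send a polynomial to its degree `k` part times a basis element -/
def pieceMap (F : FreeComplex K n) (q : Fin (F.rk 0)) (k : ℕ) :
    PolyS K n →ₗ[K] MPiece F (k + F.deg 0 q) :=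
  (Submodule.mkQ _).comp (LinearMap.codRestrict (freePiece (F.deg 0) (k + F.deg 0 q))
      ((LinearMap.single K (fun _ => PolyS K n) q).comp
      (homogeneousComponent k)) (by
        intro f
        rw [mem_freePiece]
        intro r
        by_cases h : r = q
        · subst h
          simp only [LinearMap.comp_apply, LinearMap.coe_single, Pi.single_eq_same, add_sub_cancel_right]
          rw [homogZ_nat]
          exact homogeneousComponent_mem k f
        · simp [h]))

lemma pieceMap_eq_zero (F : FreeComplex K n) (q : Fin (F.rk 0)) (k : ℕ) (f : PolyS K n)
    (h : pieceMap F q k f = 0) :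
    Pi.single q (homogeneousComponent k f) ∈ LinearMap.range ((F.dd 0).mulVecLin) := by
  unfold pieceMap at h
  rw [LinearMap.comp_apply, Submodule.mkQ_apply] at h
  have h3 := (Submodule.Quotient.mk_eq_zero _).1 h
  exact h3

lemma growth_count (F : FreeComplex K n) {t : ℕ}
    (φ : MvPolynomial (Fin t) K →ₐ[K] (PolyS K n ⧸ annF F)) (hφ : Function.Injective φ) :
    ∃ D : ℕ, ∀ M : ℕ, (M + 1) ^ t ≤
      ∑ q : Fin (F.rk 0), ∑ k : Fin (D * M + 1), MPieceDim F ((k : ℕ) + F.deg 0 q) := by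
  choose p hp using fun i => Ideal.Quotient.mk_surjective (φ (X i))
  let D0 := ∑ i, (p i).totalDegree
  have hD0 : ∀ i, (p i).totalDegree ≤ D0 := fun i =>
    Finset.single_le_sum (f := fun i => (p i).totalDegree) (fun _ _ => Nat.zero_le _) (mem_univ _)
  let P : MvPolynomial (Fin t) K →ₐ[K] PolyS K n := aeval p
  have hP : ∀ f, Ideal.Quotient.mk (annF F) (P f) = φ f := by
    intro f
    have : (Ideal.Quotient.mkₐ K (annF F)).comp P = φ := by
      apply MvPolynomial.algHom_ext
      intro i
      simp [P, hp]
    rw [← this]; rfl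
  refine ⟨t * D0, fun M => ?_⟩
  let mon : (Fin t → Fin (M + 1)) → MvPolynomial (Fin t) K := fun e =>
    monomial (Finsupp.equivFunOnFinite.symm fun i => (e i : ℕ)) 1
  have hli : LinearIndependent K mon := by
    have h1 := (basisMonomials (Fin t) K).linearIndependent
    have h2 : Function.Injective (fun e : Fin t → Fin (M + 1) =>
        (Finsupp.equivFunOnFinite.symm fun i => (e i : ℕ) : Fin t →₀ ℕ)) := by
      intro e e' h
      funext i
      have := congrArg (fun f : Fin t →₀ ℕ => f i) h
      exact Fin.ext (by simpa using this)
    have := h1.comp _ h2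
    simpa [Function.comp_def] using this
  have hdeg : ∀ f ∈ Submodule.span K (Set.range mon), (P f).totalDegree ≤ t * D0 * M := by
    intro f hf
    induction hf using Submodule.span_induction with
    | mem x hx =>
      obtain ⟨e, rfl⟩ := hx
      simp only [mon, P, aeval_monomial, map_one, one_mul, Finsupp.prod_fintype, pow_zero, implies_true]
      refine (totalDegree_finsetProd _ _).trans ?_
      calc ∑ i, (p i ^ _).totalDegree ≤ ∑ i : Fin t, M * D0 := by
            refine Finset.sum_le_sum fun i _ => (totalDegree_pow _ _).trans ?_
            have := (e i).2
            exact Nat.mul_le_mul (by simp; omega) (hD0 i)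
        _ = _ := by simp; ring
    | zero => simp
    | add x y _ _ hx hy => 
      rw [map_add]
      exact (totalDegree_add _ _).trans (max_le hx hy)
    | smul c x _ hx =>
      rw [map_smul]
      exact (totalDegree_smul_le _ _).trans hx
  have key : ∀ f ∈ Submodule.span K (Set.range mon),
      (∀ qk : Fin (F.rk 0) × Fin (t * D0 * M + 1), (pieceMap F qk.1 qk.2 ∘ₗ P.toLinearMap) f = 0) → f = 0 := by
    intro f hf hk
    have hd := hdeg f hf
    apply hφ
    rw [map_zero, ← hP, Ideal.Quotient.eq_zero_iff_mem, mem_annF]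
    intro v
    have h0 : ∀ q, Pi.single q (P f) ∈ LinearMap.range ((F.dd 0).mulVecLin) := by
      intro q
      have h1 : ∀ k : ℕ, k < t * D0 * M + 1 → 
        Pi.single q (homogeneousComponent k (P f)) ∈ LinearMap.range ((F.dd 0).mulVecLin) := by
        intro k hk'
        exact pieceMap_eq_zero F q k (P f) (hk (q, ⟨k, hk'⟩))
      have h5 : P f = ∑ k ∈ range (t * D0 * M + 1), homogeneousComponent k (P f) := by
        conv_lhs => rw [← sum_homogeneousComponent (P f)]
        apply Finset.sum_subset
        · intro i hi; simp at hi ⊢; omega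
        · intro i _ hi
          apply homogeneousComponent_eq_zero
          simp at hi; omega
      rw [h5]
      have h6 := map_sum (LinearMap.single K (fun _ : Fin (F.rk 0) => PolyS K n) q)
        (fun k => homogeneousComponent k (P f)) (range (t * D0 * M + 1))
      simp only [LinearMap.coe_single] at h6
      rw [h6]
      exact Submodule.sum_mem _ fun k hk => h1 k (by simpa using hk)
    have : P f • v = ∑ q, v q • (Pi.single q (P f) : Fin (F.rk 0) → PolyS K n) := by
      funext r
      rw [Finset.sum_apply, Finset.sum_eq_single r]
      · simp [mul_comm]
      · intro b _ hb; simp [Ne.symm hb]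
      · simp
    rw [this]
    exact Submodule.sum_mem _ fun q _ => Submodule.smul_mem _ _ (h0 q)
  have h2 := li_card (W := fun qk : Fin (F.rk 0) × Fin (t * D0 * M + 1) => MPiece F ((qk.2 : ℕ) + F.deg 0 qk.1))
    (fun qk => pieceMap F qk.1 qk.2 ∘ₗ P.toLinearMap) mon hli key
  rw [Fintype.sum_prod_type] at h2
  simp only [Fintype.card_fun, Fintype.card_fin] at h2
  exact h2

theorem vanF {m : ℕ} (F : FreeComplex K (m + 1)) (hres : IsResolution F) {s : ℕ}
    (z : Fin s → ℤ) (a : ℚ)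
    (hP : hilbPoly F = Polynomial.C a * ∏ i : Fin s, (Polynomial.X - Polynomial.C ((z i : ℚ))))
    (j : ℕ) (hj : j + s < m) (e : ℤ) : cohomDim (dualCo F) j e = 0 := by
  by_cases hI : annF F = ⊤
  · refine cohomDim_van F hres (List.replicate (j+1) 1) ?_ ?_ j (by simp) e
    · generalize j + 1 = k
      have : ∀ k, ∀ (N : Type) [AddCommGroup N] [Module (PolyS K (m+1)) N],
          RingTheory.Sequence.IsWeaklyRegular N (List.replicate k (1 : PolyS K (m+1))) := by
        intro k
        induction k with
        | zero => intro N _ _; exact RingTheory.Sequence.IsWeaklyRegular.nil _ _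
        | succ k ih =>
          intro N _ _
          rw [List.replicate_succ, RingTheory.Sequence.isWeaklyRegular_cons_iff]
          exact ⟨IsSMulRegular.one N, ih _⟩
      exact this k _
    · intro b hb
      rw [← mem_annF, hI]; trivial
  · obtain ⟨rs, hreg, hrs, t, ht, φ, hφ⟩ := exists_regseq (m+1) (annF F) hI
    refine cohomDim_van F hres rs hreg (fun b hb => (mem_annF F b).1 (hrs b hb)) j ?_ e
    suffices t ≤ s + 1 by omega
    by_contra hts
    obtain ⟨D, hD⟩ := growth_count F φ hφ
    choose C hC using fun q => MPieceDim_bound F hres z a hP (F.deg 0 q)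
    let C' := ∑ q, C q * (D + 1) ^ (s + 1)
    have hub : ∀ M, (M + 1) ^ t ≤ C' * (M + 1) ^ (s + 1) := by
      intro M
      refine (hD M).trans ?_
      rw [Finset.sum_mul]
      refine Finset.sum_le_sum fun q _ => ?_
      have h1 : D * M + 1 ≤ (D + 1) * (M + 1) := by nlinarith
      calc ∑ k : Fin (D * M + 1), MPieceDim F ((k : ℕ) + F.deg 0 q)
          ≤ ∑ k : Fin (D * M + 1), C q * (D * M + 1) ^ s := by
            refine Finset.sum_le_sum fun k _ => (hC q k).trans ?_
            exact Nat.mul_le_mul_left _ (Nat.pow_le_pow_left (by have := k.2; omega) _)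
        _ = C q * (D * M + 1) ^ (s + 1) := by simp; ring
        _ ≤ C q * ((D + 1) * (M + 1)) ^ (s + 1) := 
            Nat.mul_le_mul_left _ (Nat.pow_le_pow_left h1 _)
        _ = _ := by rw [mul_pow]; ring
    have h1 := hub C'
    have h2 : (C' + 1) ^ (s + 2) ≤ (C' + 1) ^ t := Nat.pow_le_pow_right (by omega) (by omega)
    have h3 := h2.trans h1
    rw [show s + 2 = (s + 1) + 1 by ring, pow_succ, mul_comm] at h3
    have := Nat.le_of_mul_le_mul_right h3 (by positivity)
    omega

/-- Laurent polynomials -/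
abbrev Laur (K : Type) [Field K] (n : ℕ) : Type := AddMonoidAlgebra K (Fin n → ℤ)

/-- Laurent polynomials with exponents satisfying `P`. -/
def lsupp (P : (Fin n → ℤ) → Prop) : Submodule K (Laur K n) where
  carrier := {f | ∀ a, f.coeff a ≠ 0 → P a}
  zero_mem' := by intro a h; simp at h
  add_mem' := by
    intro f g hf hg a h
    by_cases h1 : f.coeff a = 0
    · by_cases h2 : g.coeff a = 0
      · simp [h1, h2] at h
      · exact hg a h2
    · exact hf a h1
  smul_mem' := by
    intro c f hf a h
    apply hf a
    intro h1
    simp [h1] at h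

lemma mem_lsupp {P : (Fin n → ℤ) → Prop} {f : Laur K n} :
    f ∈ lsupp P ↔ ∀ a, f.coeff a ≠ 0 → P a := Iff.rfl

lemma lsupp_mono {P Q : (Fin n → ℤ) → Prop} (h : ∀ a, P a → Q a) {f : Laur K n}
    (hf : f ∈ lsupp P) : f ∈ lsupp Q := fun a ha => h a (hf a ha)

lemma lsupp_mul {P Q R : (Fin n → ℤ) → Prop} (h : ∀ a b, P a → Q b → R (a + b)) {f g : Laur K n}
    (hf : f ∈ lsupp P) (hg : g ∈ lsupp Q) : f * g ∈ lsupp R := by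
  classical
  intro a ha
  have h1 := AddMonoidAlgebra.support_coeff_mul_subset f g (Finsupp.mem_support_iff.2 ha)
  rw [Finset.mem_add] at h1
  obtain ⟨b, hb, c, hc, rfl⟩ := h1
  exact h b c (hf b (Finsupp.mem_support_iff.1 hb)) (hg c (Finsupp.mem_support_iff.1 hc))

/-- Laurent monomial -/
def lmon (a : Fin n → ℤ) : Laur K n := AddMonoidAlgebra.single a 1

lemma lmon_mul (a b : Fin n → ℤ) : (lmon a : Laur K n) * lmon b = lmon (a + b) := by
  simp [lmon, AddMonoidAlgebra.single_mul_single]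

lemma lmon_zero : (lmon 0 : Laur K n) = 1 := rfl

lemma lmon_mem {P : (Fin n → ℤ) → Prop} {a : Fin n → ℤ} (h : P a) : (lmon a : Laur K n) ∈ lsupp P := by
  classical
  intro b hb
  rw [lmon, AddMonoidAlgebra.coeff_single, Finsupp.single_apply] at hb
  split_ifs at hb with h1
  · exact h1 ▸ h
  · exact absurd rfl hb

lemma coeff_lmon_mul (a b : Fin n → ℤ) (f : Laur K n) :
    (lmon a * f).coeff b = f.coeff (b - a) := by
  rw [lmon, AddMonoidAlgebra.coeff_single_mul_eq_mul_coeff (b - a), one_mul]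
  intro c _
  exact ⟨fun h => by rw [← h]; abel, fun h => by rw [h]; abel⟩

/-- embedding of polynomials in Laurent polynomials -/
def lau : PolyS K n →ₐ[K] Laur K n := aeval fun k => lmon (Pi.single k 1)

lemma lau_X (k : Fin n) : lau (X k : PolyS K n) = lmon (Pi.single k 1) := by
  simp [lau]

/-- integer exponent -/
def expZ (b : Fin n →₀ ℕ) : Fin n → ℤ := fun k => (b k : ℤ)

lemma lmon_pow (a : Fin n → ℤ) (k : ℕ) : (lmon a : Laur K n) ^ k = lmon (k • a) := by
  simp [lmon, AddMonoidAlgebra.single_pow]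

lemma lmon_prod {ι : Type} (s : Finset ι) (a : ι → Fin n → ℤ) :
    ∏ i ∈ s, (lmon (a i) : Laur K n) = lmon (∑ i ∈ s, a i) := by
  classical
  induction s using Finset.induction_on with
  | empty => simp [lmon_zero]
  | insert i s hi ih => rw [Finset.prod_insert hi, ih, lmon_mul, Finset.sum_insert hi]

lemma lau_monomial (b : Fin n →₀ ℕ) (c : K) :
    lau (monomial b c : PolyS K n) = c • lmon (expZ b) := by
  rw [lau, aeval_monomial, Finsupp.prod_fintype _ _ (by simp)]
  rw [Algebra.smul_def]
  congr 1
  simp only [lmon_pow]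
  rw [lmon_prod]
  congr 1
  funext k
  rw [Finset.sum_apply, Finset.sum_eq_single k]
  · simp [expZ]
  · intro i _ hi; simp [Ne.symm hi]
  · simp

lemma expZ_injective : Function.Injective (expZ : (Fin n →₀ ℕ) → Fin n → ℤ) := by
  intro a b h
  ext k
  have := congrFun h k
  simpa [expZ] using this

lemma lau_coeff (p : PolyS K n) (b : Fin n →₀ ℕ) : (lau p).coeff (expZ b) = p.coeff b := by
  classical
  induction p using MvPolynomial.induction_on' with
  | monomial u c =>
    rw [lau_monomial]
    simp [lmon, coeff_monomial, Finsupp.single_apply, expZ_injective.eq_iff]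
  | add p q hp hq => simp [hp, hq]

lemma lau_mem (p : PolyS K n) : lau p ∈ lsupp (fun a => ∀ k, 0 ≤ a k) := by
  induction p using MvPolynomial.induction_on' with
  | monomial u c =>
    rw [lau_monomial]
    exact Submodule.smul_mem _ _ (lmon_mem fun k => by simp [expZ])
  | add p q hp hq => rw [map_add]; exact Submodule.add_mem _ hp hq

lemma lau_injective : Function.Injective (lau : PolyS K n → Laur K n) := by
  intro p q h
  ext b
  rw [← lau_coeff, ← lau_coeff, h]

lemma expZ_surj {a : Fin n → ℤ} (h : ∀ k, 0 ≤ a k) : ∃ b, expZ b = a := by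
  refine ⟨Finsupp.equivFunOnFinite.symm fun k => (a k).toNat, ?_⟩
  funext k
  simp [expZ, h k]

lemma lau_surj {f : Laur K n} (hf : f ∈ lsupp (fun a => ∀ k, 0 ≤ a k)) : ∃ p : PolyS K n, lau p = f := by
  have h1 : f = ∑ a ∈ f.coeff.support, f.coeff a • lmon a := by
    conv_lhs => rw [← AddMonoidAlgebra.sum_coeff_single f]
    rw [Finsupp.sum]
    refine Finset.sum_congr rfl fun a _ => ?_
    simp [lmon, AddMonoidAlgebra.smul_single]
  rw [h1]
  have h2 : ∀ a ∈ f.coeff.support, f.coeff a • lmon a ∈ LinearMap.range (lau (K := K) (n := n)).toLinearMap := by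
    intro a ha
    obtain ⟨b, rfl⟩ := expZ_surj (hf a (Finsupp.mem_support_iff.1 ha))
    refine ⟨monomial b (f.coeff (expZ b)), ?_⟩
    exact lau_monomial _ _
  obtain ⟨p, hp⟩ := Submodule.sum_mem _ h2
  exact ⟨p, hp⟩

/-- degree of exponent -/
def expDeg (a : Fin n → ℤ) : ℤ := ∑ k, a k

lemma expDeg_add (a b : Fin n → ℤ) : expDeg (a + b) = expDeg a + expDeg b := by
  simp [expDeg, Finset.sum_add_distrib]

lemma expDeg_expZ (b : Fin n →₀ ℕ) : expDeg (expZ b) = (b.degree : ℤ) := by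
  simp [expDeg, expZ, Finsupp.degree_eq_sum]

lemma lau_homog {p : PolyS K n} {z : ℤ} :
    lau p ∈ lsupp (fun a => expDeg a = z) ↔ p ∈ homogZ K n z := by
  rcases lt_or_ge z 0 with hz | hz
  · rw [homogZ_of_neg hz, Submodule.mem_bot]
    constructor
    · intro h
      ext b
      rw [coeff_zero]
      by_contra hb
      rw [← lau_coeff] at hb
      have : expDeg (expZ b) = z := h _ hb
      rw [expDeg_expZ] at this
      omega
    · rintro rfl; rw [map_zero]; exact Submodule.zero_mem _
  · rw [homogZ_of_nonneg hz, mem_homogeneousSubmodule]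
    constructor
    · intro h b hb
      rw [← lau_coeff] at hb
      have : expDeg (expZ b) = z := h _ hb
      rw [expDeg_expZ] at this
      have h9 : Finsupp.weight (1 : Fin n → ℕ) b = b.degree := by
        rw [Finsupp.degree_eq_weight_one]; rfl
      rw [h9]
      omega
    · intro h a ha
      obtain ⟨b, rfl⟩ := expZ_surj (lau_mem p a ha)
      rw [lau_coeff] at ha
      have := h ha
      have h9 : Finsupp.weight (1 : Fin n → ℕ) b = b.degree := by
        rw [Finsupp.degree_eq_weight_one]; rfl
      rw [h9] at this
      rw [expDeg_expZ]
      omega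

open Classical in
/-- filter by exponents -/
def lflt (P : (Fin n → ℤ) → Prop) : Laur K n →ₗ[K] Laur K n where
  toFun f := AddMonoidAlgebra.ofCoeff (f.coeff.filter P)
  map_add' f g := by
    ext a
    simp [Finsupp.filter_add]
  map_smul' c f := by
    ext a
    simp [Finsupp.filter_smul]

open Classical in
lemma lflt_coeff (P : (Fin n → ℤ) → Prop) (f : Laur K n) (a : Fin n → ℤ) :
    (lflt P f).coeff a = if P a then f.coeff a else 0 := by
  simp [lflt, Finsupp.filter_apply]

lemma lflt_mem {P Q R : (Fin n → ℤ) → Prop} {f : Laur K n} (hf : f ∈ lsupp Q)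
    (h : ∀ a, P a → Q a → R a) : lflt P f ∈ lsupp R := by
  classical
  intro a ha
  rw [lflt_coeff] at ha
  split_ifs at ha with h1
  · exact h a h1 (hf a ha)
  · exact absurd rfl ha

lemma lflt_self {P : (Fin n → ℤ) → Prop} {f : Laur K n} (hf : f ∈ lsupp P) : lflt P f = f := by
  classical
  ext a
  rw [lflt_coeff]
  split_ifs with h
  · rfl
  · by_contra hc
    exact h (hf a (Ne.symm hc))

lemma lflt_zero {P : (Fin n → ℤ) → Prop} {f : Laur K n} (hf : f ∈ lsupp fun a => ¬ P a) : lflt P f = 0 := by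
  classical
  ext a
  rw [lflt_coeff]
  split_ifs with h
  · by_contra hc
    exact (hf a hc) h
  · rfl

lemma lflt_add_not (P : (Fin n → ℤ) → Prop) (f : Laur K n) : lflt P f + lflt (fun a => ¬ P a) f = f := by
  classical
  ext a
  simp only [AddMonoidAlgebra.coeff_add, Finsupp.add_apply, lflt_coeff]
  by_cases h : P a <;> simp [h]

lemma mem_ltrue (f : Laur K n) : f ∈ lsupp (fun _ : Fin n → ℤ => True) := fun _ _ => trivial

lemma lflt_mul {f : Laur K n} {c z : ℤ} (hf : f ∈ lsupp fun a => expDeg a = c) (g : Laur K n) :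
    lflt (fun a => expDeg a = z + c) (f * g) = f * lflt (fun a => expDeg a = z) g := by
  conv_lhs => rw [← lflt_add_not (fun a => expDeg a = z) g, mul_add, map_add]
  have h1 : lflt (fun a => expDeg a = z + c) (f * lflt (fun a => expDeg a = z) g) =
      f * lflt (fun a => expDeg a = z) g := by
    apply lflt_self
    refine lsupp_mul (Q := fun a => (expDeg a = z)) ?_ hf (lflt_mem (mem_ltrue g) fun a h _ => h)
    intro a b ha hb
    rw [expDeg_add]
    omega
  have h2 : lflt (fun a => expDeg a = z + c) (f * lflt (fun a => ¬ expDeg a = z) g) = 0 := by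
    apply lflt_zero
    refine lsupp_mul (Q := fun a => ¬ (expDeg a = z)) ?_ hf (lflt_mem (mem_ltrue g) fun a h _ => h)
    intro a b ha hb
    rw [expDeg_add]
    intro h; apply hb; omega
  rw [h1, h2, add_zero]

/-- exponents allowed in the localization at `x_I` -/
def inI (I : Finset (Fin n)) (a : Fin n → ℤ) : Prop := ∀ k, k ∉ I → 0 ≤ a k

/-- the degree `d` piece of the localization `S[x_I⁻¹]` -/
def LI (K : Type) [Field K] {n : ℕ} (I : Finset (Fin n)) (d : ℤ) : Submodule K (Laur K n) :=
  lsupp fun a => inI I a ∧ expDeg a = d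

lemma LI_mono {I J : Finset (Fin n)} (h : I ⊆ J) {d : ℤ} {f : Laur K n} (hf : f ∈ LI K I d) : f ∈ LI K J d :=
  lsupp_mono (fun _ ha => ⟨fun k hk => ha.1 k fun hk' => hk (h hk'), ha.2⟩) hf

lemma LI_mul {I : Finset (Fin n)} {c d : ℤ} {p : PolyS K n} {f : Laur K n} (hp : p ∈ homogZ K n c)
    (hf : f ∈ LI K I d) : lau p * f ∈ LI K I (c + d) := by
  have h1 : lau p ∈ lsupp fun a => (∀ k, 0 ≤ a k) ∧ expDeg a = c := fun a ha =>
    ⟨lau_mem p a ha, lau_homog.2 hp a ha⟩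
  refine lsupp_mul ?_ h1 hf
  rintro a b ⟨ha, ha'⟩ ⟨hb, hb'⟩
  refine ⟨fun k hk => ?_, ?_⟩
  · have := ha k; have := hb k hk; simp only [Pi.add_apply]; omega
  · rw [expDeg_add]; omega

lemma LI_mul_of_eq {I : Finset (Fin n)} {c d e : ℤ} {p : PolyS K n} {f : Laur K n} (hp : p ∈ homogZ K n c)
    (hf : f ∈ LI K I d) (h : c + d = e) : lau p * f ∈ LI K I e := h ▸ LI_mul hp hf

lemma LI_empty {d : ℤ} {f : Laur K n} (hf : f ∈ LI K ∅ d) : ∃ p ∈ homogZ K n d, lau p = f := by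
  obtain ⟨p, rfl⟩ := lau_surj (lsupp_mono (Q := fun a => ∀ k, 0 ≤ a k) (fun a ha k => ha.1 k (by simp)) hf)
  exact ⟨p, lau_homog.1 (lsupp_mono (fun a ha => ha.2) hf), rfl⟩

lemma lau_LI {d : ℤ} {p : PolyS K n} (hp : p ∈ homogZ K n d) (I : Finset (Fin n)) : lau p ∈ LI K I d :=
  fun a ha => ⟨fun k _ => lau_mem p a ha k, lau_homog.2 hp a ha⟩

/-- matrices act on Laurent vectors -/
def lact {a b : ℕ} (A : Matrix (Fin a) (Fin b) (PolyS K n)) : (Fin b → Laur K n) →ₗ[K] (Fin a → Laur K n) where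
  toFun v := fun p => ∑ q, lau (A p q) * v q
  map_add' u v := by funext p; simp [mul_add, Finset.sum_add_distrib]
  map_smul' c v := by funext p; simp [Finset.smul_sum]

lemma lact_apply {a b : ℕ} (A : Matrix (Fin a) (Fin b) (PolyS K n)) (v : Fin b → Laur K n) (p : Fin a) :
    lact A v p = ∑ q, lau (A p q) * v q := rfl

lemma lact_mul {a b c : ℕ} (A : Matrix (Fin a) (Fin b) (PolyS K n)) (B : Matrix (Fin b) (Fin c) (PolyS K n))
    (v : Fin c → Laur K n) : lact A (lact B v) = lact (A * B) v := by
  funext p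
  simp only [lact_apply, Matrix.mul_apply, map_sum, map_mul, Finset.mul_sum, Finset.sum_mul]
  rw [Finset.sum_comm]
  refine Finset.sum_congr rfl fun q _ => Finset.sum_congr rfl fun r _ => ?_
  ring

lemma lact_zero {a b : ℕ} (v : Fin b → Laur K n) : lact (0 : Matrix (Fin a) (Fin b) (PolyS K n)) v = 0 := by
  funext p; simp [lact_apply]

lemma lact_scale {a b : ℕ} (A : Matrix (Fin a) (Fin b) (PolyS K n)) (f : Laur K n) (v : Fin b → Laur K n) :
    lact A (fun q => f * v q) = fun p => f * lact A v p := by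
  funext p
  simp only [lact_apply, Finset.mul_sum]
  refine Finset.sum_congr rfl fun q _ => ?_
  ring

lemma lact_lau {a b : ℕ} (A : Matrix (Fin a) (Fin b) (PolyS K n)) (v : Fin b → PolyS K n) :
    lact A (fun q => lau (v q)) = fun p => lau (A.mulVec v p) := by
  funext p
  simp [lact_apply, Matrix.mulVec, dotProduct]

lemma lact_mem {a b : ℕ} {A : Matrix (Fin a) (Fin b) (PolyS K n)} {da : Fin a → ℤ} {db : Fin b → ℤ}
    (hA : ∀ p q, A p q ∈ homogZ K n (db q - da p)) {d : ℤ} {I : Finset (Fin n)} {v : Fin b → Laur K n}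
    (hv : ∀ q, v q ∈ LI K I (d - db q)) (p : Fin a) : lact A v p ∈ LI K I (d - da p) := by
  rw [lact_apply]
  exact Submodule.sum_mem _ fun q _ => LI_mul_of_eq (hA p q) (hv q) (by ring)

lemma exists_clear (I : Finset (Fin n)) {b : ℕ} (v : Fin b → Laur K n) (hv : ∀ q, v q ∈ lsupp (inI I)) :
    ∃ (N : ℤ) (w : Fin b → PolyS K n), ∀ q, lau (w q) = lmon (fun k => if k ∈ I then N else 0) * v q := by
  classical
  let N : ℤ := ∑ q, ∑ a ∈ (v q).coeff.support, ∑ k, |a k|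
  have hN : ∀ q a k, (v q).coeff a ≠ 0 → |a k| ≤ N := by
    intro q a k ha
    have h1 : |a k| ≤ ∑ k, |a k| :=
      Finset.single_le_sum (f := fun k => |a k|) (fun _ _ => abs_nonneg _) (mem_univ k)
    have h2 : ∑ k, |a k| ≤ ∑ a ∈ (v q).coeff.support, ∑ k, |a k| :=
      Finset.single_le_sum (f := fun a : Fin n → ℤ => ∑ k, |a k|)
        (fun _ _ => Finset.sum_nonneg fun _ _ => abs_nonneg _) (Finsupp.mem_support_iff.2 ha)
    have h3 : ∑ a ∈ (v q).coeff.support, ∑ k, |a k| ≤ N :=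
      Finset.single_le_sum (f := fun q => ∑ a ∈ (v q).coeff.support, ∑ k, |a k|)
        (fun _ _ => Finset.sum_nonneg fun _ _ => Finset.sum_nonneg fun _ _ => abs_nonneg _) (mem_univ q)
    omega
  have : ∀ q, ∃ w : PolyS K n, lau w = lmon (fun k => if k ∈ I then N else 0) * v q := by
    intro q
    apply lau_surj
    intro a ha k
    rw [coeff_lmon_mul] at ha
    by_cases hk : k ∈ I
    · have := hN q _ k ha
      simp only [Pi.sub_apply, hk, if_true] at this
      have := neg_abs_le (a k - N)
      omega
    · have := hv q _ ha k hk
      simpa [hk] using this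
  choose w hw using this
  exact ⟨N, w, hw⟩

lemma col_exact {a b c : ℕ} {A : Matrix (Fin a) (Fin b) (PolyS K n)} {B : Matrix (Fin b) (Fin c) (PolyS K n)}
    {db : Fin b → ℤ} {dc : Fin c → ℤ}
    (hB : ∀ p q, B p q ∈ homogZ K n (dc q - db p))
    (hex : LinearMap.ker A.mulVecLin = LinearMap.range B.mulVecLin) (I : Finset (Fin n)) (d : ℤ)
    (v : Fin b → Laur K n) (hv : ∀ q, v q ∈ LI K I (d - db q)) (h0 : lact A v = 0) :
    ∃ u : Fin c → Laur K n, (∀ q, u q ∈ LI K I (d - dc q)) ∧ lact B u = v := by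
  obtain ⟨N, w, hw⟩ := exists_clear I v (fun q => lsupp_mono (fun a ha => ha.1) (hv q))
  have h1 : w ∈ LinearMap.ker A.mulVecLin := by
    rw [LinearMap.mem_ker]
    funext p
    apply lau_injective
    have := congrFun (lact_lau A w) p
    rw [Matrix.mulVecLin_apply, ← this]
    have h2 : (fun q => lau (w q)) = fun q => lmon (fun k => if k ∈ I then N else 0) * v q := funext hw
    rw [h2, lact_scale, h0]
    simp
  rw [hex] at h1
  obtain ⟨u, hu⟩ := h1
  rw [Matrix.mulVecLin_apply] at hu
  let u1 : Fin c → Laur K n := fun q => lmon (fun k => if k ∈ I then -N else 0) * lau (u q)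
  have hu1 : lact B u1 = v := by
    rw [show u1 = fun q => lmon (fun k => if k ∈ I then -N else 0) * (fun q => lau (u q)) q from rfl,
      lact_scale, lact_lau, hu]
    funext p
    simp only [hw]
    rw [← mul_assoc, lmon_mul]
    have : ((fun k => if k ∈ I then -N else 0) + fun k => if k ∈ I then N else 0 : Fin n → ℤ) = 0 := by
      funext k; by_cases hk : k ∈ I <;> simp [hk]
    rw [this, lmon_zero, one_mul]
  have hu1m : ∀ q, u1 q ∈ lsupp (inI I) := by
    intro q
    refine lsupp_mul (P := inI I) ?_ (lmon_mem ?_) (lau_mem (u q))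
    · intro x y hx hy k hk
      have := hx k hk; have := hy k; simp only [Pi.add_apply]; omega
    · intro k hk; simp [hk]
  refine ⟨fun q => lflt (fun a => expDeg a = d - dc q) (u1 q), fun q =>
    lflt_mem (hu1m q) (fun a h1 h2 => ⟨h2, h1⟩), ?_⟩
  funext p
  have h3 : lflt (fun a => expDeg a = d - db p) (v p) = v p :=
    lflt_self (lsupp_mono (fun a ha => ha.2) (hv p))
  rw [← h3]
  conv_rhs => rw [← hu1, lact_apply, map_sum]
  rw [lact_apply]
  refine Finset.sum_congr rfl fun q _ => ?_
  rw [← lflt_mul (lau_homog.2 (hB p q))]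
  congr 2
  funext a
  rw [show d - dc q + (dc q - db p) = d - db p by ring]

/-- Koszul sign -/
def ksgn (k : Fin n) (J : Finset (Fin n)) : ℤ := (-1) ^ (J.filter (fun t => t < k)).card

lemma ksgn_sq (k : Fin n) (J : Finset (Fin n)) : ksgn k J * ksgn k J = 1 := by
  unfold ksgn
  rw [← pow_add, ← two_mul, pow_mul]; simp

lemma ksgn_erase (k l : Fin n) (J : Finset (Fin n)) (hl : l ∈ J) :
    ksgn k (J.erase l) = (if l < k then -1 else 1) * ksgn k J := by
  unfold ksgn
  rw [Finset.filter_erase]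
  split_ifs with h
  · have h1 : l ∈ J.filter (fun t => t < k) := by simp [hl, h]
    rw [← Finset.card_erase_add_one h1, pow_succ]
    ring
  · rw [Finset.erase_eq_of_notMem (by simp [h])]; simp

lemma ksgn_insert (k l : Fin n) (J : Finset (Fin n)) (hl : l ∉ J) :
    ksgn k (insert l J) = (if l < k then -1 else 1) * ksgn k J := by
  have h := ksgn_erase k l (insert l J) (mem_insert_self _ _)
  rw [Finset.erase_insert hl] at h
  rw [h, ← mul_assoc]
  split_ifs <;> simp

section Koszul
variable {X : Type} [AddCommGroup X] [Module K X]

/-- Koszul differential -/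
def kd (f : Fin n → X →ₗ[K] X) : (Finset (Fin n) → X) →ₗ[K] (Finset (Fin n) → X) where
  toFun y := fun J => ∑ k ∈ J, ksgn k J • f k (y (J.erase k))
  map_add' u v := by funext J; simp [Finset.sum_add_distrib]
  map_smul' c v := by
    funext J
    simp only [Pi.smul_apply, map_smul, RingHom.id_apply, Finset.smul_sum]
    exact Finset.sum_congr rfl fun k _ => smul_comm _ _ _

lemma kd_apply (f : Fin n → X →ₗ[K] X) (y : Finset (Fin n) → X) (J : Finset (Fin n)) :
    kd f y J = ∑ k ∈ J, ksgn k J • f k (y (J.erase k)) := rfl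

/-- Koszul homotopy -/
def kh (u : Fin n → X →ₗ[K] X) : (Finset (Fin n) → X) →ₗ[K] (Finset (Fin n) → X) where
  toFun y := fun J => ∑ k ∈ Jᶜ, ksgn k J • u k (y (insert k J))
  map_add' u v := by funext J; simp [Finset.sum_add_distrib]
  map_smul' c v := by
    funext J
    simp only [Pi.smul_apply, map_smul, RingHom.id_apply, Finset.smul_sum]
    exact Finset.sum_congr rfl fun k _ => smul_comm _ _ _

lemma kh_apply (f : Fin n → X →ₗ[K] X) (y : Finset (Fin n) → X) (J : Finset (Fin n)) :
    kh f y J = ∑ k ∈ Jᶜ, ksgn k J • f k (y (insert k J)) := rfl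

lemma kd_kd (f : Fin n → X →ₗ[K] X) (hf : ∀ k l x, f k (f l x) = f l (f k x)) (y : Finset (Fin n) → X) :
    kd f (kd f y) = 0 := by
  funext J
  rw [Pi.zero_apply, kd_apply]
  simp only [kd_apply, map_sum, Finset.smul_sum]
  rw [Finset.sum_sigma']
  refine Finset.sum_involution (fun a _ => ⟨a.2, a.1⟩) ?_ ?_ ?_ ?_
  · rintro ⟨k, l⟩ h
    simp only [mem_sigma, mem_erase] at h
    obtain ⟨hk, hlk, hl⟩ := h
    simp only [map_zsmul]
    rw [ksgn_erase l k J hk, ksgn_erase k l J hl, Finset.erase_right_comm, hf k l, smul_smul, smul_smul,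
      ← add_smul]
    have : ksgn k J * ((if k < l then -1 else 1) * ksgn l J) + ksgn l J * ((if l < k then -1 else 1) * ksgn k J) = 0 := by
      rcases lt_or_gt_of_ne hlk with h | h
      · rw [if_neg (not_lt.2 h.le), if_pos h]; ring
      · rw [if_neg (not_lt.2 h.le), if_pos h]; ring
    rw [this, zero_smul]
  · rintro ⟨k, l⟩ h _ he
    simp only [mem_sigma, mem_erase] at h
    have : l = k := congrArg Sigma.fst he
    exact h.2.1 this
  · rintro ⟨k, l⟩ h
    simp only [mem_sigma, mem_erase] at h ⊢
    exact ⟨h.2.2, Ne.symm h.2.1, h.1⟩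
  · rintro ⟨k, l⟩ h; rfl

lemma kd_kh (f u : Fin n → X →ₗ[K] X) (hf : ∀ k l x, u k (f l x) = f l (u k x)) (y : Finset (Fin n) → X) (J) :
    kd f (kh u y) J + kh u (kd f y) J = ∑ k, f k (u k (y J)) := by
  have h1 : kd f (kh u y) J = ∑ k ∈ J, f k (u k (y J)) + ∑ k ∈ J, ∑ l ∈ Jᶜ,
      (ksgn k J * ((if k < l then -1 else 1) * ksgn l J)) • f k (u l (y (insert l (J.erase k)))) := by
    rw [kd_apply, ← Finset.sum_add_distrib]
    refine Finset.sum_congr rfl fun k hk => ?_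
    have : (J.erase k)ᶜ = insert k Jᶜ := by
      ext t; simp only [mem_compl, mem_erase, mem_insert]; tauto
    rw [kh_apply, this, Finset.sum_insert (by simp [hk]), map_add, smul_add, map_zsmul, smul_smul,
      Finset.insert_erase hk, ksgn_erase k k J hk, if_neg (lt_irrefl _), one_mul, ksgn_sq, one_smul,
      map_sum, Finset.smul_sum]
    congr 1
    refine Finset.sum_congr rfl fun l hl => ?_
    rw [map_zsmul, smul_smul, ksgn_erase l k J hk]
  have h2 : kh u (kd f y) J = ∑ k ∈ Jᶜ, f k (u k (y J)) + ∑ l ∈ Jᶜ, ∑ k ∈ J,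
      (ksgn l J * ((if l < k then -1 else 1) * ksgn k J)) • f k (u l (y (insert l (J.erase k)))) := by
    rw [kh_apply, ← Finset.sum_add_distrib]
    refine Finset.sum_congr rfl fun l hl => ?_
    rw [mem_compl] at hl
    rw [kd_apply, Finset.sum_insert hl, map_add, smul_add, map_zsmul, smul_smul,
      Finset.erase_insert hl, ksgn_insert l l J hl, if_neg (lt_irrefl _), one_mul, ksgn_sq, one_smul,
      map_sum, Finset.smul_sum, hf]
    congr 1
    refine Finset.sum_congr rfl fun k hk => ?_
    have : l ≠ k := fun h => hl (h ▸ hk)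
    rw [map_zsmul, smul_smul, ksgn_insert k l J hl, hf, Finset.erase_insert_of_ne this]
  rw [h1, h2]
  rw [Finset.sum_comm (s := Jᶜ)]
  rw [add_add_add_comm, Finset.sum_add_sum_compl, ← Finset.sum_add_distrib]
  conv_rhs => rw [← add_zero (∑ k, f k (u k (y J)))]
  congr 1
  refine Finset.sum_eq_zero fun k hk => ?_
  rw [← Finset.sum_add_distrib]
  refine Finset.sum_eq_zero fun l hl => ?_
  rw [mem_compl] at hl
  have hlk : l ≠ k := fun h => hl (h ▸ hk)
  rw [← add_smul]
  have : ksgn k J * ((if k < l then -1 else 1) * ksgn l J) + ksgn l J * ((if l < k then -1 else 1) * ksgn k J) = 0 := by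
    rcases lt_or_gt_of_ne hlk with h | h
    · rw [if_neg (not_lt.2 h.le), if_pos h]; ring
    · rw [if_neg (not_lt.2 h.le), if_pos h]; ring
  rw [this, zero_smul]

end Koszul

/-- values of Cech-type cochains -/
abbrev XT (F : FreeComplex K n) : Type := (j : ℕ) → Fin (F.rk j) → Laur K n
/-- ambient space of the total complex -/
abbrev YT (F : FreeComplex K n) : Type := Finset (Fin n) → XT F

/-- Cech differential -/
def DC (F : FreeComplex K n) : YT F →ₗ[K] YT F := kd fun _ => LinearMap.id

/-- differential of F on XT -/
def dX (F : FreeComplex K n) : XT F →ₗ[K] XT F := LinearMap.pi fun j =>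
  (lact (F.dd j)).comp (LinearMap.proj (j + 1))

lemma dX_apply (F : FreeComplex K n) (x : XT F) (j : ℕ) : dX F x j = lact (F.dd j) (x (j + 1)) := rfl

lemma dX_dX (F : FreeComplex K n) (x : XT F) : dX F (dX F x) = 0 := by
  funext j
  rw [dX_apply, dX_apply, lact_mul, F.isComplex, lact_zero]; rfl

/-- signed differential of F -/
def DF (F : FreeComplex K n) : YT F →ₗ[K] YT F where
  toFun y := fun I => ((-1 : ℤ) ^ I.card) • dX F (y I)
  map_add' u v := by funext J; simp
  map_smul' c v := by
    funext J
    simp only [Pi.smul_apply, map_smul, RingHom.id_apply]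
    exact smul_comm _ _ _

lemma DF_apply (F : FreeComplex K n) (y : YT F) (I) : DF F y I = ((-1 : ℤ) ^ I.card) • dX F (y I) := rfl

lemma DC_apply (F : FreeComplex K n) (y : YT F) (I) : DC F y I = ∑ k ∈ I, ksgn k I • y (I.erase k) := rfl

/-- total differential -/
def DT (F : FreeComplex K n) : YT F →ₗ[K] YT F := DC F + DF F

lemma DT_apply (F : FreeComplex K n) (y : YT F) : DT F y = DC F y + DF F y := rfl

lemma DF_DF (F : FreeComplex K n) (y : YT F) : DF F (DF F y) = 0 := by
  funext I
  rw [DF_apply, DF_apply, map_zsmul, dX_dX]; simp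

lemma DC_DC (F : FreeComplex K n) (y : YT F) : DC F (DC F y) = 0 := kd_kd _ (fun _ _ _ => rfl) y

lemma DC_DF (F : FreeComplex K n) (y : YT F) : DC F (DF F y) + DF F (DC F y) = 0 := by
  funext I
  rw [Pi.add_apply, DF_apply, DC_apply, DC_apply, map_sum, Finset.smul_sum, ← Finset.sum_add_distrib]
  refine Finset.sum_eq_zero fun k hk => ?_
  rw [DF_apply, map_zsmul, ← Finset.card_erase_add_one hk, smul_smul, smul_smul, ← add_smul, pow_succ]
  have : ksgn k I * (-1) ^ (I.erase k).card + (-1) ^ (I.erase k).card * (-1) * ksgn k I = 0 := by ring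
  rw [this, zero_smul]

lemma DT_DT (F : FreeComplex K n) (y : YT F) : DT F (DT F y) = 0 := by
  rw [DT_apply, DT_apply, map_add, map_add, DC_DC, DF_DF, zero_add, add_zero, DC_DF]

/-- degree-d cochains of total degree i -/
def VT (F : FreeComplex K n) (i d : ℤ) : Submodule K (YT F) where
  carrier := {y | ∀ I j r, y I j r ∈ LI K I (d - F.deg j r) ∧ ((I.card : ℤ) - j ≠ i → y I j r = 0)}
  zero_mem' := fun I j r => ⟨Submodule.zero_mem _, fun _ => rfl⟩
  add_mem' := fun {u v} hu hv I j r => ⟨Submodule.add_mem _ (hu I j r).1 (hv I j r).1, fun h => by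
    have h1 := (hu I j r).2 h
    have h2 := (hv I j r).2 h
    simp [h1, h2]⟩
  smul_mem' := fun c {u} hu I j r => ⟨Submodule.smul_mem _ _ (hu I j r).1, fun h => by
    have h1 := (hu I j r).2 h
    simp [h1]⟩

lemma zsmul_mem_LI {I : Finset (Fin n)} {d : ℤ} (c : ℤ) {f : Laur K n} (h : f ∈ LI K I d) : c • f ∈ LI K I d :=
  zsmul_mem h c

lemma DC_mem {F : FreeComplex K n} {i d : ℤ} {y : YT F} (hy : y ∈ VT F i d) : DC F y ∈ VT F (i + 1) d := by
  intro I j r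
  have h : DC F y I j r = ∑ k ∈ I, ksgn k I • y (I.erase k) j r := by
    rw [DC_apply]; simp [Finset.sum_apply]
  rw [h]
  refine ⟨Submodule.sum_mem _ fun k hk => zsmul_mem_LI _ (LI_mono (erase_subset _ _) (hy _ j r).1), fun hne => ?_⟩
  refine Finset.sum_eq_zero fun k hk => ?_
  rw [(hy (I.erase k) j r).2, smul_zero]
  have := Finset.card_erase_add_one hk
  intro h2; apply hne; rw [← this]; push_cast; omega

lemma DF_mem {F : FreeComplex K n} {i d : ℤ} {y : YT F} (hy : y ∈ VT F i d) : DF F y ∈ VT F (i + 1) d := by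
  intro I j r
  have h : DF F y I j r = ((-1 : ℤ) ^ I.card) • lact (F.dd j) (y I (j + 1)) r := rfl
  rw [h]
  refine ⟨zsmul_mem_LI _ (lact_mem (F.isHomog j) (fun q => (hy I (j + 1) q).1) r), fun hne => ?_⟩
  have : y I (j + 1) = 0 := by
    funext q
    exact (hy I (j + 1) q).2 (by push_cast; omega)
  rw [this, map_zero]; simp

lemma DT_mem {F : FreeComplex K n} {i d : ℤ} {y : YT F} (hy : y ∈ VT F i d) : DT F y ∈ VT F (i + 1) d :=
  Submodule.add_mem _ (DC_mem hy) (DF_mem hy)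

/-- all exponents negative -/
def aneg (a : Fin n → ℤ) : Prop := ∀ k, a k < 0

/-- first nonnegative index -/
def firstNN (k : Fin n) (a : Fin n → ℤ) : Prop := 0 ≤ a k ∧ ∀ l, l < k → a l < 0

lemma sum_firstNN (f : Laur K n) : ∑ k, lflt (firstNN k) f = lflt (fun a => ¬ aneg a) f := by
  classical
  ext a
  rw [AddMonoidAlgebra.coeff_sum, Finsupp.finsetSum_apply]
  simp only [lflt_coeff]
  split_ifs with h
  swap
  · have h : ∃ k, 0 ≤ a k := by
      by_contra hc
      exact h fun k => by
        by_contra hk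
        exact hc ⟨k, not_lt.1 hk⟩
    have hne : (univ.filter fun k => 0 ≤ a k).Nonempty := by
      obtain ⟨k, hk⟩ := h; exact ⟨k, by simp [hk]⟩
    obtain ⟨k0, hk0, hmin⟩ := Finset.exists_minimal hne
    simp only [mem_filter, mem_univ, true_and] at hk0 hmin
    have hk1 : ∀ l, l < k0 → a l < 0 := fun l hl => by
      by_contra hc
      exact absurd (hmin (not_lt.1 hc) hl.le) (not_le.2 hl)
    rw [Finset.sum_eq_single k0]
    · rw [if_pos ⟨hk0, hk1⟩]
    · intro k _ hk
      rw [if_neg]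
      rintro ⟨h1, h2⟩
      rcases lt_or_gt_of_ne hk with h | h
      · have := hk1 k h; omega
      · have := h2 k0 h; omega
    · simp
  · refine Finset.sum_eq_zero fun k _ => ?_
    rw [if_neg]
    rintro ⟨h1, _⟩
    have := h k; omega

/-- filter acting on XT -/
def uX (F : FreeComplex K n) (k : Fin n) : XT F →ₗ[K] XT F where
  toFun x := fun j r => lflt (firstNN k) (x j r)
  map_add' x y := by funext j r; simp
  map_smul' c x := by funext j r; simp

/-- Cech homotopy -/
def hC (F : FreeComplex K n) : YT F →ₗ[K] YT F := kh (uX F)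

lemma hC_apply (F : FreeComplex K n) (y : YT F) (I j r) :
    hC F y I j r = ∑ k ∈ Iᶜ, ksgn k I • lflt (firstNN k) (y (insert k I) j r) := by
  unfold hC; rw [kh_apply]; simp [Finset.sum_apply, uX]

lemma hC_univ (F : FreeComplex K n) (y : YT F) : hC F y univ = 0 := by
  unfold hC; rw [kh_apply]; simp

lemma hC_mem {F : FreeComplex K n} {i d : ℤ} {y : YT F} (hy : y ∈ VT F i d) : hC F y ∈ VT F (i - 1) d := by
  intro I j r
  rw [hC_apply]
  refine ⟨Submodule.sum_mem _ fun k hk => zsmul_mem_LI _ ?_, fun hne => ?_⟩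
  · refine lflt_mem (hy _ j r).1 fun a ha hb => ⟨fun l hl => ?_, hb.2⟩
    by_cases hlk : l = k
    · rw [hlk]; exact ha.1
    · exact hb.1 l (by simp [hlk, hl])
  · refine Finset.sum_eq_zero fun k hk => ?_
    rw [mem_compl] at hk
    rw [(hy (insert k I) j r).2, map_zero, smul_zero]
    rw [Finset.card_insert_of_notMem hk]; push_cast; omega

lemma hC_homotopy {F : FreeComplex K n} {i d : ℤ} {y : YT F} (hy : y ∈ VT F i d)
    (h0 : ∀ j r, y univ j r ∈ lsupp (fun a => ¬ aneg a)) : DC F (hC F y) + hC F (DC F y) = y := by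
  funext I
  have h1 := kd_kh (fun _ => LinearMap.id) (uX F) (fun _ _ _ => rfl) y I
  have h2 : (DC F (hC F y) + hC F (DC F y)) I = ∑ k, uX F k (y I) := h1
  rw [h2]
  funext j r
  have h3 : (∑ k, uX F k (y I)) j r = ∑ k, lflt (firstNN k) (y I j r) := by
    simp [Finset.sum_apply, uX]
  rw [h3, sum_firstNN]
  apply lflt_self
  by_cases hI : I = univ
  · rw [hI]; exact h0 j r
  · obtain ⟨k, hk⟩ : ∃ k, k ∉ I := by
      by_contra hc; push Not at hc; exact hI (eq_univ_iff_forall.2 hc)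
    refine lsupp_mono (fun a ha hb => ?_) (hy I j r).1
    have := ha.1 k hk; have := hb k; omega

lemma V1_aux {F : FreeComplex K n} {i d : ℤ} (N : ℕ) : ∀ {w : YT F}, w ∈ VT F i d → DT F w = 0 →
    (∀ j r, w univ j r ∈ lsupp (fun a => ¬ aneg a)) → (∀ I j, N ≤ j → w I j = 0) →
    ∃ v ∈ VT F (i - 1) d, v univ = 0 ∧ DT F v = w := by
  induction N with
  | zero =>
    intro w _ _ _ h
    refine ⟨0, Submodule.zero_mem _, rfl, ?_⟩
    rw [map_zero]; funext I j; rw [h I j (Nat.zero_le _)]; rfl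
  | succ N ih =>
    intro w hw hD hu hN
    have hv0 := hC_mem hw
    have hDv0 : DT F (hC F w) ∈ VT F i d := by simpa using DT_mem hv0
    have e1 := hC_homotopy hw hu
    have e2 : DC F w = - DF F w := eq_neg_of_add_eq_zero_left hD
    have e3 : w - DT F (hC F w) = - hC F (DF F w) - DF F (hC F w) := by
      rw [e2, map_neg] at e1
      rw [DT_apply]
      nth_rewrite 1 [← e1]
      abel
    obtain ⟨v, hv, hvu, hvD⟩ := ih (w := w - DT F (hC F w)) (Submodule.sub_mem _ hw hDv0)
      (by rw [map_sub, hD, DT_DT, sub_zero]) (by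
        intro j r
        have : (w - DT F (hC F w)) univ j r = 0 := by
          rw [e3]
          have h1 : DF F (hC F w) univ = 0 := by rw [DF_apply, hC_univ]; simp
          have h2 := hC_univ F (DF F w)
          simp [h1, h2]
        rw [this]; exact Submodule.zero_mem _) (by
        intro I j hj
        rw [e3]
        have hFw : ∀ I, DF F w I j = 0 := by
          intro I
          have : DF F w I j = ((-1 : ℤ) ^ I.card) • lact (F.dd j) (w I (j + 1)) := rfl
          rw [this, hN I (j + 1) (by omega), map_zero, smul_zero]
        have hh : ∀ r, hC F (DF F w) I j r = 0 := by
          intro r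
          rw [hC_apply]
          exact Finset.sum_eq_zero fun k _ => by rw [hFw]; simp
        have hg : DF F (hC F w) I j = 0 := by
          have : DF F (hC F w) I j = ((-1 : ℤ) ^ I.card) • lact (F.dd j) (hC F w I (j + 1)) := rfl
          rw [this]
          have : hC F w I (j + 1) = 0 := by
            funext r
            rw [hC_apply]
            exact Finset.sum_eq_zero fun k _ => by rw [hN _ (j + 1) (by omega)]; simp
          rw [this, map_zero, smul_zero]
        funext r
        simp [hg, hh])
    refine ⟨v + hC F w, Submodule.add_mem _ hv hv0, ?_, ?_⟩
    · rw [Pi.add_apply, hvu, hC_univ, add_zero]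
    · rw [map_add, hvD]; abel

lemma V1 {F : FreeComplex K n} {i d : ℤ} {w : YT F} (hw : w ∈ VT F i d) (hD : DT F w = 0)
    (hu : ∀ j r, w univ j r ∈ lsupp (fun a => ¬ aneg a)) :
    ∃ v ∈ VT F (i - 1) d, v univ = 0 ∧ DT F v = w := by
  refine V1_aux (F.len + 1) hw hD hu fun I j hj => ?_
  funext r
  have := F.rk_eq_zero j (by omega)
  exact absurd r.2 (by omega)

lemma V2_aux {F : FreeComplex K n} (hres : IsResolution F) {i d : ℤ} (q : ℕ) : ∀ (p : ℕ), p + q = n + 1 → i < p →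
    ∀ {w : YT F}, w ∈ VT F i d → DT F w = 0 → (∀ I, I.card < p → w I = 0) →
    ∃ v ∈ VT F (i - 1) d, (∀ I, I.card < p → v I = 0) ∧ DT F v = w := by
  induction q with
  | zero =>
    intro p hp hi w hw hD h0
    refine ⟨0, Submodule.zero_mem _, fun _ _ => rfl, ?_⟩
    rw [map_zero]; funext I; rw [h0 I]; · rfl
    have := Finset.card_le_univ I
    simp at this; omega
  | succ q ih =>
    intro p hp hi w hw hD h0
    have key : ∀ (I : Finset (Fin n)) (j : ℕ), ∃ u : Fin (F.rk (j + 1)) → Laur K n,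
        I.card = p → (p : ℤ) - j = i → (∀ q, u q ∈ LI K I (d - F.deg (j + 1) q)) ∧
          ((-1 : ℤ) ^ p) • lact (F.dd j) u = w I j := by
      intro I j
      by_cases hc : I.card = p ∧ (p : ℤ) - j = i
      · obtain ⟨hI, hj⟩ := hc
        obtain ⟨j, rfl⟩ : ∃ j', j = j' + 1 := ⟨j - 1, by omega⟩
        have h1 : lact (F.dd j) (w I (j + 1)) = 0 := by
          have e1 : DT F w I j = 0 := by rw [hD]; rfl
          have e2 : DC F w I = 0 := by
            rw [DC_apply]
            refine Finset.sum_eq_zero fun k hk => ?_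
            rw [h0 (I.erase k), smul_zero]
            have := Finset.card_erase_add_one hk; omega
          rw [DT_apply, Pi.add_apply, e2, zero_add, DF_apply] at e1
          have e3 : ((-1 : ℤ) ^ I.card) • lact (F.dd j) (w I (j + 1)) = 0 := e1
          have e4 := congrArg (fun x => ((-1 : ℤ) ^ I.card) • x) e3
          simp only [smul_smul, smul_zero] at e4
          rw [← pow_add, ← two_mul, pow_mul] at e4
          simpa using e4
        obtain ⟨u, hu, hu'⟩ := col_exact (F.isHomog (j + 1)) (hres j) I d (w I (j + 1))
          (fun r => (hw I (j + 1) r).1) h1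
        refine ⟨((-1 : ℤ) ^ p) • u, fun _ _ => ⟨fun q => zsmul_mem_LI _ (hu q), ?_⟩⟩
        rw [map_zsmul, smul_smul, ← pow_add, ← two_mul, pow_mul, hu']
        simp
      · exact ⟨0, fun h1 h2 => absurd ⟨h1, h2⟩ hc⟩
    choose U hU using key
    let v0 : YT F := fun I j => match j with
      | 0 => 0
      | (j' + 1) => if I.card = p ∧ (p : ℤ) - j' = i then U I j' else 0
    have hv0s : ∀ I j', v0 I (j' + 1) = if I.card = p ∧ (p : ℤ) - j' = i then U I j' else 0 := fun _ _ => rfl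
    have hv00 : ∀ I, v0 I 0 = 0 := fun _ => rfl
    have hv0z : ∀ I, I.card ≠ p → v0 I = 0 := by
      intro I hI
      funext j
      cases j with
      | zero => exact hv00 I
      | succ j => rw [hv0s, if_neg (fun h => hI h.1)]; rfl
    have hv0 : v0 ∈ VT F (i - 1) d := by
      intro I j r
      cases j with
      | zero =>
        have h1 : v0 I 0 r = 0 := congrFun (hv00 I) r
        rw [h1]; exact ⟨Submodule.zero_mem _, fun _ => rfl⟩
      | succ j =>
        rw [hv0s]
        split_ifs with h
        · refine ⟨(hU I j h.1 h.2).1 r, fun hne => absurd ?_ hne⟩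
          rw [h.1]; push_cast; omega
        · exact ⟨Submodule.zero_mem _, fun _ => rfl⟩
    have hDv0 : DT F v0 ∈ VT F i d := by simpa using DT_mem hv0
    have hz : ∀ I, I.card < p + 1 → (w - DT F v0) I = 0 := by
      intro I hI
      have e2 : DC F v0 I = 0 := by
        rw [DC_apply]
        refine Finset.sum_eq_zero fun k hk => ?_
        rw [hv0z (I.erase k), smul_zero]
        have := Finset.card_erase_add_one hk; omega
      rw [Pi.sub_apply, DT_apply, Pi.add_apply, e2, zero_add]
      rcases (show I.card < p ∨ I.card = p by omega) with h | h
      · rw [h0 I h, DF_apply, hv0z I (by omega)]; simp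
      · funext j
        have e5 : DF F v0 I j = ((-1 : ℤ) ^ I.card) • lact (F.dd j) (v0 I (j + 1)) := rfl
        rw [Pi.sub_apply, e5, hv0s]
        split_ifs with hc
        · rw [hc.1, (hU I j hc.1 hc.2).2, sub_self]; rfl
        · rw [map_zero, smul_zero, sub_zero]
          funext r
          exact (hw I j r).2 (fun hh => hc ⟨h, by rw [← h]; exact hh⟩)
    obtain ⟨v, hv, hv1, hv2⟩ := ih (p + 1) (by omega) (by push_cast; omega) (w := w - DT F v0)
      (Submodule.sub_mem _ hw hDv0) (by rw [map_sub, hD, DT_DT, sub_zero]) hz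
    refine ⟨v + v0, Submodule.add_mem _ hv hv0, fun I hI => ?_, ?_⟩
    · rw [Pi.add_apply, hv1 I (by omega), hv0z I (by omega), add_zero]
    · rw [map_add, hv2]; abel

lemma V2 {F : FreeComplex K n} (hres : IsResolution F) {i d : ℤ} (p : ℕ) (hp : p ≤ n + 1) (hi : i < p)
    {w : YT F} (hw : w ∈ VT F i d) (hD : DT F w = 0) (h0 : ∀ I, I.card < p → w I = 0) :
    ∃ v ∈ VT F (i - 1) d, (∀ I, I.card < p → v I = 0) ∧ DT F v = w :=
  V2_aux hres (n + 1 - p) p (by omega) hi hw hD h0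

/-- residue pairing -/
def pr {ρ : ℕ} : (Fin ρ → Laur K n) →ₗ[K] (Fin ρ → PolyS K n) →ₗ[K] K :=
  LinearMap.mk₂ K (fun x g => (∑ r, x r * lau (g r)).coeff (fun _ => -1))
    (by intro x y g; simp [add_mul, Finset.sum_add_distrib])
    (by intro c x g; simp [← Finset.smul_sum])
    (by intro x g g'; simp [mul_add, Finset.sum_add_distrib])
    (by intro c x g; simp [← Finset.smul_sum])

lemma pr_apply {ρ : ℕ} (x : Fin ρ → Laur K n) (g : Fin ρ → PolyS K n) :
    pr x g = (∑ r, x r * lau (g r)).coeff (fun _ => -1) := rfl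

lemma pr_lact {a b : ℕ} (A : Matrix (Fin a) (Fin b) (PolyS K n)) (y : Fin b → Laur K n) (g : Fin a → PolyS K n) :
    pr (lact A y) g = pr y (A.transpose.mulVec g) := by
  rw [pr_apply, pr_apply]
  congr 2
  simp only [lact_apply, Matrix.mulVec, dotProduct, Matrix.transpose_apply, map_sum, map_mul, Finset.sum_mul,
    Finset.mul_sum]
  rw [Finset.sum_comm]
  refine Finset.sum_congr rfl fun q _ => Finset.sum_congr rfl fun p _ => ?_
  ring

lemma pr_nonneg {ρ : ℕ} (x : Fin ρ → Laur K n) (hx : ∀ r, x r ∈ lsupp fun a => ¬ aneg a) (g : Fin ρ → PolyS K n) :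
    pr x g = 0 := by
  rw [pr_apply]
  have : ∑ r, x r * lau (g r) ∈ lsupp fun a => ¬ aneg a := by
    refine Submodule.sum_mem _ fun r _ => lsupp_mul ?_ (hx r) (lau_mem (g r))
    intro a b ha hb hc
    apply ha
    intro k
    have h1 := hc k; have h2 := hb k; simp only [Pi.add_apply] at h1; omega
  by_contra hc
  exact this _ hc (fun k => by simp)

lemma pr_single {ρ : ℕ} (x : Fin ρ → Laur K n) (r : Fin ρ) (b : Fin n →₀ ℕ) (c : K) :
    pr x (Pi.single r (monomial b c)) = c * (x r).coeff (fun k => -1 - b k) := by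
  rw [pr_apply, Finset.sum_eq_single r]
  · rw [Pi.single_eq_same, lau_monomial, mul_comm, smul_mul_assoc, AddMonoidAlgebra.coeff_smul, Finsupp.smul_apply,
      coeff_lmon_mul, smul_eq_mul]
    rfl
  · intro q _ hq
    rw [Pi.single_eq_of_ne hq, map_zero, mul_zero]
  · simp

lemma monomial_homogZ {b : Fin n →₀ ℕ} {c : K} {z : ℤ} (h : (b.degree : ℤ) = z) :
    monomial b c ∈ homogZ K n z := by
  rw [← lau_homog, lau_monomial]
  exact Submodule.smul_mem _ _ (lmon_mem (by rw [expDeg_expZ]; exact h))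

lemma single_mem_freePiece {ρ : ℕ} {dg : Fin ρ → ℤ} {e : ℤ} {r : Fin ρ} {p : PolyS K n}
    (h : p ∈ homogZ K n (e - dg r)) : (Pi.single r p : Fin ρ → PolyS K n) ∈ freePiece dg e := by
  rw [mem_freePiece]
  intro q
  by_cases hq : q = r
  · subst hq; rw [Pi.single_eq_same]; exact h
  · rw [Pi.single_eq_of_ne hq]; exact Submodule.zero_mem _

lemma pr_nondeg {ρ : ℕ} {dg : Fin ρ → ℤ} {d : ℤ} {x : Fin ρ → Laur K n}
    (hx : ∀ r, x r ∈ lsupp fun a => expDeg a = d - dg r)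
    (h : ∀ g ∈ freePiece (fun r => - dg r) (- d - n), pr x g = 0) (r : Fin ρ) : x r ∈ lsupp fun a => ¬ aneg a := by
  intro a ha hneg
  obtain ⟨b, hb⟩ := expZ_surj (a := fun k => -1 - a k) (fun k => by have := hneg k; omega)
  have hb' : ∀ k, (b k : ℤ) = -1 - a k := fun k => congrFun hb k
  have hdeg : expDeg a = d - dg r := hx r a ha
  have h1 : (b.degree : ℤ) = (- d - n) - - dg r := by
    rw [← expDeg_expZ, hb]
    unfold expDeg at hdeg ⊢
    rw [Finset.sum_sub_distrib, hdeg]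
    simp
    ring
  have h2 := h _ (single_mem_freePiece (r := r) (monomial_homogZ (c := (1 : K)) h1))
  rw [pr_single, one_mul] at h2
  apply ha
  rw [← h2]
  congr 1
  funext k
  rw [hb']; ring

lemma pr_rep {ρ : ℕ} (dg : Fin ρ → ℤ) (d : ℤ) (lam : (Fin ρ → PolyS K n) →ₗ[K] K) :
    ∃ y : Fin ρ → Laur K n, (∀ r, y r ∈ LI K univ (d - dg r)) ∧
      ∀ g ∈ freePiece (fun r => - dg r) (- d - n), lam g = pr y g := by
  classical
  let e : ℤ := - d - n
  let B : Fin ρ → Finset (Fin n →₀ ℕ) := fun r =>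
    if 0 ≤ e + dg r then Finset.finsuppAntidiag univ (e + dg r).toNat else ∅
  have hB : ∀ r b, b ∈ B r ↔ (b.degree : ℤ) = e + dg r := by
    intro r b
    simp only [B]
    split_ifs with h
    · rw [Finset.mem_finsuppAntidiag, Finsupp.degree_eq_sum]
      simp only [subset_univ, and_true]
      constructor
      · intro h2; rw [h2]; omega
      · intro h2; rw [← h2, Int.toNat_natCast]
    · simp only [notMem_empty, false_iff]
      intro h2; apply h; rw [← h2]; positivity
  let y : Fin ρ → Laur K n := fun r => ∑ b ∈ B r, lam (Pi.single r (monomial b 1)) • lmon (fun k => -1 - (b k : ℤ))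
  have hy : ∀ r b, b ∈ B r → (y r).coeff (fun k => -1 - (b k : ℤ)) = lam (Pi.single r (monomial b 1)) := by
    intro r b hb
    simp only [y]
    rw [AddMonoidAlgebra.coeff_sum, Finsupp.finsetSum_apply, Finset.sum_eq_single b]
    · simp [lmon]
    · intro b' _ hb'
      rw [AddMonoidAlgebra.coeff_smul, Finsupp.smul_apply, lmon, AddMonoidAlgebra.coeff_single, Finsupp.single_apply,
        if_neg, smul_zero]
      intro h
      apply hb'
      ext k
      have : -1 - (b' k : ℤ) = -1 - (b k : ℤ) := congrFun h k
      omega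
    · intro h; exact absurd hb h
  refine ⟨y, fun r => ?_, ?_⟩
  · refine Submodule.sum_mem _ fun b hb => Submodule.smul_mem _ _ (lmon_mem ⟨fun k hk => absurd (mem_univ k) hk, ?_⟩)
    have h1 := (hB r b).1 hb
    rw [← expDeg_expZ] at h1
    unfold expDeg at h1 ⊢
    rw [Finset.sum_sub_distrib]
    have h2 : ∑ k, (b k : ℤ) = e + dg r := h1
    rw [h2]
    simp [e]
    ring
  · intro g hg
    rw [mem_freePiece] at hg
    have h1 : ∀ r, ∀ b ∈ (g r).support, b ∈ B r := by
      intro r b hb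
      rw [hB]
      have h2 := lau_homog.2 (hg r) (expZ b) (by rw [lau_coeff]; exact mem_support_iff.1 hb)
      have h3 : expDeg (expZ b) = - d - n - - dg r := h2
      rw [← expDeg_expZ, h3]; ring
    have h2 : g = ∑ r, ∑ b ∈ (g r).support, Pi.single r (monomial b ((g r).coeff b)) := by
      conv_lhs => rw [← Finset.univ_sum_single g]
      refine Finset.sum_congr rfl fun r _ => ?_
      conv_lhs => rw [(g r).as_sum]
      exact map_sum (LinearMap.single K (fun _ : Fin ρ => PolyS K n) r) _ _
    rw [h2, map_sum, map_sum]
    refine Finset.sum_congr rfl fun r _ => ?_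
    rw [map_sum, map_sum]
    refine Finset.sum_congr rfl fun b hb => ?_
    rw [pr_single, hy r b (h1 r b hb)]
    have : (Pi.single r (monomial b ((g r).coeff b)) : Fin ρ → PolyS K n) =
        (g r).coeff b • Pi.single r (monomial b 1) := by
      rw [← Pi.single_smul, smul_monomial]; simp
    rw [this, map_smul, smul_eq_mul]

lemma lsupp_zsmul {P : (Fin n → ℤ) → Prop} {f : Laur K n} (c : ℤ) (h : f ∈ lsupp P) : c • f ∈ lsupp P :=
  zsmul_mem h c

lemma DC_univ_nonneg {F : FreeComplex K n} {i d : ℤ} {y : YT F} (hy : y ∈ VT F i d) (j r) :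
    DC F y univ j r ∈ lsupp (fun a => ¬ aneg a) := by
  have h : DC F y univ j r = ∑ k, ksgn k univ • y (univ.erase k) j r := by
    rw [DC_apply]; simp [Finset.sum_apply]
  rw [h]
  refine Submodule.sum_mem _ fun k _ => lsupp_zsmul _ (lsupp_mono ?_ (hy (univ.erase k) j r).1)
  intro a ha hb
  have h1 := ha.1 k (by simp)
  have h2 := hb k
  omega

lemma pr_DT {F : FreeComplex K n} {i d : ℤ} {y : YT F} (hy : y ∈ VT F i d) (j) (g) :
    pr (DT F y univ j) g = ((-1 : ℤ) ^ n) • pr (y univ (j + 1)) ((F.dd j).transpose.mulVec g) := by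
  have h : DT F y univ j = DC F y univ j + ((-1 : ℤ) ^ n) • lact (F.dd j) (y univ (j + 1)) := by
    rw [DT_apply, Pi.add_apply, DF_apply]; simp [dX_apply]
  rw [h, map_add, LinearMap.add_apply, pr_nonneg _ (DC_univ_nonneg hy j), zero_add, map_zsmul, LinearMap.smul_apply,
    pr_lact]

lemma neg_one_smul_eq_zero {M : Type} [AddCommGroup M] {k : ℕ} {x : M} (h : ((-1 : ℤ) ^ k) • x = 0) : x = 0 := by
  have e4 := congrArg (fun x => ((-1 : ℤ) ^ k) • x) h
  simp only [smul_smul, smul_zero] at e4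
  rw [← pow_add, ← two_mul, pow_mul] at e4
  simpa using e4

/-- cochain concentrated at one spot -/
def spot (F : FreeComplex K n) (I : Finset (Fin n)) (j : ℕ) (y : Fin (F.rk j) → Laur K n) : YT F :=
  Pi.single I (Pi.single j y)

lemma spot_self (F : FreeComplex K n) (I) (j) (y) : spot F I j y I j = y := by
  simp [spot]

lemma spot_ne (F : FreeComplex K n) {I I'} (j) (y) (h : I' ≠ I) : spot F I j y I' = 0 := by
  simp [spot, h]

lemma spot_ne' (F : FreeComplex K n) (I) {j j'} (y) (h : j' ≠ j) : spot F I j y I j' = 0 := by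
  simp [spot, h]

lemma spot_mem (F : FreeComplex K n) {I j y} {i d : ℤ} (hy : ∀ r, y r ∈ LI K I (d - F.deg j r))
    (hi : (I.card : ℤ) - j = i) : spot F I j y ∈ VT F i d := by
  intro I' j' r
  by_cases h1 : I' = I
  · subst h1
    by_cases h2 : j' = j
    · subst h2
      rw [spot_self]
      exact ⟨hy r, fun h => absurd hi h⟩
    · rw [spot_ne' F I' y h2]
      exact ⟨Submodule.zero_mem _, fun _ => rfl⟩
  · rw [spot_ne F j y h1]
    exact ⟨Submodule.zero_mem _, fun _ => rfl⟩

lemma VT_zero {F : FreeComplex K n} {i d : ℤ} {y : YT F} (hy : y ∈ VT F i d) {I : Finset (Fin n)} {j : ℕ}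
    (h : (I.card : ℤ) - j ≠ i) : y I j = 0 := funext fun r => (hy I j r).2 h

lemma exists_cocycle {F : FreeComplex K n} (d : ℤ) (j : ℕ) (lam : (Fin (F.rk j) → PolyS K n) →ₗ[K] K)
    (hlam : ∀ g ∈ (dualCo F).imSub j, g ∈ freePiece (fun r => - F.deg j r) (- d - n) → lam g = 0) :
    ∃ w ∈ VT F (n - j) d, DT F w = 0 ∧
      ∀ g ∈ freePiece (fun r => - F.deg j r) (- d - n), lam g = pr (w univ j) g := by
  obtain ⟨y, hy, hyl⟩ := pr_rep (F.deg j) d lam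
  have hw0 : spot F univ j y ∈ VT F (n - j) d := spot_mem F hy (by simp)
  have hD := DT_mem hw0
  obtain ⟨v, hv, hvu, hvD⟩ := V1 hD (DT_DT F _) (by
    intro j'
    refine pr_nondeg (dg := F.deg j') (d := d) (fun r => lsupp_mono (fun a ha => ha.2) (hD univ j' r).1) ?_
    intro g hg
    rw [pr_DT hw0]
    by_cases hj : j' + 1 = j
    · subst hj
      rw [spot_self]
      have hmem : (F.dd j').transpose.mulVec g ∈ freePiece (fun r => - F.deg (j' + 1) r) (- d - n) :=
        mvK_mem ((dualCo F).isHomog j') hg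
      have h0 : lam ((F.dd j').transpose.mulVec g) = 0 := hlam _ ⟨g, rfl⟩ hmem
      rw [← hyl _ hmem, h0, smul_zero]
    · rw [spot_ne' F univ y hj, map_zero, LinearMap.zero_apply, smul_zero])
  refine ⟨spot F univ j y - v, Submodule.sub_mem _ hw0 (by simpa using hv), by rw [map_sub, hvD, sub_self], ?_⟩
  intro g hg
  rw [Pi.sub_apply, hvu, sub_zero, spot_self]
  exact hyl g hg

lemma cocycle_im {F : FreeComplex K n} {d : ℤ} {j : ℕ} {w : YT F} (hw : w ∈ VT F (n - j) d) (hD : DT F w = 0)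
    (g : Fin (F.rk j) → PolyS K n) (hg : g ∈ (dualCo F).imSub j) : pr (w univ j) g = 0 := by
  cases j with
  | zero =>
    have : g = 0 := hg
    rw [this, map_zero]
  | succ j =>
    obtain ⟨g', rfl⟩ := hg
    have h := pr_DT hw j g'
    rw [hD] at h
    have h1 : pr ((0 : YT F) univ j) g' = 0 := by
      rw [show (0 : YT F) univ j = 0 from rfl, map_zero]; rfl
    rw [h1] at h
    exact neg_one_smul_eq_zero h.symm

lemma cobd_ker {F : FreeComplex K n} {d i : ℤ} {j : ℕ} {v : YT F} (hv : v ∈ VT F i d)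
    (g) (hg : (F.dd j).transpose.mulVec g = 0) : pr (DT F v univ j) g = 0 := by
  rw [pr_DT hv, hg, map_zero, smul_zero]

lemma factor_dual {V W : Type} [AddCommGroup V] [Module K V] [AddCommGroup W] [Module K W]
    (T : V →ₗ[K] W) (P : Submodule K V) (φ : V →ₗ[K] K) (h : ∀ g ∈ P, T g = 0 → φ g = 0) :
    ∃ μ : W →ₗ[K] K, ∀ g ∈ P, φ g = μ (T g) := by
  have h1 : φ.comp P.subtype ∈ LinearMap.range (T.comp P.subtype).dualMap := by
    rw [LinearMap.range_dualMap_eq_dualAnnihilator_ker, Submodule.mem_dualAnnihilator]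
    intro x hx
    exact h x.1 x.2 hx
  obtain ⟨μ, hμ⟩ := h1
  exact ⟨μ, fun g hg => (LinearMap.congr_fun hμ ⟨g, hg⟩).symm⟩

lemma cocycle_cobd {F : FreeComplex K n} {d : ℤ} {j : ℕ} {w : YT F} (hw : w ∈ VT F (n - j) d) (hD : DT F w = 0)
    (h : ∀ g ∈ (dualCo F).kerPiece j (- d - n), pr (w univ j) g = 0) :
    ∃ v ∈ VT F (n - j - 1) d, DT F v = w := by
  obtain ⟨μ, hμ⟩ := factor_dual (mvK (F.dd j).transpose) (freePiece (fun r => - F.deg j r) (- d - n))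
    (pr (w univ j)) (fun g hg h0 => h g ⟨h0, hg⟩)
  obtain ⟨y, hy, hyl⟩ := pr_rep (F.deg (j + 1)) d μ
  have hv0 : ((-1 : ℤ) ^ n) • spot F univ (j + 1) y ∈ VT F (n - j - 1) d :=
    zsmul_mem (spot_mem F hy (by simp; ring)) _
  have hDv0 : DT F (((-1 : ℤ) ^ n) • spot F univ (j + 1) y) ∈ VT F (n - j) d := by simpa using DT_mem hv0
  have hsub := Submodule.sub_mem _ hw hDv0
  obtain ⟨v, hv, hvu, hvD⟩ := V1 hsub (by rw [map_sub, hD, DT_DT, sub_zero]) (by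
    intro j'
    by_cases hj : j' = j
    · subst hj
      refine pr_nondeg (dg := F.deg j') (d := d) (fun r => lsupp_mono (fun a ha => ha.2) (hsub univ j' r).1) ?_
      intro g hg
      rw [Pi.sub_apply, Pi.sub_apply, map_sub, LinearMap.sub_apply, pr_DT hv0, hμ g hg]
      have hmem : (F.dd j').transpose.mulVec g ∈ freePiece (fun r => - F.deg (j' + 1) r) (- d - n) :=
        mvK_mem ((dualCo F).isHomog j') hg
      rw [mvK_apply, hyl _ hmem, Pi.smul_apply, Pi.smul_apply, spot_self, map_zsmul, LinearMap.smul_apply, smul_smul,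
        ← pow_add, ← two_mul, pow_mul]
      simp
    · intro r
      have : (w - DT F (((-1 : ℤ) ^ n) • spot F univ (j + 1) y)) univ j' = 0 :=
        VT_zero hsub (I := univ) (j := j') (by rw [Finset.card_univ, Fintype.card_fin]; omega)
      rw [this]; exact Submodule.zero_mem _)
  exact ⟨v + _, Submodule.add_mem _ hv hv0, by rw [map_add, hvD]; abel⟩

instance kerPiece_fin (E : CoComplex K n) (i ℓ) : FiniteDimensional K (E.kerPiece i ℓ) :=
  Submodule.finiteDimensional_of_le (inf_le_right : _ ≤ freePiece (E.deg i) ℓ)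

lemma cohomDim_eq_zero_iff (E : CoComplex K n) (i ℓ) : cohomDim E i ℓ = 0 ↔ E.kerPiece i ℓ ≤ E.imSub i := by
  unfold cohomDim
  rw [Module.finrank_zero_iff, Submodule.Quotient.subsingleton_iff, Submodule.comap_subtype_eq_top]

lemma cohom_zero_iff {F : FreeComplex K n} (d : ℤ) (j : ℕ) : cohomDim (dualCo F) j (- d - n) = 0 ↔
    ∀ w ∈ VT F (n - j) d, DT F w = 0 → ∃ v ∈ VT F (n - j - 1) d, DT F v = w := by
  rw [cohomDim_eq_zero_iff]
  constructor
  · intro h w hw hD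
    exact cocycle_cobd hw hD fun g hg => cocycle_im hw hD g (h hg)
  · intro h g hg
    by_contra hc
    obtain ⟨lam, h1, h2⟩ := Submodule.exists_le_ker_of_notMem hc
    obtain ⟨w, hw, hD, hwl⟩ := exists_cocycle (F := F) d j lam (fun g hg _ => h2 hg)
    obtain ⟨v, hv, rfl⟩ := h w hw hD
    have := hwl g hg.2
    rw [cobd_ker hv g hg.1] at this
    exact h1 this

lemma cohom_big {F : FreeComplex K n} (hres : IsResolution F) (d : ℤ) (j : ℕ) (hj : n < j) :
    cohomDim (dualCo F) j (- d - n) = 0 := by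
  rw [cohom_zero_iff]
  intro w hw hD
  obtain ⟨v, hv, _, h⟩ := V2 hres 0 (by omega) (by push_cast; omega) hw hD (fun I h => absurd h (by omega))
  exact ⟨v, hv, h⟩

lemma exists_lauL : ∃ L : Laur K n →ₗ[K] PolyS K n, ∀ p, L (lau p) = p := by
  obtain ⟨L, hL⟩ := LinearMap.exists_leftInverse_of_injective (lau (K := K) (n := n)).toLinearMap
    (LinearMap.ker_eq_bot.2 lau_injective)
  exact ⟨L, fun p => LinearMap.congr_fun hL p⟩

/-- linear left inverse of `lau` -/
def lauL : Laur K n →ₗ[K] PolyS K n := Classical.choose exists_lauL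

lemma lauL_lau (p : PolyS K n) : lauL (lau p) = p := Classical.choose_spec exists_lauL p

lemma lauL_spec {d : ℤ} {f : Laur K n} (hf : f ∈ LI K ∅ d) : lauL f ∈ homogZ K n d ∧ lau (lauL f) = f := by
  obtain ⟨p, hp, rfl⟩ := LI_empty hf
  rw [lauL_lau]; exact ⟨hp, rfl⟩

/-- degree 0 cocycles -/
def Z0 (F : FreeComplex K n) (d : ℤ) : Submodule K (YT F) := VT F 0 d ⊓ LinearMap.ker (DT F)

/-- kernel piece with good types -/
def kp (F : FreeComplex K n) (j : ℕ) (e : ℤ) : Submodule K (Fin (F.rk j) → PolyS K n) := (dualCo F).kerPiece j e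
/-- image with good types -/
def ims (F : FreeComplex K n) (j : ℕ) : Submodule K (Fin (F.rk j) → PolyS K n) := (dualCo F).imSub j

instance kp_fin (F : FreeComplex K n) (j e) : FiniteDimensional K (kp F j e) := kerPiece_fin (dualCo F) j e

lemma cohomDim_dual (F : FreeComplex K n) (j e) :
    cohomDim (dualCo F) j e = finrank K ((ims F j).comap (kp F j e).subtype).dualAnnihilator := by
  have h := (Submodule.dualQuotEquivDualAnnihilator ((ims F j).comap (kp F j e).subtype)).finrank_eq
  rw [← h, Subspace.dual_finrank_eq]
  rfl

lemma ims_le {F : FreeComplex K n} {j : ℕ} {e : ℤ} {g : Fin (F.rk j) → PolyS K n} (hg : g ∈ ims F j)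
    (hg' : g ∈ freePiece (fun r => - F.deg j r) e) : g ∈ kp F j e := by
  refine ⟨?_, hg'⟩
  cases j with
  | zero =>
    have : g = 0 := hg
    subst this
    exact Submodule.zero_mem _
  | succ j =>
    obtain ⟨u, rfl⟩ := hg
    have h1 : ((dualCo F).dd (j + 1)).mulVec (((dualCo F).dd j).mulVec u) = 0 := by
      rw [Matrix.mulVec_mulVec, (dualCo F).isComplex j, Matrix.zero_mulVec]
    exact h1

/-- pairing with cocycles -/
def pi1 (F : FreeComplex K n) (d : ℤ) : Z0 F d →ₗ[K] Dual K (kp F n (- d - n)) where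
  toFun w := (pr (w.1 univ n)).comp (kp F n (- d - n)).subtype
  map_add' u v := by ext g; simp
  map_smul' c v := by ext g; simp

lemma pi1_apply (F : FreeComplex K n) (d : ℤ) (w : Z0 F d) (g) : pi1 F d w g = pr (w.1 univ n) g.1 := rfl

lemma pi1_range (F : FreeComplex K n) (d : ℤ) :
    LinearMap.range (pi1 F d) = ((ims F n).comap (kp F n (- d - n)).subtype).dualAnnihilator := by
  ext φ
  rw [LinearMap.mem_range, Submodule.mem_dualAnnihilator]
  constructor
  · rintro ⟨w, rfl⟩ g hg
    rw [pi1_apply]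
    exact cocycle_im (j := n) (by rw [sub_self]; exact w.2.1) w.2.2 g.1 hg
  · intro h
    obtain ⟨lam, hlam⟩ := LinearMap.exists_extend φ
    have hl : ∀ g : kp F n (- d - n), lam g.1 = φ g := fun g => LinearMap.congr_fun hlam g
    obtain ⟨w, hw, hD, hwl⟩ := exists_cocycle (F := F) d n lam (fun g hg hg' => by
      have hk := ims_le (F := F) hg hg'
      have := hl ⟨g, hk⟩
      rw [h ⟨g, hk⟩ hg] at this
      exact this)
    rw [sub_self] at hw
    refine ⟨⟨w, hw, hD⟩, ?_⟩
    ext g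
    rw [pi1_apply, ← hl]
    exact (hwl g.1 g.2.2).symm

lemma pi1_ker (F : FreeComplex K n) (d : ℤ) (w : Z0 F d) :
    pi1 F d w = 0 ↔ ∃ v ∈ VT F (-1) d, DT F v = w.1 := by
  constructor
  · intro h
    have := cocycle_cobd (j := n) (F := F) (d := d) (w := w.1) (by rw [sub_self]; exact w.2.1) w.2.2
      (fun g hg => by
        have := LinearMap.congr_fun h ⟨g, hg⟩
        exact this)
    rw [sub_self, zero_sub] at this
    exact this
  · rintro ⟨v, hv, hD⟩
    ext g
    rw [pi1_apply, ← hD]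
    exact cobd_ker hv g.1 g.2.1

/-- sub of boundaries -/
def bM (F : FreeComplex K n) (d : ℤ) : Submodule K (freePiece (K := K) (n := n) (F.deg 0) d) :=
  Submodule.comap (freePiece (F.deg 0) d).subtype ((LinearMap.range ((F.dd 0).mulVecLin)).restrictScalars K)

/-- edge map, numerator -/
def pi2' (F : FreeComplex K n) (d : ℤ) : Z0 F d →ₗ[K] freePiece (K := K) (n := n) (F.deg 0) d where
  toFun := fun w => ⟨fun r => lauL (w.1 ∅ 0 r), mem_freePiece.2 fun r => (lauL_spec (w.2.1 ∅ 0 r).1).1⟩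
  map_add' := fun u v => by ext1; funext r; simp
  map_smul' := fun c v => by ext1; funext r; simp

/-- edge map -/
def pi2 (F : FreeComplex K n) (d : ℤ) : Z0 F d →ₗ[K] (freePiece (K := K) (n := n) (F.deg 0) d ⧸ bM F d) :=
  (bM F d).mkQ.comp (pi2' F d)

lemma pi2_eq (F : FreeComplex K n) (d : ℤ) (w : Z0 F d) (m : freePiece (K := K) (n := n) (F.deg 0) d) :
    pi2 F d w = (bM F d).mkQ m ↔ ∃ u ∈ freePiece (K := K) (F.deg 1) d,
      w.1 ∅ 0 = fun r => lau (m.1 r) + lau ((F.dd 0).mulVec u r) := by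
  unfold pi2
  rw [LinearMap.comp_apply, Submodule.mkQ_apply, Submodule.mkQ_apply, Submodule.Quotient.eq]
  constructor
  · rintro ⟨u, hu⟩
    have hu1 : (F.dd 0).mulVec u = fun r => lauL (w.1 ∅ 0 r) - m.1 r := hu
    obtain ⟨u', hu', hu2⟩ := mvK_lift (ℓ := d) (v := u) (F.isHomog 0) (by
      rw [hu1, mem_freePiece]
      intro r
      exact Submodule.sub_mem _ ((lauL_spec (w.2.1 ∅ 0 r).1).1) (mem_freePiece.1 m.2 r))
    refine ⟨u', hu', ?_⟩
    rw [hu2, hu1]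
    funext r
    rw [map_sub, (lauL_spec (w.2.1 ∅ 0 r).1).2]; ring
  · rintro ⟨u, _, hu⟩
    refine ⟨u, ?_⟩
    change (F.dd 0).mulVec u = fun r => lauL (w.1 ∅ 0 r) - m.1 r
    funext r
    rw [hu, map_add, lauL_lau, lauL_lau]; ring

lemma lau_spot_mem {F : FreeComplex K n} {d : ℤ} {j : ℕ} {u : Fin (F.rk j) → PolyS K n}
    (hu : u ∈ freePiece (F.deg j) d) : spot F ∅ j (fun r => lau (u r)) ∈ VT F (- j) d :=
  spot_mem F (fun r => lau_LI (mem_freePiece.1 hu r) _) (by simp)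

lemma DT_empty (F : FreeComplex K n) (y : YT F) (j) : DT F y ∅ j = lact (F.dd j) (y ∅ (j + 1)) := by
  rw [DT_apply, Pi.add_apply, DC_apply, DF_apply]
  simp [dX_apply]

lemma DT_lau_spot (F : FreeComplex K n) (u : Fin (F.rk 1) → PolyS K n) :
    DT F (spot F ∅ 1 (fun r => lau (u r))) ∅ 0 = fun r => lau ((F.dd 0).mulVec u r) := by
  rw [DT_empty, spot_self, lact_lau]

lemma pi2_ker {F : FreeComplex K n} (hres : IsResolution F) (d : ℤ) (w : Z0 F d) :
    pi2 F d w = 0 ↔ ∃ v ∈ VT F (-1) d, DT F v = w.1 := by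
  have h0 : pi2 F d w = 0 ↔ pi2 F d w = (bM F d).mkQ 0 := by rw [map_zero]
  rw [h0, pi2_eq]
  constructor
  · rintro ⟨u, hu, hw⟩
    have hv0 := lau_spot_mem hu
    have hv0' : spot F ∅ 1 (fun r => lau (u r)) ∈ VT F (-1) d := by simpa using hv0
    have hDv0 : DT F (spot F ∅ 1 (fun r => lau (u r))) ∈ VT F 0 d := by simpa using DT_mem hv0'
    have hsub := Submodule.sub_mem _ w.2.1 hDv0
    obtain ⟨v, hv, _, hvD⟩ := V2 hres 1 (by omega) (by simp) hsub
      (by rw [map_sub, DT_DT, sub_zero]; exact w.2.2) (by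
        intro I hI
        have hI : I = ∅ := by rw [← Finset.card_eq_zero]; omega
        subst hI
        funext j
        by_cases hj : j = 0
        · subst hj
          rw [Pi.sub_apply, Pi.sub_apply, DT_lau_spot, hw]
          funext r
          simp
        · exact VT_zero hsub (by simp; omega))
    exact ⟨v + _, Submodule.add_mem _ (by simpa using hv) hv0', by rw [map_add, hvD]; abel⟩
  · rintro ⟨v, hv, hD⟩
    refine ⟨fun r => lauL (v ∅ 1 r), mem_freePiece.2 fun r => (lauL_spec (hv ∅ 1 r).1).1, ?_⟩
    rw [← hD, DT_empty]
    have : v ∅ (0 + 1) = fun r => lau ((fun r => lauL (v ∅ 1 r)) r) :=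
      funext fun r => ((lauL_spec (hv ∅ 1 r).1).2).symm
    refine (congrArg (lact (F.dd 0)) this).trans ((lact_lau _ (fun r => lauL (v ∅ 1 r))).trans ?_)
    funext r
    simp

lemma ext_n_eq {F : FreeComplex K n} (hres : IsResolution F) (d : ℤ) :
    cohomDim (dualCo F) n (- d - n) = finrank K (LinearMap.range (pi2 F d)) := by
  rw [cohomDim_dual, ← pi1_range]
  have hk : LinearMap.ker (pi1 F d) = LinearMap.ker (pi2 F d) := by
    ext w
    rw [LinearMap.mem_ker, LinearMap.mem_ker, pi1_ker, pi2_ker hres]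
  rw [← (pi1 F d).quotKerEquivRange.finrank_eq, ← (pi2 F d).quotKerEquivRange.finrank_eq, hk]

lemma ext_n_le {F : FreeComplex K n} (hres : IsResolution F) (d : ℤ) :
    cohomDim (dualCo F) n (- d - n) ≤ MPieceDim F d := by
  rw [ext_n_eq hres]
  exact Submodule.finrank_le _

lemma ext_n_surj {F : FreeComplex K n} (hres : IsResolution F) (d : ℤ) :
    MPieceDim F d ≤ cohomDim (dualCo F) n (- d - n) ↔ Function.Surjective (pi2 F d) := by
  rw [ext_n_eq hres, ← LinearMap.range_eq_top]
  constructor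
  · intro h
    apply Submodule.eq_top_of_finrank_eq
    exact le_antisymm (Submodule.finrank_le _) h
  · intro h
    rw [h, finrank_top]
    exact le_refl _

/-- exactness statement equivalent to vanishing of sheaf cohomology -/
def HE (F : FreeComplex K n) (i d : ℤ) : Prop :=
  ∀ w ∈ VT F (i + 1) d, DT F w = 0 → ∃ v ∈ VT F i d, v ∅ = 0 ∧ DT F v = w

lemma HE_pos {F : FreeComplex K n} {i : ℤ} (hi : 0 < i) (d : ℤ) :
    HE F i d ↔ ∀ w ∈ VT F (i + 1) d, DT F w = 0 → ∃ v ∈ VT F i d, DT F v = w := by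
  unfold HE
  refine forall_congr' fun w => forall_congr' fun hw => forall_congr' fun hD => ?_
  constructor
  · rintro ⟨v, hv, _, h⟩; exact ⟨v, hv, h⟩
  · rintro ⟨v, hv, h⟩
    refine ⟨v, hv, ?_, h⟩
    funext j
    exact VT_zero hv (by simp; omega)

lemma HE_iff {m : ℕ} {F : FreeComplex K (m + 1)} (hres : IsResolution F) (i : ℕ) (d : ℤ) :
    sheafH F i d = 0 ↔ HE F i d := by
  unfold sheafH
  rcases Nat.eq_zero_or_pos i with rfl | hi
  · rw [if_pos rfl, Nat.add_eq_zero_iff, Nat.sub_eq_zero_iff_le]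
    have e1 : extDim F ((m + 1 : ℕ) : ℤ) (-d - (m + 1 : ℕ)) = cohomDim (dualCo F) (m + 1) (-d - (m + 1 : ℕ)) := by
      unfold extDim; rw [if_pos (by positivity)]; rfl
    have e2 : extDim F (((m + 1 : ℕ) : ℤ) - 1) (-d - (m + 1 : ℕ)) = cohomDim (dualCo F) m (-d - (m + 1 : ℕ)) := by
      unfold extDim; rw [if_pos (by push_cast; omega)]
      congr 1
      push_cast; omega
    rw [e1, e2, ext_n_surj hres, cohom_zero_iff]
    have e3 : ((m + 1 : ℕ) : ℤ) - m = 1 := by push_cast; ring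
    rw [e3, sub_self]
    unfold HE
    push_cast
    constructor
    · rintro ⟨hs, h⟩ w hw hD
      obtain ⟨v, hv, rfl⟩ := h w hw hD
      let mm : freePiece (K := K) (n := m + 1) (F.deg 0) d :=
        ⟨fun r => lauL (v ∅ 0 r), mem_freePiece.2 fun r => (lauL_spec (hv ∅ 0 r).1).1⟩
      obtain ⟨z, hz⟩ := hs ((bM F d).mkQ mm)
      rw [pi2_eq] at hz
      obtain ⟨u, hu, hz⟩ := hz
      have hv0 := lau_spot_mem hu
      have hv0' : spot F ∅ 1 (fun r => lau (u r)) ∈ VT F (-1) d := by simpa using hv0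
      have hDv0 : DT F (spot F ∅ 1 (fun r => lau (u r))) ∈ VT F 0 d := by simpa using DT_mem hv0'
      have hmem := Submodule.add_mem _ (Submodule.sub_mem _ hv z.2.1) hDv0
      refine ⟨_, hmem, ?_, ?_⟩
      · funext j
        by_cases hj : j = 0
        · subst hj
          rw [Pi.add_apply, Pi.add_apply, Pi.sub_apply, Pi.sub_apply, DT_lau_spot, hz]
          funext r
          have : lau (mm.1 r) = v ∅ 0 r := (lauL_spec (hv ∅ 0 r).1).2
          simp [this]
        · exact VT_zero hmem (by simp; omega)
      · have hz0 : DT F z.1 = 0 := z.2.2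
        rw [map_add, map_sub, DT_DT, hz0]; simp
    · intro h
      constructor
      · intro x
        obtain ⟨mm, rfl⟩ := Submodule.mkQ_surjective _ x
        have hm0 := lau_spot_mem mm.2
        have hm : spot F ∅ 0 (fun r => lau (mm.1 r)) ∈ VT F 0 d := by simpa using hm0
        have hDm : DT F (spot F ∅ 0 (fun r => lau (mm.1 r))) ∈ VT F 1 d := by simpa using DT_mem hm
        obtain ⟨v, hv, hv0, hvD⟩ := h _ hDm (DT_DT F _)
        refine ⟨⟨spot F ∅ 0 (fun r => lau (mm.1 r)) - v, Submodule.sub_mem _ hm hv, ?_⟩, ?_⟩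
        · change DT F _ = 0
          rw [map_sub, hvD, sub_self]
        · rw [pi2_eq]
          refine ⟨0, Submodule.zero_mem _, ?_⟩
          funext r
          simp [hv0, spot_self]
      · intro w hw hD
        obtain ⟨v, hv, _, h⟩ := h w hw hD
        exact ⟨v, hv, h⟩
  · rw [if_neg (by omega)]
    by_cases him : i ≤ m
    · have e2 : extDim F (((m + 1 : ℕ) : ℤ) - 1 - i) (-d - (m + 1 : ℕ)) =
          cohomDim (dualCo F) (m - i) (-d - (m + 1 : ℕ)) := by
        unfold extDim; rw [if_pos (by push_cast; omega)]
        congr 1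
        push_cast; omega
      rw [e2, cohom_zero_iff, HE_pos (by omega)]
      have e3 : ((m + 1 : ℕ) : ℤ) - (m - i : ℕ) = i + 1 := by push_cast [him]; ring
      rw [e3, add_sub_cancel_right]
    · unfold extDim
      rw [if_neg (by push_cast; omega)]
      simp only [true_iff]
      intro w hw hD
      refine ⟨0, Submodule.zero_mem _, rfl, ?_⟩
      rw [map_zero]
      funext I j
      symm
      apply VT_zero hw
      have := Finset.card_le_univ I
      rw [Fintype.card_fin] at this
      omega

/-- multiplication by a Laurent monomial, possibly depending on `I` -/
def lmulY (F : FreeComplex K n) (f : Finset (Fin n) → Laur K n) : YT F →ₗ[K] YT F where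
  toFun y := fun I j r => f I * y I j r
  map_add' x y := by funext I j r; simp [mul_add]
  map_smul' c x := by funext I j r; simp

lemma lmulY_apply (F : FreeComplex K n) (f : Finset (Fin n) → Laur K n) (y : YT F) (I j r) :
    lmulY F f y I j r = f I * y I j r := rfl

lemma DT_lmul (F : FreeComplex K n) (f : Laur K n) (y : YT F) :
    DT F (lmulY F (fun _ => f) y) = lmulY F (fun _ => f) (DT F y) := by
  funext I j r
  have h1 : ∀ y : YT F, DT F y I j r = (∑ k ∈ I, ksgn k I • y (I.erase k) j r) +
      ((-1 : ℤ) ^ I.card) • lact (F.dd j) (y I (j + 1)) r := by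
    intro y
    rw [DT_apply, Pi.add_apply, DC_apply, DF_apply]
    simp [Finset.sum_apply, dX_apply]
  rw [lmulY_apply, h1, h1, mul_add, Finset.mul_sum]
  congr 1
  · refine Finset.sum_congr rfl fun k _ => ?_
    rw [lmulY_apply, mul_smul_comm]
  · have h2 : lmulY F (fun _ => f) y I (j + 1) = fun q => f * y I (j + 1) q := rfl
    rw [h2, lact_scale, mul_smul_comm]

/-- variable -/
def xm (F : FreeComplex K n) (k : Fin n) : YT F →ₗ[K] YT F := lmulY F fun _ => lmon (Pi.single k 1)

open Classical in
/-- partial inverse of variable -/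
def um (F : FreeComplex K n) (k : Fin n) : YT F →ₗ[K] YT F :=
  lmulY F fun I => if I.min = (k : WithTop (Fin n)) then lmon (Pi.single k (-1)) else 0

lemma sum_xm_um (F : FreeComplex K n) (y : YT F) (h : y ∅ = 0) : ∑ k, xm F k (um F k y) = y := by
  classical
  funext I
  by_cases hI : I = ∅
  · subst hI
    funext j r
    simp [Finset.sum_apply, xm, um, lmulY_apply, h]
  · obtain ⟨k0, hk0⟩ := Finset.min_of_nonempty (Finset.nonempty_iff_ne_empty.2 hI)
    funext j r
    rw [Finset.sum_apply, Finset.sum_apply, Finset.sum_apply, Finset.sum_eq_single k0]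
    · simp only [xm, um, lmulY_apply]
      rw [if_pos hk0, ← mul_assoc, lmon_mul, ← Pi.single_add]
      simp [lmon_zero]
    · intro k _ hk
      simp only [xm, um, lmulY_apply]
      rw [if_neg]
      · simp
      · rw [hk0]; intro h; exact hk (by exact_mod_cast h.symm)
    · simp

/-- cochains vanishing at the empty set -/
def WT (F : FreeComplex K n) (p d : ℤ) : Submodule K (YT F) :=
  VT F p d ⊓ LinearMap.ker (LinearMap.proj (R := K) (φ := fun _ : Finset (Fin n) => XT F) ∅)

lemma mem_WT {F : FreeComplex K n} {p d : ℤ} {y : YT F} : y ∈ WT F p d ↔ y ∈ VT F p d ∧ y ∅ = 0 := Iff.rfl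

lemma xm_mem {F : FreeComplex K n} {p d : ℤ} {y : YT F} (hy : y ∈ WT F p d) (k) : xm F k y ∈ WT F p (d + 1) := by
  rw [mem_WT] at *
  refine ⟨fun I j r => ⟨?_, fun h => ?_⟩, ?_⟩
  · have h1 := LI_mul_of_eq (p := X k) (c := 1) (by
      rw [← lau_homog, lau_X]; exact lmon_mem (by simp [expDeg])) (hy.1 I j r).1
      (show 1 + (d - F.deg j r) = d + 1 - F.deg j r by ring)
    rw [lau_X] at h1
    exact h1
  · rw [xm, lmulY_apply, (hy.1 I j r).2 h, mul_zero]
  · funext j r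
    rw [xm, lmulY_apply, hy.2]; simp

lemma um_mem {F : FreeComplex K n} {p d : ℤ} {y : YT F} (hy : y ∈ WT F p (d + 1)) (k) : um F k y ∈ WT F p d := by
  classical
  rw [mem_WT] at *
  refine ⟨fun I j r => ⟨?_, fun h => ?_⟩, ?_⟩
  · rw [um, lmulY_apply]
    split_ifs with h
    · have hk := Finset.mem_of_min h
      refine lsupp_mul (P := fun a => a = Pi.single k (-1)) ?_ (lmon_mem rfl) (hy.1 I j r).1
      rintro a b rfl ⟨hb, hb'⟩
      refine ⟨fun l hl => ?_, ?_⟩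
      · have : l ≠ k := fun h => hl (h ▸ hk)
        rw [Pi.add_apply, Pi.single_eq_of_ne this, zero_add]
        exact hb l hl
      · rw [expDeg_add, hb']
        simp [expDeg]; ring
    · rw [zero_mul]; exact Submodule.zero_mem _
  · rw [um, lmulY_apply, (hy.1 I j r).2 h, mul_zero]
  · funext j r
    rw [um, lmulY_apply, hy.2]; simp

lemma DT_WT {F : FreeComplex K n} {p d : ℤ} {y : YT F} (hy : y ∈ WT F p d) : DT F y ∈ WT F (p + 1) d := by
  rw [mem_WT] at *
  refine ⟨DT_mem hy.1, ?_⟩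
  funext j
  rw [DT_empty, hy.2, Pi.zero_apply, map_zero]; rfl

/-- ambient space of the double complex -/
abbrev YYT (F : FreeComplex K n) : Type := Finset (Fin n) → YT F

/-- Koszul differential -/
def dv (F : FreeComplex K n) : YYT F →ₗ[K] YYT F := kd (xm F)
/-- Koszul homotopy -/
def hv (F : FreeComplex K n) : YYT F →ₗ[K] YYT F := kh (um F)
/-- pointwise total differential -/
def dh (F : FreeComplex K n) : YYT F →ₗ[K] YYT F where
  toFun y := fun J => DT F (y J)
  map_add' x y := by funext J; simp
  map_smul' c x := by funext J; simp

lemma dh_apply (F : FreeComplex K n) (y : YYT F) (J) : dh F y J = DT F (y J) := rfl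

lemma dv_dv (F : FreeComplex K n) (y : YYT F) : dv F (dv F y) = 0 := by
  refine kd_kd _ ?_ y
  intro k l x
  funext I j r
  simp only [xm, lmulY_apply]; ring

lemma dh_dh (F : FreeComplex K n) (y : YYT F) : dh F (dh F y) = 0 := by
  funext J; rw [dh_apply, dh_apply, DT_DT]; rfl

lemma dh_dv (F : FreeComplex K n) (y : YYT F) : dh F (dv F y) = dv F (dh F y) := by
  funext J
  rw [dh_apply]
  unfold dv
  rw [kd_apply, kd_apply, map_sum]
  refine Finset.sum_congr rfl fun k _ => ?_
  rw [map_zsmul, dh_apply]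
  congr 1
  exact DT_lmul F _ _

/-- bigraded pieces -/
def AT (F : FreeComplex K n) (c0 p : ℤ) (q : ℕ) : Submodule K (YYT F) where
  carrier := {y | ∀ J, y J ∈ WT F p (c0 + q) ∧ (J.card ≠ q → y J = 0)}
  zero_mem' := fun J => ⟨Submodule.zero_mem _, fun _ => rfl⟩
  add_mem' := fun {u v} hu hv J => ⟨Submodule.add_mem _ (hu J).1 (hv J).1, fun h => by
    rw [Pi.add_apply, (hu J).2 h, (hv J).2 h, add_zero]⟩
  smul_mem' := fun c {u} hu J => ⟨Submodule.smul_mem _ _ (hu J).1, fun h => by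
    rw [Pi.smul_apply, (hu J).2 h, smul_zero]⟩

lemma dv_mem {F : FreeComplex K n} {c0 p : ℤ} {q : ℕ} {y : YYT F} (hy : y ∈ AT F c0 p q) :
    dv F y ∈ AT F c0 p (q + 1) := by
  intro J
  unfold dv
  rw [kd_apply]
  constructor
  · refine Submodule.sum_mem _ fun k _ => zsmul_mem ?_ _
    have := xm_mem (hy (J.erase k)).1 k
    rwa [add_assoc] at this
  · intro hJ
    refine Finset.sum_eq_zero fun k hk => ?_
    rw [(hy (J.erase k)).2, map_zero, smul_zero]
    have := Finset.card_erase_add_one hk; omega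

lemma hv_mem {F : FreeComplex K n} {c0 p : ℤ} {q : ℕ} {y : YYT F} (hy : y ∈ AT F c0 p (q + 1)) :
    hv F y ∈ AT F c0 p q := by
  intro J
  unfold hv
  rw [kh_apply]
  constructor
  · refine Submodule.sum_mem _ fun k _ => zsmul_mem (um_mem ?_ k) _
    have := (hy (insert k J)).1
    rwa [Nat.cast_add, Nat.cast_one, ← add_assoc] at this
  · intro hJ
    refine Finset.sum_eq_zero fun k hk => ?_
    rw [mem_compl] at hk
    rw [(hy (insert k J)).2, map_zero, smul_zero]
    rw [Finset.card_insert_of_notMem hk]; omega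

lemma hv_zero {F : FreeComplex K n} {c0 p : ℤ} {y : YYT F} (hy : y ∈ AT F c0 p 0) : hv F y = 0 := by
  funext J
  unfold hv
  rw [kh_apply]
  refine Finset.sum_eq_zero fun k hk => ?_
  rw [mem_compl] at hk
  rw [(hy (insert k J)).2, map_zero, smul_zero]
  rw [Finset.card_insert_of_notMem hk]; omega

lemma dh_mem {F : FreeComplex K n} {c0 p : ℤ} {q : ℕ} {y : YYT F} (hy : y ∈ AT F c0 p q) :
    dh F y ∈ AT F c0 (p + 1) q := by
  intro J
  rw [dh_apply]
  exact ⟨DT_WT (hy J).1, fun h => by rw [(hy J).2 h, map_zero]⟩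

lemma dv_exact {F : FreeComplex K n} {c0 p : ℤ} {q : ℕ} {y : YYT F} (hy : y ∈ AT F c0 p q) (h : dv F y = 0) :
    dv F (hv F y) = y := by
  funext J
  have h1 := kd_kh (xm F) (um F) (fun k l x => by
    funext I j r
    simp only [xm, um, lmulY_apply]; ring) y J
  have h2 : dv F (hv F y) J + hv F (dv F y) J = ∑ k, xm F k (um F k (y J)) := h1
  rw [h, map_zero, Pi.zero_apply, add_zero, sum_xm_um F _ (hy J).1.2] at h2
  exact h2

lemma SD_aux {m : ℕ} {F : FreeComplex K (m + 1)} {i : ℕ} {c : ℤ} (H : ∀ k : ℕ, HE F (i + k) (c - 1 - k)) (q : ℕ) :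
    q ≤ m → ∀ b ∈ AT F (c - (m + 1)) (i + (m - q) + 1) q, dh F (dv F b) = 0 →
    ∃ u ∈ AT F (c - (m + 1)) (i + (m - q)) q, dv F b = dv F (dh F u) := by
  -- solve a pointwise equation
  have solve : ∀ q : ℕ, q ≤ m → ∀ b ∈ AT F (c - (m + 1)) (i + (m - q) + 1) q, dh F b = 0 →
      ∃ u ∈ AT F (c - (m + 1)) (i + (m - q)) q, dh F u = b := by
    intro q hq b hb hD
    have hk := H (m - q)
    have e1 : (i : ℤ) + (m - q : ℕ) = i + (m - q) := by push_cast [hq]; ring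
    have e2 : c - 1 - (m - q : ℕ) = c - (m + 1) + q := by push_cast [hq]; ring
    rw [e1, e2] at hk
    have : ∀ J, ∃ v ∈ WT F (i + (m - q)) (c - (m + 1) + q), DT F v = b J := by
      intro J
      obtain ⟨v, hv, hv0, hvD⟩ := hk (b J) (hb J).1.1 (by rw [← dh_apply, hD]; rfl)
      exact ⟨v, ⟨hv, hv0⟩, hvD⟩
    choose U hU hUD using this
    refine ⟨fun J => if J.card = q then U J else 0, fun J => ⟨?_, fun h => if_neg h⟩, ?_⟩
    · dsimp only
      split_ifs
      · exact hU J
      · exact Submodule.zero_mem _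
    · funext J
      rw [dh_apply]
      split_ifs with h
      · exact hUD J
      · rw [map_zero, (hb J).2 h]
  induction q with
  | zero =>
    intro hq b hb hD
    rw [dh_dv] at hD
    have h1 := dv_exact (dh_mem hb) hD
    rw [hv_zero (dh_mem hb), map_zero] at h1
    obtain ⟨u, hu, hub⟩ := solve 0 hq b hb h1.symm
    exact ⟨u, hu, by rw [hub]⟩
  | succ q ih =>
    intro hq b hb hD
    rw [dh_dv] at hD
    have h1 := dv_exact (dh_mem hb) hD
    have hb' := hv_mem (dh_mem hb)
    have e : (i : ℤ) + (m - (q + 1 : ℕ)) + 1 + 1 = i + (m - q) + 1 := by push_cast; ring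
    have e' : (i : ℤ) + (m - (q + 1 : ℕ)) + 1 = i + (m - q) := by push_cast; ring
    rw [e] at hb'
    obtain ⟨u', hu', hu'D⟩ := ih (by omega) _ hb' (by rw [h1, dh_dh])
    rw [h1, ← dh_dv] at hu'D
    have hdu := dv_mem hu'
    rw [← e'] at hdu
    obtain ⟨u, hu, hub⟩ := solve (q + 1) hq (b - dv F u') (Submodule.sub_mem _ hb hdu) (by
      rw [map_sub, hu'D, sub_self])
    refine ⟨u, hu, ?_⟩
    rw [hub, map_sub, dv_dv, sub_zero]

lemma SD_HE {m : ℕ} {F : FreeComplex K (m + 1)} {i : ℕ} {c : ℤ} (H : ∀ k : ℕ, HE F (i + k) (c - 1 - k)) :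
    HE F i c := by
  intro w hw hD
  have hw0 : w ∅ = 0 := by
    funext j
    exact VT_zero hw (by simp; omega)
  let a : YYT F := Pi.single univ w
  have hau : a univ = w := by simp [a]
  have haz : ∀ J, J ≠ univ → a J = 0 := fun J hJ => by simp [a, hJ]
  have ecc : c - (m + 1) + (m + 1 : ℕ) = c := by push_cast; ring
  have ha : a ∈ AT F (c - (m + 1)) (i + 1) (m + 1) := by
    intro J
    rw [ecc]
    by_cases hJ : J = univ
    · subst hJ
      rw [hau]
      exact ⟨⟨hw, hw0⟩, fun h => absurd (by simp) h⟩
    · rw [haz J hJ]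
      exact ⟨Submodule.zero_mem _, fun _ => rfl⟩
  have hda : dv F a = 0 := by
    funext J
    exact (dv_mem ha J).2 (by
      have := Finset.card_le_univ J
      rw [Fintype.card_fin] at this
      omega)
  have hha : dh F a = 0 := by
    funext J
    rw [dh_apply]
    by_cases hJ : J = univ
    · rw [hJ, hau, hD]; rfl
    · rw [haz J hJ, map_zero]; rfl
  have h1 := dv_exact ha hda
  have hb := hv_mem ha
  have e : (i : ℤ) + 1 = i + (m - (m : ℕ)) + 1 := by ring
  rw [e] at hb
  obtain ⟨u, hu, hud⟩ := SD_aux H m le_rfl (hv F a) hb (by rw [h1, hha])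
  rw [h1, ← dh_dv] at hud
  have hdu := dv_mem hu univ
  rw [ecc, sub_self, add_zero] at hdu
  refine ⟨dv F u univ, hdu.1.1, hdu.1.2, ?_⟩
  rw [← dh_apply, ← hud, hau]

lemma SD_sheafH {m : ℕ} {F : FreeComplex K (m + 1)} (hres : IsResolution F) (i : ℕ) (c : ℤ)
    (h : sheafH F i c ≠ 0) : ∃ k : ℕ, sheafH F (i + k) (c - 1 - k) ≠ 0 := by
  by_contra hc
  push Not at hc
  apply h
  rw [HE_iff hres]
  apply SD_HE
  intro k
  have := (HE_iff hres (i + k) (c - 1 - k)).1 (hc k)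
  rwa [Nat.cast_add] at this

lemma sheafH_zero_eq {m : ℕ} {F : FreeComplex K (m + 1)} (hres : IsResolution F) (d : ℤ) :
    (sheafH F 0 d : ℚ) = (MPieceDim F d : ℚ) - cohomDim (dualCo F) (m + 1) (-d - (m + 1 : ℕ))
      + cohomDim (dualCo F) m (-d - (m + 1 : ℕ)) := by
  unfold sheafH
  rw [if_pos rfl]
  have e1 : extDim F ((m + 1 : ℕ) : ℤ) (-d - (m + 1 : ℕ)) =
      cohomDim (dualCo F) (m + 1) (-d - (m + 1 : ℕ)) := by
    unfold extDim; rw [if_pos (by positivity)]; rfl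
  have e2 : extDim F (((m + 1 : ℕ) : ℤ) - 1) (-d - (m + 1 : ℕ)) =
      cohomDim (dualCo F) m (-d - (m + 1 : ℕ)) := by
    unfold extDim; rw [if_pos (by push_cast; omega)]
    congr 1
    push_cast; omega
  rw [e1, e2, Nat.cast_add, Nat.cast_sub (ext_n_le hres d)]

lemma sheafH_pos_eq {m : ℕ} (F : FreeComplex K (m + 1)) (i : ℕ) (h0 : i ≠ 0) (hi : i ≤ m)
    (d : ℤ) : sheafH F i d = cohomDim (dualCo F) (m - i) (-d - (m + 1 : ℕ)) := by
  unfold sheafH extDim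
  rw [if_neg h0, if_pos (by push_cast; omega)]
  congr 1
  push_cast; omega

lemma sheafH_big {m : ℕ} (F : FreeComplex K (m + 1)) (i : ℕ) (hi : m + 1 ≤ i)
    (d : ℤ) : sheafH F i d = 0 := by
  unfold sheafH extDim
  rw [if_neg (by omega), if_neg (by push_cast; omega)]

lemma cohomDim_len {F : FreeComplex K n} (j : ℕ) (hj : F.len < j) (e : ℤ) :
    cohomDim (dualCo F) j e = 0 := by
  apply cohomDim_eq_zero_of_small
  intro p
  have h : (dualCo F).rk j = 0 := (dualCo F).rk_eq_zero j hj
  exact absurd p.2 (by omega)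

lemma chi_eq {m : ℕ} (F : FreeComplex K (m + 1)) (hres : IsResolution F) (d : ℤ) :
    (hilbPoly F).eval (d : ℚ) = ∑ i ∈ range (m + 1), (-1 : ℚ) ^ i * sheafH F i d := by
  rw [hilbPoly_eval F hres d]
  set f : ℕ → ℚ := fun j => (-1 : ℚ) ^ j * cohomDim (dualCo F) j (-d - (m + 1 : ℕ)) with hf
  have hsum : ∑ j ∈ range (F.len + 1), f j = ∑ j ∈ range (m + 2), f j := by
    have a1 : ∑ j ∈ range (F.len + 1), f j = ∑ j ∈ range (max (F.len + 1) (m + 2)), f j := by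
      apply sum_subset
      · intro x hx; simp only [mem_range, lt_max_iff] at *; exact Or.inl hx
      · intro x _ hx
        simp only [mem_range] at hx
        simp only [hf]
        rw [cohomDim_len x (by omega)]; simp
    have a2 : ∑ j ∈ range (m + 2), f j = ∑ j ∈ range (max (F.len + 1) (m + 2)), f j := by
      apply sum_subset
      · intro x hx; simp only [mem_range, lt_max_iff] at *; exact Or.inr hx
      · intro x _ hx
        simp only [mem_range] at hx
        simp only [hf]
        rw [cohom_big hres d x (by omega)]; simp
    rw [a1, a2]
  rw [hsum, sum_range_succ, sum_range_succ, sum_range_succ', sheafH_zero_eq hres,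
    ← sum_range_reflect]
  have hs : ∑ i ∈ range m, (-1 : ℚ) ^ (i + 1) * (sheafH F (i + 1) d : ℚ)
      = (-1) ^ m * ∑ j ∈ range m, f (m - 1 - j) := by
    rw [mul_sum]
    apply sum_congr rfl
    intro i hi
    rw [mem_range] at hi
    obtain ⟨k, rfl⟩ : ∃ k, m = i + 1 + k := ⟨m - (i + 1), by omega⟩
    rw [sheafH_pos_eq F (i + 1) (by omega) (by omega)]
    simp only [hf]
    rw [show i + 1 + k - (i + 1) = k by omega, show i + 1 + k - 1 - i = k by omega, ← mul_assoc]
    congr 1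
    rw [pow_add (-1 : ℚ) (i + 1) k, mul_assoc, ← mul_pow]
    norm_num
  rw [hs]
  simp only [hf]
  have hsq : ((-1 : ℚ) ^ m) * (-1) ^ m = 1 := by rw [← mul_pow]; norm_num
  rw [pow_succ (-1 : ℚ) m, pow_zero]
  linear_combination ((cohomDim (dualCo F) m (-d - (m + 1 : ℕ)) : ℚ) -
    cohomDim (dualCo F) (m + 1) (-d - (m + 1 : ℕ))) * hsq

lemma sheafRank_eq (F : FreeComplex K n) {s : ℕ} (z : Fin s → ℤ) (a : ℚ)
    (hP : hilbPoly F = Polynomial.C a * ∏ i : Fin s, (Polynomial.X - Polynomial.C ((z i : ℚ)))) :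
    sheafRank F s / s.factorial = a := by
  have hm : (∏ i : Fin s, (Polynomial.X - Polynomial.C ((z i : ℚ)))).Monic :=
    Polynomial.monic_prod_of_monic _ _ fun i _ => Polynomial.monic_X_sub_C _
  have hd : (∏ i : Fin s, (Polynomial.X - Polynomial.C ((z i : ℚ)))).natDegree = s := by
    rw [Polynomial.natDegree_prod_of_monic _ _ fun i _ => Polynomial.monic_X_sub_C _]
    simp only [Polynomial.natDegree_X_sub_C, sum_const, card_univ, Fintype.card_fin, smul_eq_mul,
      mul_one]
  unfold sheafRank
  rw [hP, Polynomial.coeff_C_mul]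
  have h1 : (∏ i : Fin s, (Polynomial.X - Polynomial.C ((z i : ℚ)))).coeff s = 1 := by
    have := hm.coeff_natDegree
    rwa [hd] at this
  rw [h1]
  have : (s.factorial : ℚ) ≠ 0 := by exact_mod_cast s.factorial_ne_zero
  field_simp

/-- Let `𝓔` be a coherent sheaf on `ℙ^m` (associated to
`coker (F₁ → F₀)`) with supernatural cohomology, of dimension `s`, with root
sequence `z_1 > ⋯ > z_s` (conventions `z_0 = +∞`, `z_{s+1} = -∞`). Then for each
`0 ≤ j ≤ s` and each `d`: `h^j(𝓔(d)) = (rank 𝓔 / s!) ∏_{i=1}^s |d - z_i|` if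
`z_j > d > z_{j+1}`, and `h^j(𝓔(d)) = 0` otherwise. -/
theorem supernatural_cohomology_values (K : Type) [Field K] (m : ℕ)
    (F : FreeComplex K (m + 1)) (hres : IsResolution F)
    (s : ℕ) (z : Fin s → ℤ) (hsn : IsSupernaturalWithRoots F z) :
    ∀ j : ℕ, j ≤ s → ∀ d : ℤ,
      (sheafH F j d : ℚ) =
        if (∀ i : Fin s, (i : ℕ) < j → d < z i) ∧ (∀ i : Fin s, j ≤ (i : ℕ) → z i < d) then
          (sheafRank F s / s.factorial) * ∏ i : Fin s, |(d : ℚ) - (z i : ℚ)|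
        else 0 := by
  obtain ⟨hz, hnat, a, ha, hP⟩ := hsn
  intro j hj d
  rw [sheafRank_eq F z a hP]
  refine combi (sheafH F) (m + 1) s z hz hnat a ha ?_ (fun i d hi => sheafH_big F i hi d)
    (SD_sheafH hres) ?_ j hj d
  · intro d
    rw [← chi_eq F hres d, hP]
    simp [Polynomial.eval_prod]
  · intro i d hi
    by_cases him : i ≤ m
    · rw [sheafH_pos_eq F i (by omega) him]
      exact vanF F hres z a hP (m - i) (by omega) _
    · exact sheafH_big F i (by omega) d

end
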